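/- Let n ≥ 1 and let ν > −1/2 and μ > −1/2 be real. Set Z := ∫_{{g ∈ M_{2n}(ℝ) : I − g gᵀ is positive definite}} (det g gᵀ)^ν · det(I − g gᵀ)^μ dg. Then, for every invariant test function φ, (1/Z) · ∫_{{g : I − g gᵀ > 0}} φ(g · D(1) · gᵀ) · (det g gᵀ)^ν · det(I − g gᵀ)^μ dg = ∫_{(0,1)ⁿ} φ(D(a)) · p(a) da, where p(a) = [1/(2^{n(n−1)/2} n!)] · (∏_{j=1}^n Γ(2ν+2μ+2n+2j)/(Γ(j)·Γ(2ν+2j−1)·Γ(2μ+2n+2−j))) · Δ_n(a²) · Δ_n(a) · ∏_{j=1}^n a_j^{2ν} (1−a_j)^{2μ+n+1}. In particular, p is a probability density on (0,1)ⁿ (the Jacobi Muttalib–Borodin ensemble with θ = 2). -/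

import Mathlib

open MeasureTheory Matrix
open scoped BigOperators

noncomputable section

instance matrixMeasurableSpace {l : Type*} [Fintype l] : MeasurableSpace (Matrix l l ℝ) :=
  inferInstanceAs (MeasurableSpace (l → l → ℝ))

/-- The `2n × 2n` real antisymmetric matrix `D(a) = diag(a₁ J, …, aₙ J)`,
`J = [[0,1],[-1,0]]`. -/
def Dmat {n : ℕ} (a : Fin n → ℝ) : Matrix (Fin (2 * n)) (Fin (2 * n)) ℝ :=
  Matrix.of fun i j =>
    if i.val / 2 = j.val / 2 then
      a ⟨i.val / 2, by have := i.isLt; omega⟩ *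
        (if i.val % 2 = 0 ∧ j.val % 2 = 1 then 1
          else if i.val % 2 = 1 ∧ j.val % 2 = 0 then -1 else 0)
    else 0

/-- Vandermonde product `Δ_m(x) = ∏_{j<k} (x_k - x_j)`. -/
def vdm {m : ℕ} {R : Type*} [CommRing R] (x : Fin m → R) : R :=
  ∏ p ∈ Finset.univ.filter (fun p : Fin m × Fin m => p.1 < p.2), (x p.2 - x p.1)

/-- A bounded measurable `O(m)`-invariant test function on antisymmetric matrices. -/
def IsInvTest (m : ℕ) (φ : Matrix (Fin m) (Fin m) ℝ → ℝ) : Prop :=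
  Measurable φ ∧ (∃ C, ∀ X, |φ X| ≤ C) ∧
    ∀ X : Matrix (Fin m) (Fin m) ℝ, Xᵀ = -X →
      ∀ k ∈ Matrix.orthogonalGroup (Fin m) ℝ, φ (k * X * kᵀ) = φ X

/-- The (unnormalized) induced real Jacobi density `(det ggᵀ)^ν det(1-ggᵀ)^μ` in
coordinates. -/
def jacDens (n : ℕ) (ν μ : ℝ) (u : Fin (2 * n) → Fin (2 * n) → ℝ) : ℝ :=
  ((Matrix.of u * (Matrix.of u)ᵀ).det) ^ ν * ((1 - Matrix.of u * (Matrix.of u)ᵀ).det) ^ μ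

/-- The Jacobi domain `{g : 1 - ggᵀ positive definite}` in coordinates. -/
def jacDom (n : ℕ) : Set (Fin (2 * n) → Fin (2 * n) → ℝ) :=
  {u | (1 - Matrix.of u * (Matrix.of u)ᵀ).PosDef}

/-- The Jacobi Muttalib–Borodin density with `θ = 2`. -/
def jacMB (n : ℕ) (ν μ : ℝ) (a : Fin n → ℝ) : ℝ :=
  (1 / ((2 : ℝ) ^ (n * (n - 1) / 2) * (Nat.factorial n : ℝ))) *
    (∏ j ∈ Finset.range n,
      Real.Gamma (2 * ν + 2 * μ + 2 * n + 2 * ((j : ℝ) + 1)) /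
        (Real.Gamma ((j : ℝ) + 1) * Real.Gamma (2 * ν + 2 * ((j : ℝ) + 1) - 1) *
          Real.Gamma (2 * μ + 2 * n + 2 - ((j : ℝ) + 1)))) *
    (vdm fun j => (a j) ^ 2) * (vdm a) *
    ∏ j, (a j) ^ (2 * ν) * (1 - a j) ^ (2 * μ + n + 1)

set_option linter.all false

section

abbrev OG (N : ℕ) := ↥(Matrix.orthogonalGroup (Fin N) ℝ)

instance matBorel (N : ℕ) : BorelSpace (Matrix (Fin N) (Fin N) ℝ) :=
  inferInstanceAs (BorelSpace (Fin N → Fin N → ℝ))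

instance matSecond (N : ℕ) : SecondCountableTopology (Matrix (Fin N) (Fin N) ℝ) :=
  inferInstanceAs (SecondCountableTopology (Fin N → Fin N → ℝ))

lemma og_mul_tr {N : ℕ} (k : OG N) : k.1 * k.1ᵀ = 1 := by
  have := (Matrix.mem_orthogonalGroup_iff (Fin N) ℝ).1 k.2
  exact this

lemma og_tr_mul {N : ℕ} (k : OG N) : k.1ᵀ * k.1 = 1 := by
  have := (Matrix.mem_orthogonalGroup_iff' (Fin N) ℝ).1 k.2
  exact this

instance ogCompact (N : ℕ) : CompactSpace (OG N) := by
  apply isCompact_iff_compactSpace.1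
  have hcl : IsClosed (Matrix.orthogonalGroup (Fin N) ℝ : Set (Matrix (Fin N) (Fin N) ℝ)) :=
    isClosed_unitary
  have hsub : (Matrix.orthogonalGroup (Fin N) ℝ : Set (Matrix (Fin N) (Fin N) ℝ)) ⊆
      Set.pi Set.univ (fun _ => Set.pi Set.univ (fun _ => Set.Icc (-1 : ℝ) 1)) := by
    intro k hk i _ j _
    have h1 := og_mul_tr ⟨k, hk⟩
    have h2 := congrFun (congrFun h1 i) i
    simp only [Matrix.mul_apply, Matrix.transpose_apply, Matrix.one_apply_eq] at h2
    have h3 : k i j * k i j ≤ 1 := by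
      rw [← h2]
      exact Finset.single_le_sum (f := fun j => k i j * k i j)
        (fun j _ => mul_self_nonneg _) (Finset.mem_univ j)
    exact abs_le.1 (abs_le_one_iff_mul_self_le_one.2 h3)
  have hc : IsCompact (Set.pi Set.univ (fun _ : Fin N => Set.pi Set.univ
      (fun _ : Fin N => Set.Icc (-1 : ℝ) 1))) :=
    isCompact_univ_pi fun _ => isCompact_univ_pi fun _ => isCompact_Icc
  exact hc.of_isClosed_subset hcl hsub

def hK (N : ℕ) : Measure (OG N) := Measure.haarMeasure ⊤

instance hKhaar (N : ℕ) : (hK N).IsHaarMeasure := by unfold hK; infer_instance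

instance hKprob (N : ℕ) : IsProbabilityMeasure (hK N) := ⟨by
  have := Measure.haarMeasure_self (K₀ := (⊤ : TopologicalSpace.PositiveCompacts (OG N)))
  simpa [hK] using this⟩

instance hKright (N : ℕ) : (hK N).IsMulRightInvariant := ⟨fun g => by
  have : IsProbabilityMeasure (Measure.map (· * g) (hK N)) :=
    Measure.isProbabilityMeasure_map (by fun_prop)
  exact Measure.isHaarMeasure_eq_of_isProbabilityMeasure _ _⟩

lemma contK_integrable {N : ℕ} {f : OG N → ℝ} (hf : Continuous f) : Integrable f (hK N) :=
  hf.integrable_of_hasCompactSupport (HasCompactSupport.of_compactSpace f)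

/-- volume is preserved by an orthogonal matrix -/
lemma og_vecMul_mp {N : ℕ} (k : OG N) :
    MeasurePreserving (fun x : Fin N → ℝ => x ᵥ* k.1) volume volume := by
  have h1 : (k.1ᵀ).det ^ 2 = 1 := by
    have := congrArg Matrix.det (og_mul_tr k)
    rw [Matrix.det_mul, Matrix.det_transpose, Matrix.det_one] at this
    rw [Matrix.det_transpose, sq]; exact this
  have h0 : (k.1ᵀ).det ≠ 0 := by
    intro h; rw [h] at h1; norm_num at h1
  have h2 := Real.map_matrix_volume_pi_eq_smul_volume_pi h0
  have h3 : |(k.1ᵀ).det⁻¹| = 1 := by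
    rw [abs_inv]
    have h4 : |(k.1ᵀ).det| = 1 := by
      have := sq_abs (k.1ᵀ).det
      rw [h1] at this
      nlinarith [abs_nonneg (k.1ᵀ).det]
    rw [h4]; norm_num
  refine ⟨?_, ?_⟩
  · have : Continuous (fun x : Fin N → ℝ => x ᵥ* k.1) := by fun_prop
    exact this.measurable
  · rw [h3] at h2
    simp only [ENNReal.ofReal_one, one_smul] at h2
    have h5 : (fun x : Fin N → ℝ => x ᵥ* k.1) = ⇑(Matrix.toLin' (k.1)ᵀ) := by
      funext x
      rw [Matrix.toLin'_apply, Matrix.mulVec_transpose]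
    rw [h5]; exact h2

lemma dot_vecMul_og {N : ℕ} (k : OG N) (x : Fin N → ℝ) : (x ᵥ* k.1) ⬝ᵥ (x ᵥ* k.1) = x ⬝ᵥ x := by
  rw [← Matrix.mulVec_transpose, Matrix.dotProduct_mulVec, Matrix.vecMul_transpose,
    Matrix.mulVec_mulVec, og_mul_tr, Matrix.one_mulVec]

lemma og_of_onb {N : ℕ} (b : OrthonormalBasis (Fin N) ℝ (EuclideanSpace ℝ (Fin N))) :
    (Matrix.of fun i j => b i j) ∈ Matrix.orthogonalGroup (Fin N) ℝ := by
  rw [Matrix.mem_orthogonalGroup_iff]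
  ext i j
  have := orthonormal_iff_ite.1 b.orthonormal i j
  rw [PiLp.inner_apply] at this
  simp only [Matrix.star_eq_conjTranspose, Matrix.mul_apply, Matrix.conjTranspose_apply,
    Matrix.of_apply, Matrix.one_apply]
  rw [← this]
  apply Finset.sum_congr rfl
  intro k _
  simp [mul_comm]

lemma og_trans {N : ℕ} (x : Fin N → ℝ) (e : Fin N) :
    ∃ k : OG N, x = Real.sqrt (x ⬝ᵥ x) • k.1 e := by
  by_cases hx : x = 0
  · exact ⟨1, by simp [hx]⟩
  have hd : x ⬝ᵥ x = ‖(WithLp.toLp 2 x : EuclideanSpace ℝ (Fin N))‖ ^ 2 := by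
    rw [EuclideanSpace.norm_sq_eq]
    simp [dotProduct, sq]
  set y : EuclideanSpace ℝ (Fin N) := WithLp.toLp 2 x with hy
  have hy0 : ‖y‖ ≠ 0 := by
    simpa [hy] using hx
  have hon : Orthonormal ℝ (Set.domRestrict {e} (fun _ : Fin N => ‖y‖⁻¹ • y)) := by
    rw [orthonormal_iff_ite]
    rintro ⟨i, hi⟩ ⟨j, hj⟩
    have hij : (⟨i, hi⟩ : ({e} : Set (Fin N))) = ⟨j, hj⟩ := Subsingleton.elim _ _
    rw [if_pos hij]
    change inner ℝ (‖y‖⁻¹ • y) (‖y‖⁻¹ • y) = 1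
    rw [real_inner_self_eq_norm_sq, norm_smul, norm_inv, norm_norm, inv_mul_cancel₀ hy0]
    norm_num
  obtain ⟨b, hb⟩ := hon.exists_orthonormalBasis_extension_of_card_eq (by simp)
  refine ⟨⟨_, og_of_onb b⟩, ?_⟩
  have h1 := hb e rfl
  rw [hd, Real.sqrt_sq (norm_nonneg _)]
  funext i
  simp only [Pi.smul_apply, Matrix.of_apply, h1, smul_eq_mul, PiLp.smul_apply]
  rw [← mul_assoc, mul_inv_cancel₀ hy0, one_mul]

end

section

def mom (N : ℕ) (e : Fin N) (m : Fin N → ℕ) : ℝ := ∫ k : OG N, ∏ i, ((k.1 e i) ^ 2) ^ (m i) ∂(hK N)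

lemma og_cont {N : ℕ} (i j : Fin N) : Continuous fun k : OG N => k.1 i j :=
  continuous_subtype_val.matrix_elem i j

def gmom (s : ℕ) : ℝ := ∫ x : ℝ, (x ^ 2) ^ s * Real.exp (-(x * x))

lemma gmom_integrable (s : ℕ) : Integrable (fun x : ℝ => (x ^ 2) ^ s * Real.exp (-(x * x))) := by
  have h := integrable_rpow_mul_exp_neg_mul_sq (b := 1) one_pos (s := ((2 * s : ℕ) : ℝ))
    (by have : (0:ℝ) ≤ ((2 * s : ℕ) : ℝ) := by positivity
        linarith)
  refine h.congr (Filter.Eventually.of_forall fun x => ?_)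
  simp only [Real.rpow_natCast]
  rw [pow_mul]; congr 2; ring

lemma gmom_pos (s : ℕ) : 0 < gmom s := by
  unfold gmom
  rw [integral_pos_iff_support_of_nonneg (fun x => by positivity) (gmom_integrable s)]
  have : Set.Ioi (0:ℝ) ⊆ Function.support (fun x : ℝ => (x ^ 2) ^ s * Real.exp (-(x * x))) := by
    intro x hx
    have hx : 0 < x := hx
    simp only [Function.mem_support]; positivity
  refine lt_of_lt_of_le ?_ (measure_mono this)
  simp

lemma gmom_succ (s : ℕ) : gmom (s + 1) = (2 * s + 1) / 2 * gmom s := by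
  have hd : ∀ x : ℝ, HasDerivAt (fun x : ℝ => x * (x ^ 2) ^ s * Real.exp (-(x * x)))
      ((2 * s + 1) * ((x ^ 2) ^ s * Real.exp (-(x * x))) -
        2 * ((x ^ 2) ^ (s + 1) * Real.exp (-(x * x)))) x := by
    intro x
    have h1 : HasDerivAt (fun x : ℝ => x ^ (2 * s + 1)) (((2 * s + 1 : ℕ) : ℝ) * x ^ (2 * s)) x := by
      simpa using hasDerivAt_pow (2 * s + 1) x
    have h2 : HasDerivAt (fun x : ℝ => Real.exp (-(x * x)))
        (Real.exp (-(x * x)) * (-(1 * x + x * 1))) x :=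
      (((hasDerivAt_id x).mul (hasDerivAt_id x)).neg).exp
    have h3 := h1.mul h2
    refine (h3.congr_deriv ?_).congr_of_eventuallyEq (Filter.Eventually.of_forall fun y => ?_)
    · push_cast; ring
    · simp only [Pi.mul_apply]; ring
  have hi : Integrable (fun x : ℝ => (2 * s + 1) * ((x ^ 2) ^ s * Real.exp (-(x * x))) -
        2 * ((x ^ 2) ^ (s + 1) * Real.exp (-(x * x)))) :=
    ((gmom_integrable s).const_mul _).sub ((gmom_integrable (s+1)).const_mul _)
  have hf : Integrable (fun x : ℝ => x * (x ^ 2) ^ s * Real.exp (-(x * x))) := by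
    have h := integrable_rpow_mul_exp_neg_mul_sq (b := 1) one_pos (s := ((2 * s + 1 : ℕ) : ℝ))
      (by have : (0:ℝ) ≤ ((2 * s + 1 : ℕ) : ℝ) := by positivity
          linarith)
    refine h.congr (Filter.Eventually.of_forall fun x => ?_)
    simp only [Real.rpow_natCast]
    rw [pow_add, pow_mul, pow_one, mul_comm _ x]; congr 2; ring
  have h0 := integral_eq_zero_of_hasDerivAt_of_integrable hd hi hf
  rw [integral_sub ((gmom_integrable s).const_mul _) ((gmom_integrable (s+1)).const_mul _),
    integral_const_mul, integral_const_mul] at h0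
  unfold gmom
  linarith

lemma exp_dot {N : ℕ} (x : Fin N → ℝ) : Real.exp (-(x ⬝ᵥ x)) = ∏ i, Real.exp (-(x i * x i)) := by
  rw [← Real.exp_sum]; simp [dotProduct]

lemma gauss_mono_integrable {N : ℕ} (m : Fin N → ℕ) :
    Integrable (fun x : Fin N → ℝ => (∏ i, ((x i) ^ 2) ^ (m i)) * Real.exp (-(x ⬝ᵥ x))) := by
  simp_rw [exp_dot, ← Finset.prod_mul_distrib]
  exact Integrable.fintype_prod (f := fun i (x : ℝ) => (x ^ 2) ^ (m i) * Real.exp (-(x * x)))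
    (fun i => gmom_integrable (m i))

lemma gauss_mono {N : ℕ} (m : Fin N → ℕ) :
    ∫ x : Fin N → ℝ, (∏ i, ((x i) ^ 2) ^ (m i)) * Real.exp (-(x ⬝ᵥ x)) = ∏ i, gmom (m i) := by
  simp_rw [exp_dot, ← Finset.prod_mul_distrib]
  exact integral_fintype_prod_volume_eq_prod
    (f := fun i (x : ℝ) => (x ^ 2) ^ (m i) * Real.exp (-(x * x)))

lemma dot_nonneg {N : ℕ} (x : Fin N → ℝ) : 0 ≤ x ⬝ᵥ x :=
  Finset.sum_nonneg fun i _ => mul_self_nonneg _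

/-- the main polar identity -/
lemma mom_polar {N : ℕ} (e : Fin N) (m : Fin N → ℕ) :
    ENNReal.ofReal (∏ i, gmom (m i)) =
      (∫⁻ x : Fin N → ℝ, ENNReal.ofReal ((x ⬝ᵥ x) ^ (∑ i, m i) * Real.exp (-(x ⬝ᵥ x)))) *
        ENNReal.ofReal (mom N e m) := by
  have hnn : ∀ x : Fin N → ℝ, 0 ≤ (∏ i, ((x i) ^ 2) ^ (m i)) * Real.exp (-(x ⬝ᵥ x)) :=
    fun x => by positivity
  rw [← gauss_mono, ofReal_integral_eq_lintegral_ofReal (gauss_mono_integrable m)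
    (Filter.Eventually.of_forall hnn)]
  set F : (Fin N → ℝ) → ENNReal := fun x =>
    ENNReal.ofReal ((∏ i, ((x i) ^ 2) ^ (m i)) * Real.exp (-(x ⬝ᵥ x))) with hF
  have hFm : Measurable F := by
    apply ENNReal.measurable_ofReal.comp
    apply Continuous.measurable
    unfold dotProduct
    fun_prop
  have h1 : ∫⁻ x, F x = ∫⁻ k : OG N, ∫⁻ x, F (x ᵥ* k.1) ∂volume ∂(hK N) := by
    have : ∀ k : OG N, ∫⁻ x, F (x ᵥ* k.1) = ∫⁻ x, F x := fun k =>
      (og_vecMul_mp k).lintegral_comp hFm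
    simp_rw [this]
    simp
  rw [h1, lintegral_lintegral_swap]
  · rw [← lintegral_mul_const' _ _ ENNReal.ofReal_ne_top]
    apply lintegral_congr
    intro x
    obtain ⟨k0, hk0⟩ := og_trans x e
    have h2 : ∀ k : OG N, F (x ᵥ* k.1) =
        ENNReal.ofReal ((x ⬝ᵥ x) ^ (∑ i, m i) * Real.exp (-(x ⬝ᵥ x))) *
          ENNReal.ofReal (∏ i, (((k0 * k : OG N).1 e i) ^ 2) ^ (m i)) := by
      intro k
      rw [← ENNReal.ofReal_mul (mul_nonneg (pow_nonneg (dot_nonneg x) _) (Real.exp_nonneg _))]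
      simp only [hF, dot_vecMul_og]
      congr 1
      have h3 : ∀ i, ((x ᵥ* k.1) i) ^ 2 = (x ⬝ᵥ x) * ((k0 * k : OG N).1 e i) ^ 2 := by
        intro i
        have : (x ᵥ* k.1) i = Real.sqrt (x ⬝ᵥ x) * ((k0 * k : OG N).1 e i) := by
          conv_lhs => rw [hk0]
          rw [Matrix.smul_vecMul]
          simp only [Pi.smul_apply, smul_eq_mul]
          rfl
        rw [this, mul_pow, Real.sq_sqrt (dot_nonneg x)]
      simp_rw [h3, mul_pow, Finset.prod_mul_distrib, Finset.prod_pow_eq_pow_sum]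
      ring
    simp_rw [h2]
    rw [lintegral_const_mul' _ _ ENNReal.ofReal_ne_top]
    congr 1
    rw [lintegral_mul_left_eq_self (μ := hK N)
      (fun k : OG N => ENNReal.ofReal (∏ i, ((k.1 e i) ^ 2) ^ (m i))) k0]
    rw [← ofReal_integral_eq_lintegral_ofReal]
    · rfl
    · apply contK_integrable
      exact continuous_finset_prod _ fun i _ => ((og_cont e i).pow 2).pow _
    · exact Filter.Eventually.of_forall fun k => by positivity
  · apply Measurable.aemeasurable
    apply hFm.comp
    apply Continuous.measurable
    fun_prop

lemma radial_fin (N s : ℕ) :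
    (∫⁻ x : Fin N → ℝ, ENNReal.ofReal ((x ⬝ᵥ x) ^ s * Real.exp (-(x ⬝ᵥ x)))) ≠ ⊤ := by
  have hi : Integrable (fun x : Fin N → ℝ => (2 ^ s * s.factorial : ℝ) * ∏ i, Real.exp (-(1/2) * (x i) ^ 2)) :=
    (Integrable.fintype_prod (f := fun (i : Fin N) (x : ℝ) => Real.exp (-(1/2) * x ^ 2))
      (fun i => integrable_exp_neg_mul_sq (by norm_num))).const_mul _
  refine ne_top_of_le_ne_top hi.lintegral_lt_top.ne (lintegral_mono fun x => ?_)
  apply ENNReal.ofReal_le_ofReal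
  have h0 := dot_nonneg x
  have h1 := Real.pow_div_factorial_le_exp (x ⬝ᵥ x / 2) (by linarith) s
  have h2 : ∏ i, Real.exp (-(1/2) * (x i) ^ 2) = Real.exp (-(x ⬝ᵥ x / 2)) := by
    rw [← Real.exp_sum]; congr 1
    simp only [dotProduct, Finset.sum_div, ← Finset.sum_neg_distrib]
    exact Finset.sum_congr rfl fun i _ => by ring
  rw [h2]
  have h3 : Real.exp (-(x ⬝ᵥ x)) = Real.exp (-(x ⬝ᵥ x / 2)) * Real.exp (-(x ⬝ᵥ x / 2)) := by
    rw [← Real.exp_add]; congr 1; ring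
  have h4 : (x ⬝ᵥ x) ^ s ≤ 2 ^ s * s.factorial * Real.exp (x ⬝ᵥ x / 2) := by
    rw [div_pow, div_div, div_le_iff₀ (by positivity)] at h1
    linarith
  calc (x ⬝ᵥ x) ^ s * Real.exp (-(x ⬝ᵥ x))
      ≤ (2 ^ s * s.factorial * Real.exp (x ⬝ᵥ x / 2)) * Real.exp (-(x ⬝ᵥ x)) := by gcongr
    _ = 2 ^ s * s.factorial * Real.exp (-(x ⬝ᵥ x / 2)) * (Real.exp (x ⬝ᵥ x / 2) * Real.exp (-(x ⬝ᵥ x / 2))) := by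
        rw [h3]; ring
    _ = _ := by rw [← Real.exp_add]; simp

lemma mom_rec (N : ℕ) (e : Fin N) : ∃ κ : ℕ → ℝ, (∀ s, 0 < κ s) ∧ ∀ (m : Fin N → ℕ) (i : Fin N),
    mom N e (m + Pi.single i 1) = κ (∑ j, m j) * (2 * m i + 1) * mom N e m := by
  set C : ℕ → ℝ := fun s =>
    (∫⁻ x : Fin N → ℝ, ENNReal.ofReal ((x ⬝ᵥ x) ^ s * Real.exp (-(x ⬝ᵥ x)))).toReal with hC
  have hm0 : ∀ m, 0 ≤ mom N e m := fun m => integral_nonneg fun k => by positivity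
  have key : ∀ m, ∏ i, gmom (m i) = C (∑ i, m i) * mom N e m := by
    intro m
    have h := congrArg ENNReal.toReal (mom_polar e m)
    rw [ENNReal.toReal_mul, ENNReal.toReal_ofReal (hm0 m), ENNReal.toReal_ofReal
      (Finset.prod_nonneg fun i _ => (gmom_pos _).le)] at h
    exact h
  have hCpos : ∀ s, 0 < C s := by
    intro s
    have h := key (Pi.single e s)
    have h1 : 0 < ∏ i, gmom ((Pi.single e s : Fin N → ℕ) i) := Finset.prod_pos fun i _ => gmom_pos _
    rw [h] at h1
    have h2 : ∑ i, (Pi.single e s : Fin N → ℕ) i = s := by simp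
    rw [h2] at h1
    exact pos_of_mul_pos_left h1 (hm0 _)
  refine ⟨fun s => C s / (2 * C (s + 1)), fun s => div_pos (hCpos s) (by have := hCpos (s+1); positivity), ?_⟩
  intro m i
  have h1 := key m
  have h2 := key (m + Pi.single i 1)
  have h3 : ∑ j, (m + Pi.single i 1 : Fin N → ℕ) j = ∑ j, m j + 1 := by
    simp [Finset.sum_add_distrib]
  have h4 : ∏ j, gmom ((m + Pi.single i 1 : Fin N → ℕ) j) = (2 * m i + 1) / 2 * ∏ j, gmom (m j) := by
    rw [← Finset.mul_prod_erase _ _ (Finset.mem_univ i),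
      ← Finset.mul_prod_erase (a := i) _ (fun j => gmom (m j)) (Finset.mem_univ i)]
    simp only [Pi.add_apply, Pi.single_eq_same, gmom_succ]
    rw [mul_assoc]
    congr 2
    apply Finset.prod_congr rfl
    intro j hj
    rw [Pi.single_eq_of_ne (Finset.ne_of_mem_erase hj), add_zero]
  rw [h3, h4, h1] at h2
  have := hCpos (∑ j, m j + 1)
  field_simp
  field_simp at h2
  linarith

end

section

open Polynomial in
lemma det_row_interp {M : ℕ} (P : Fin (M + 1) → ℝ[X]) (s : Finset ℝ)
    (hP : ∀ k, (P k).degree < s.card) (R : Fin M → Fin (M + 1) → ℝ) (T : ℝ) :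
    (Matrix.of (Fin.cons (fun k => (P k).eval T) R : Fin (M + 1) → Fin (M + 1) → ℝ)).det =
      ∑ t ∈ s, (Lagrange.basis s id t).eval T *
        (Matrix.of (Fin.cons (fun k => (P k).eval t) R : Fin (M + 1) → Fin (M + 1) → ℝ)).det := by
  simp_rw [Matrix.det_succ_row_zero, Finset.mul_sum]
  rw [Finset.sum_comm]
  refine Finset.sum_congr rfl fun k _ => ?_
  have h := Lagrange.eq_interpolate (s := s) (v := id) (f := P k) Function.injective_id.injOn (hP k)
  have h2 := congrArg (eval T) h
  rw [Lagrange.interpolate_apply, eval_finsetSum] at h2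
  simp only [eval_mul, eval_C, id] at h2
  have hs : ∀ t : ℝ, ((Matrix.of (Fin.cons (fun k => (P k).eval t) R :
      Fin (M + 1) → Fin (M + 1) → ℝ)).submatrix Fin.succ k.succAbove).det =
      ((Matrix.of R).submatrix id k.succAbove).det := by
    intro t
    congr 1
  simp only [hs]
  simp only [Matrix.of_apply, Fin.cons_zero]
  rw [h2, Finset.mul_sum, Finset.sum_mul]
  refine Finset.sum_congr rfl fun t _ => ?_
  ring_nf

def rho {L : ℕ} (b : Fin L → ℝ) (z : ℝ) : ℝ := ∏ i, (z + b i)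
def rhoi {L : ℕ} (b : Fin L → ℝ) (i : Fin L) (z : ℝ) : ℝ := ∏ l ∈ Finset.univ.erase i, (z + b l)

lemma rho_eq {L : ℕ} (b : Fin L → ℝ) (i : Fin L) (z : ℝ) : rho b z = (z + b i) * rhoi b i z :=
  (Finset.mul_prod_erase _ _ (Finset.mem_univ i)).symm

lemma rhoi_ne {L : ℕ} (b : Fin L → ℝ) (i l : Fin L) (h : i ≠ l) : rhoi b l (- b i) = 0 :=
  Finset.prod_eq_zero (i := i) (by simp [h]) (by ring)

lemma rho_root {L : ℕ} (b : Fin L → ℝ) (i : Fin L) : rho b (- b i) = 0 := by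
  rw [rho_eq b i]; ring

/-- row entries, left -/
def giL {L : ℕ} (b w : Fin L → ℝ) (z : ℝ) (k : ℕ) : ℝ := z ^ k * ∑ i, w i * rhoi b i z
/-- row entries, right -/
def giR {L : ℕ} (b w : Fin L → ℝ) (z : ℝ) (k : ℕ) : ℝ :=
  2 * k * z ^ (k - 1) * rho b z + z ^ k * ∑ i, w i * rhoi b i z

lemma giR_succ {L : ℕ} (b : Fin L → ℝ) (m : Fin L → ℕ) (i : Fin L) (z : ℝ) (k : ℕ) :
    giR b (fun l => 1 + 2 * (m l : ℝ)) z (k + 1) + b i * giR b (fun l => 1 + 2 * (m l : ℝ)) z k =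
      (z + b i) * giR b (fun l => 1 + 2 * (((m + Pi.single i 1 : Fin L → ℕ) l : ℕ) : ℝ)) z k := by
  have h : ∑ l, (1 + 2 * (((m + Pi.single i 1 : Fin L → ℕ) l : ℕ) : ℝ)) * rhoi b l z =
      ∑ l, (1 + 2 * (m l : ℝ)) * rhoi b l z + 2 * rhoi b i z := by
    have : ∀ l, (1 + 2 * (((m + Pi.single i 1 : Fin L → ℕ) l : ℕ) : ℝ)) * rhoi b l z =
      (1 + 2 * (m l : ℝ)) * rhoi b l z + if l = i then 2 * rhoi b l z else 0 := by
      intro l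
      by_cases hl : l = i
      · subst hl; simp; ring
      · simp [hl]
    simp_rw [this, Finset.sum_add_distrib]
    simp
  unfold giR
  rw [h, rho_eq b i]
  rcases k with _ | k
  · simp; ring
  · simp only [Nat.add_sub_cancel]; push_cast; ring

lemma giL_succ {L : ℕ} (b w : Fin L → ℝ) (i : Fin L) (z : ℝ) (k : ℕ) :
    giL b w z (k + 1) + b i * giL b w z k = (z + b i) * giL b w z k := by
  unfold giL; ring

/-- reduction of the determinant with row zero `r * (-β)^k` -/
lemma det_reduce {M : ℕ} (r β : ℝ) (f : Fin M → ℕ → ℝ) :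
    (Matrix.of (Fin.cons (fun k : Fin (M + 1) => r * (-β) ^ (k : ℕ))
      (fun j k => f j (k : ℕ)) : Fin (M + 1) → Fin (M + 1) → ℝ)).det =
      r * (Matrix.of fun j k : Fin M => f j ((k : ℕ) + 1) + β * f j (k : ℕ)).det := by
  set A : Matrix (Fin (M + 1)) (Fin (M + 1)) ℝ := Matrix.of (Fin.cons (fun k : Fin (M + 1) => r * (-β) ^ (k : ℕ))
      (fun j k => f j (k : ℕ)) : Fin (M + 1) → Fin (M + 1) → ℝ) with hA
  set B : Matrix (Fin (M + 1)) (Fin (M + 1)) ℝ := Matrix.of fun i k =>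
    Fin.cases (A i 0) (fun k' => A i k'.succ + β * A i k'.castSucc) k with hB
  have h1 : A.det = B.det := by
    apply Matrix.det_eq_of_forall_col_eq_smul_add_pred (fun _ => -β)
    · intro i; simp [hB]
    · intro i j; simp [hB]
  rw [h1, Matrix.det_succ_row_zero, Fin.sum_univ_succ, Finset.sum_eq_zero, add_zero]
  · have : (B.submatrix Fin.succ (Fin.succAbove 0)) =
      Matrix.of fun j k : Fin M => f j ((k : ℕ) + 1) + β * f j (k : ℕ) := by
      ext j k
      simp [hB, hA]
    rw [this]
    simp [hB, hA]
  · intro j _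
    have : B 0 j.succ = 0 := by
      simp [hB, hA]; ring
    rw [this]; ring

def giLp {L : ℕ} (b w : Fin L → ℝ) (k : ℕ) : Polynomial ℝ :=
  Polynomial.X ^ k * ∑ i, Polynomial.C (w i) * ∏ l ∈ Finset.univ.erase i, (Polynomial.X + Polynomial.C (b l))
def giRp {L : ℕ} (b w : Fin L → ℝ) (k : ℕ) : Polynomial ℝ :=
  Polynomial.C (2 * k : ℝ) * Polynomial.X ^ (k - 1) * ∏ l, (Polynomial.X + Polynomial.C (b l)) + giLp b w k

lemma giLp_eval {L : ℕ} (b w : Fin L → ℝ) (k : ℕ) (z : ℝ) : (giLp b w k).eval z = giL b w z k := by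
  simp [giLp, giL, rhoi, Polynomial.eval_finsetSum, Polynomial.eval_prod]

lemma giRp_eval {L : ℕ} (b w : Fin L → ℝ) (k : ℕ) (z : ℝ) : (giRp b w k).eval z = giR b w z k := by
  simp [giRp, giLp_eval, giL, giR, rho, Polynomial.eval_prod]

lemma degCm (a : ℝ) (p : Polynomial ℝ) : (Polynomial.C a * p).degree ≤ p.degree := by
  rw [← Polynomial.smul_eq_C_mul]; exact Polynomial.degree_smul_le a p

lemma giLp_deg {L : ℕ} (b w : Fin L → ℝ) (k D : ℕ) (h : k + L ≤ D) : (giLp b w k).degree < D := by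
  unfold giLp
  rcases L with _ | L
  · simp only [Finset.univ_eq_empty, Finset.sum_empty, mul_zero, Polynomial.degree_zero]
    exact WithBot.bot_lt_coe _
  apply lt_of_le_of_lt (b := ((k + L : ℕ) : WithBot ℕ))
  · rw [Nat.cast_add]
    refine (Polynomial.degree_mul_le _ _).trans (add_le_add (by simp) ?_)
    refine (Polynomial.degree_sum_le _ _).trans (Finset.sup_le fun i _ => ?_)
    refine (degCm _ _).trans ?_
    rw [Polynomial.degree_prod]
    simp
  · exact_mod_cast (by omega)

lemma giRp_deg {L : ℕ} (b w : Fin L → ℝ) (k D : ℕ) (h : k + L ≤ D) (hD : 0 < D) : (giRp b w k).degree < D := by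
  unfold giRp
  refine lt_of_le_of_lt (Polynomial.degree_add_le _ _) (max_lt ?_ (giLp_deg b w k D h))
  rcases k with _ | k
  · simp only [Nat.cast_zero, mul_zero, map_zero, zero_mul, Polynomial.degree_zero]
    exact WithBot.bot_lt_coe _
  · apply lt_of_le_of_lt (b := ((k + L : ℕ) : WithBot ℕ))
    · rw [show ((k + L : ℕ) : WithBot ℕ) = (k : WithBot ℕ) + (L : WithBot ℕ) from Nat.cast_add k L]
      refine (Polynomial.degree_mul_le _ _).trans (add_le_add ?_ ?_)
      · refine (degCm _ _).trans ?_
        simp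
      · rw [Polynomial.degree_prod]
        simp
    · exact_mod_cast (by omega)

/-- The sphere identity for generic parameters. -/
lemma gi_generic {L : ℕ} (e : Fin L) (κ : ℕ → ℝ)
    (hκ : ∀ (m : Fin L → ℕ) (i : Fin L),
      mom L e (m + Pi.single i 1) = κ (∑ j, m j) * (2 * m i + 1) * mom L e m)
    (b : Fin L → ℝ) (hb : Function.Injective b) (M : ℕ) :
    ∀ (m : Fin L → ℕ) (z : Fin M → ℝ), Function.Injective z → (∀ j i, z j ≠ - b i) →
    ∫ k : OG L, (∏ i, ((k.1 e i) ^ 2) ^ (m i)) *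
        (Matrix.of fun j l : Fin M => giL b (fun i => (k.1 e i) ^ 2) (z j) l).det ∂(hK L) =
      (∏ t ∈ Finset.range M, κ (∑ i, m i + t)) * mom L e m *
        (Matrix.of fun j l : Fin M => giR b (fun i => 1 + 2 * (m i : ℝ)) (z j) l).det := by
  induction M with
  | zero => intro m z _ _; simp [mom]
  | succ M ih =>
    intro m z hz hzb
    have hL : 0 < L := e.pos
    set z' : Fin M → ℝ := fun j => z j.succ with hz'
    have hz'i : Function.Injective z' := fun i j h => Fin.succ_injective _ (hz h)
    set s1 : Finset ℝ := Finset.univ.image (fun i => - b i) with hs1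
    set s2 : Finset ℝ := Finset.univ.image z' with hs2
    have hdis : Disjoint s1 s2 := by
      rw [Finset.disjoint_left]
      intro x hx hx2
      simp only [hs1, hs2, Finset.mem_image, Finset.mem_univ, true_and] at hx hx2
      obtain ⟨i, rfl⟩ := hx
      obtain ⟨j, hj⟩ := hx2
      exact hzb _ _ hj
    have hc1 : s1.card = L := by
      rw [hs1, Finset.card_image_of_injective _ (fun i j h => hb (neg_injective h))]; simp
    have hc2 : s2.card = M := by
      rw [hs2, Finset.card_image_of_injective _ hz'i]; simp
    have hc : (s1 ∪ s2).card = L + M := by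
      rw [Finset.card_union_of_disjoint hdis, hc1, hc2]
    set W : OG L → Fin L → ℝ := fun k i => (k.1 e i) ^ 2 with hW
    set A : OG L → ℝ → ℝ := fun k T => (Matrix.of (Fin.cons (fun l => (giLp b (W k) (l : ℕ)).eval T)
      (fun j l => giL b (W k) (z' j) l) : Fin (M + 1) → Fin (M + 1) → ℝ)).det with hA
    set B : ℝ → ℝ := fun T => (Matrix.of (Fin.cons (fun l => (giRp b (fun i => 1 + 2 * (m i : ℝ)) (l : ℕ)).eval T)
      (fun j l => giR b (fun i => 1 + 2 * (m i : ℝ)) (z' j) l) : Fin (M + 1) → Fin (M + 1) → ℝ)).det with hB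
    have hAe : ∀ k, (Matrix.of fun j l : Fin (M + 1) => giL b (W k) (z j) l).det = A k (z 0) := by
      intro k
      congr 1
      ext j l
      refine Fin.cases ?_ (fun j => ?_) j
      · simp [giLp_eval]
      · simp [hz']
    have hBe : (Matrix.of fun j l : Fin (M + 1) => giR b (fun i => 1 + 2 * (m i : ℝ)) (z j) l).det = B (z 0) := by
      congr 1
      ext j l
      refine Fin.cases ?_ (fun j => ?_) j
      · simp [giRp_eval]
      · simp [hz']
    have hAi : ∀ k T, A k T = ∑ t ∈ s1 ∪ s2, (Lagrange.basis (s1 ∪ s2) id t).eval T * A k t := fun k T =>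
      det_row_interp _ _ (fun l => by rw [hc]; exact giLp_deg _ _ _ _ (by omega)) _ _
    have hBi : ∀ T, B T = ∑ t ∈ s1 ∪ s2, (Lagrange.basis (s1 ∪ s2) id t).eval T * B t := fun T =>
      det_row_interp _ _ (fun l => by rw [hc]; exact giRp_deg _ _ _ _ (by omega) (by omega)) _ _
    have hAc : ∀ T, Continuous fun k => A k T := by
      intro T
      simp only [hA]
      apply Continuous.matrix_det
      apply continuous_matrix
      intro j l
      refine Fin.cases ?_ (fun j => ?_) j
      · simp only [Matrix.of_apply, Fin.cons_zero, giLp_eval, giL, hW]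
        exact continuous_const.mul (continuous_finsetSum _ fun i _ => ((og_cont e i).pow 2).mul continuous_const)
      · simp only [Matrix.of_apply, Fin.cons_succ, giL, hW]
        exact continuous_const.mul (continuous_finsetSum _ fun i _ => ((og_cont e i).pow 2).mul continuous_const)
    have hmc : ∀ m : Fin L → ℕ, Continuous fun k : OG L => ∏ i, ((k.1 e i) ^ 2) ^ (m i) := fun m =>
      continuous_finsetProd _ fun i _ => ((og_cont e i).pow 2).pow _
    have hnode : ∀ t ∈ s1 ∪ s2, ∫ k : OG L, (∏ i, ((k.1 e i) ^ 2) ^ (m i)) * A k t ∂(hK L) =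
        (∏ t ∈ Finset.range (M + 1), κ (∑ i, m i + t)) * mom L e m * B t := by
      intro t ht
      rcases Finset.mem_union.1 ht with ht | ht
      · simp only [hs1, Finset.mem_image, Finset.mem_univ, true_and] at ht
        obtain ⟨i, rfl⟩ := ht
        have hA1 : ∀ k, A k (- b i) = W k i * rhoi b i (- b i) * ((∏ j, (z' j + b i)) *
            (Matrix.of fun j l : Fin M => giL b (W k) (z' j) l).det) := by
          intro k
          rw [← Matrix.det_mul_column, ]
          have := det_reduce (W k i * rhoi b i (- b i)) (b i) (fun j l => giL b (W k) (z' j) l)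
          simp only [giL_succ] at this
          refine Eq.trans ?_ this
          simp only [hA]
          congr 3
          funext l
          rw [giLp_eval, giL, Finset.sum_eq_single i]
          · ring
          · intro l _ hl; rw [rhoi_ne _ _ _ hl.symm]; ring
          · simp
        have hB1 : B (- b i) = (1 + 2 * (m i : ℝ)) * rhoi b i (- b i) * ((∏ j, (z' j + b i)) *
            (Matrix.of fun j l : Fin M => giR b (fun l => 1 + 2 * (((m + Pi.single i 1 : Fin L → ℕ) l : ℕ) : ℝ))
              (z' j) l).det) := by
          rw [← Matrix.det_mul_column]
          have := det_reduce ((1 + 2 * (m i : ℝ)) * rhoi b i (- b i)) (b i)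
            (fun j l => giR b (fun i => 1 + 2 * (m i : ℝ)) (z' j) l)
          simp only [giR_succ] at this
          refine Eq.trans ?_ this
          simp only [hB]
          congr 3
          funext l
          rw [giRp_eval, giR, rho_root, Finset.sum_eq_single i]
          · ring
          · intro l _ hl; rw [rhoi_ne _ _ _ hl.symm]; ring
          · simp
        have ih' := ih (m + Pi.single i 1) z' hz'i (fun j i => hzb _ _)
        have hm1 : ∀ k : OG L, ∏ l, ((k.1 e l) ^ 2) ^ ((m + Pi.single i 1 : Fin L → ℕ) l) =
            (∏ l, ((k.1 e l) ^ 2) ^ (m l)) * W k i := by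
          intro k
          simp only [Pi.add_apply, pow_add, Finset.prod_mul_distrib]
          congr 1
          rw [Finset.prod_eq_single i]
          · simp [hW]
          · intro l _ hl; simp [hl]
          · simp
        have hm2 : ∑ l, (m + Pi.single i 1 : Fin L → ℕ) l = ∑ l, m l + 1 := by
          simp [Finset.sum_add_distrib]
        rw [hm2, hκ] at ih'
        simp_rw [hm1] at ih'
        rw [hB1]
        simp_rw [hA1]
        have : ∀ k : OG L, (∏ i, ((k.1 e i) ^ 2) ^ (m i)) * (W k i * rhoi b i (- b i) * ((∏ j, (z' j + b i)) *
            (Matrix.of fun j l : Fin M => giL b (W k) (z' j) l).det)) =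
            (rhoi b i (- b i) * (∏ j, (z' j + b i))) * ((∏ l, ((k.1 e l) ^ 2) ^ (m l)) * W k i *
            (Matrix.of fun j l : Fin M => giL b (W k) (z' j) l).det) := fun k => by ring
        simp_rw [this]
        rw [integral_const_mul, ih', Finset.prod_range_succ']
        simp_rw [add_assoc, add_comm 1]
        simp only [add_zero]
        ring
      · simp only [hs2, Finset.mem_image, Finset.mem_univ, true_and] at ht
        obtain ⟨j, rfl⟩ := ht
        have hA1 : ∀ k, A k (z' j) = 0 := by
          intro k
          apply Matrix.det_zero_of_row_eq (i := 0) (j := j.succ) (Fin.succ_ne_zero j).symm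
          funext l
          simp [giLp_eval]
        have hB1 : B (z' j) = 0 := by
          apply Matrix.det_zero_of_row_eq (i := 0) (j := j.succ) (Fin.succ_ne_zero j).symm
          funext l
          simp [giRp_eval]
        simp [hA1, hB1]
    rw [hBe]
    rw [hBi]
    have hAe2 : ∀ k : OG L, (Matrix.of fun j l : Fin (M + 1) => giL b (fun i => (k.1 e i) ^ 2) (z j) l).det =
      ∑ t ∈ s1 ∪ s2, (Lagrange.basis (s1 ∪ s2) id t).eval (z 0) * A k t :=
      fun k => (hAe k).trans (hAi k (z 0))
    rw [integral_congr_ae (Filter.Eventually.of_forall fun k => congrArg _ (hAe2 k))]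
    simp_rw [Finset.mul_sum]
    rw [integral_finsetSum]
    · refine Finset.sum_congr rfl fun t ht => ?_
      have : ∀ k : OG L, (∏ i, ((k.1 e i) ^ 2) ^ (m i)) * ((Lagrange.basis (s1 ∪ s2) id t).eval (z 0) * A k t) =
        (Lagrange.basis (s1 ∪ s2) id t).eval (z 0) * ((∏ i, ((k.1 e i) ^ 2) ^ (m i)) * A k t) := fun k => by ring
      simp_rw [this]
      rw [integral_const_mul, hnode t ht]
      ring
    · intro t _
      exact contK_integrable ((hmc m).mul (continuous_const.mul (hAc t)))

end

section

lemma gi_main {L : ℕ} (e : Fin L) (M : ℕ) : ∃ c : ℝ, 0 < c ∧ ∀ (b : Fin L → ℝ), (∀ i, 0 ≤ b i) →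
    ∀ z : Fin M → ℝ, (∀ j, 0 < z j) →
    ∫ k : OG L, (Matrix.of fun j l : Fin M => giL b (fun i => (k.1 e i) ^ 2) (z j) l).det ∂(hK L) =
      c * (Matrix.of fun j l : Fin M => giR b (fun _ => 1) (z j) l).det := by
  obtain ⟨κ, hκ0, hκ⟩ := mom_rec L e
  refine ⟨∏ t ∈ Finset.range M, κ t, Finset.prod_pos fun t _ => hκ0 t, fun b hb z hz => ?_⟩
  by_cases hinj : Function.Injective z
  swap
  · have : ∃ i j, z i = z j ∧ i ≠ j := by
      simpa [Function.Injective] using hinj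
    obtain ⟨i, j, hij, hne⟩ := this
    have h1 : ∀ k : OG L, (Matrix.of fun j l : Fin M => giL b (fun i => (k.1 e i) ^ 2) (z j) l).det = 0 :=
      fun k => Matrix.det_zero_of_row_eq hne (by funext l; simp [hij])
    have h2 : (Matrix.of fun j l : Fin M => giR b (fun _ => 1) (z j) l).det = 0 :=
      Matrix.det_zero_of_row_eq hne (by funext l; simp [hij])
    simp [h1, h2]
  set B : ℝ → Fin L → ℝ := fun ε i => b i + ε * (i : ℕ) with hB
  have hBc : ∀ i, Continuous fun ε => B ε i := fun i => by simp only [hB]; fun_prop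
  have hgen : ∀ᶠ ε in nhdsWithin (0:ℝ) (Set.Ioi 0),
      ∫ k : OG L, (Matrix.of fun j l : Fin M => giL (B ε) (fun i => (k.1 e i) ^ 2) (z j) l).det ∂(hK L) =
      (∏ t ∈ Finset.range M, κ t) * (Matrix.of fun j l : Fin M => giR (B ε) (fun _ => 1) (z j) l).det := by
    have hev : ∀ᶠ ε in nhdsWithin (0:ℝ) (Set.Ioi 0), ∀ i j : Fin L, i ≠ j → B ε i ≠ B ε j := by
      rw [Filter.eventually_all]; intro i
      rw [Filter.eventually_all]; intro j
      by_cases hij : i = j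
      · simp [hij]
      by_cases hbij : b i = b j
      · filter_upwards [self_mem_nhdsWithin] with ε hε _ h
        have hε : 0 < ε := hε
        simp only [hB, hbij, add_right_inj] at h
        have := mul_left_cancel₀ hε.ne' h
        exact hij (Fin.ext (by exact_mod_cast this))
      · have h1 : Filter.Tendsto (fun ε => B ε i - B ε j) (nhdsWithin (0:ℝ) (Set.Ioi 0)) (nhds (B 0 i - B 0 j)) :=
          (((hBc i).sub (hBc j)).tendsto 0).mono_left nhdsWithin_le_nhds
        have h2 : B 0 i - B 0 j ≠ 0 := by simp [hB, sub_eq_zero, hbij]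
        filter_upwards [h1.eventually_ne h2] with ε hε _ h
        exact hε (sub_eq_zero.2 h)
    filter_upwards [hev, self_mem_nhdsWithin] with ε hε hpos
    have hpos : 0 < ε := hpos
    have := gi_generic e κ hκ (B ε) (fun i j h => by_contra fun hne => hε i j hne h) M 0 z hinj
      (fun j i h => by
        have h1 := hz j
        have h2 := hb i
        have h3 : 0 ≤ ε * ((i : ℕ) : ℝ) := by positivity
        simp only [hB] at h; linarith)
    simpa [mom] using this
  have hc1 : Continuous fun ε : ℝ => ∫ k : OG L, (Matrix.of fun j l : Fin M => giL (B ε) (fun i => (k.1 e i) ^ 2) (z j) l).det ∂(hK L) := by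
    have := continuous_parametric_integral_of_continuous (μ := hK L)
      (f := fun (ε : ℝ) (k : OG L) => (Matrix.of fun j l : Fin M => giL (B ε) (fun i => (k.1 e i) ^ 2) (z j) l).det)
      (s := Set.univ) ?_ isCompact_univ
    · simpa using this
    · apply Continuous.matrix_det
      apply continuous_matrix
      intro j l
      simp only [Matrix.of_apply, giL, rhoi]
      refine continuous_const.mul (continuous_finsetSum _ fun i _ => ?_)
      refine (((og_cont e i).comp continuous_snd).pow 2).mul (continuous_finsetProd _ fun l _ => ?_)
      exact continuous_const.add ((hBc l).comp continuous_fst)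
  have hc2 : Continuous fun ε : ℝ => (∏ t ∈ Finset.range M, κ t) * (Matrix.of fun j l : Fin M => giR (B ε) (fun _ => 1) (z j) l).det := by
    refine continuous_const.mul ?_
    apply Continuous.matrix_det
    apply continuous_matrix
    intro j l
    simp only [Matrix.of_apply, giR, rhoi, rho]
    refine (continuous_const.mul (continuous_finsetProd _ fun l _ => ?_)).add
      (continuous_const.mul (continuous_finsetSum _ fun i _ => continuous_const.mul (continuous_finsetProd _ fun l _ => ?_)))
    · exact continuous_const.add (hBc l)
    · exact continuous_const.add (hBc l)
  have hB0 : B 0 = b := by funext i; simp [hB]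
  have t1 := (hc1.tendsto 0).mono_left (nhdsWithin_le_nhds (s := Set.Ioi 0))
  have t2 := (hc2.tendsto 0).mono_left (nhdsWithin_le_nhds (s := Set.Ioi 0))
  have := tendsto_nhds_unique (t1.congr' hgen) t2
  simpa only [hB0] using this

end

section

lemma adj_og {L : ℕ} (V : OG L) : adjugate V.1 = V.1.det • V.1ᵀ := by
  calc adjugate V.1 = adjugate V.1 * (V.1 * V.1ᵀ) := by rw [og_mul_tr, mul_one]
    _ = _ := by rw [← mul_assoc, adjugate_mul, smul_mul_assoc, one_mul]

lemma det_og_sq {L : ℕ} (V : OG L) : V.1.det * V.1.det = 1 := by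
  have := congrArg Matrix.det (og_mul_tr V)
  rwa [Matrix.det_mul, Matrix.det_transpose, Matrix.det_one] at this

lemma adj_conj_og {L : ℕ} (V : OG L) (d : Fin L → ℝ) :
    adjugate (V.1 * diagonal d * V.1ᵀ) =
      V.1 * diagonal (fun i => ∏ j ∈ Finset.univ.erase i, d j) * V.1ᵀ := by
  rw [adjugate_mul_distrib, adjugate_mul_distrib, adjugate_diagonal, ← adjugate_transpose, adj_og]
  simp only [transpose_smul, transpose_transpose, smul_mul_assoc, mul_smul_comm, smul_smul,
    det_og_sq, one_smul, mul_assoc]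

lemma conj_antisymm {L : ℕ} (X k : Matrix (Fin L) (Fin L) ℝ) (hX : Xᵀ = -X) :
    (k * X * kᵀ)ᵀ = -(k * X * kᵀ) := by
  simp [transpose_mul, hX, mul_assoc]

def corner {N : ℕ} (X : Matrix (Fin (N + 1)) (Fin (N + 1)) ℝ) : Matrix (Fin N) (Fin N) ℝ :=
  X.submatrix Fin.castSucc Fin.castSucc

lemma charpoly_conj_og {L : ℕ} (X : Matrix (Fin L) (Fin L) ℝ) (k : OG L) :
    (k.1 * X * k.1ᵀ).charpoly = X.charpoly := by
  rw [Matrix.charpoly_mul_comm, ← mul_assoc, og_tr_mul, one_mul]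

lemma charpoly_sq {L : ℕ} (X : Matrix (Fin L) (Fin L) ℝ) (hX : Xᵀ = -X) (U : OG L) (b : Fin L → ℝ)
    (hU : Xᵀ * X = U.1 * diagonal b * U.1ᵀ) (ζ : ℝ) :
    ((Matrix.scalar (Fin L) ζ - X)ᵀ * (Matrix.scalar (Fin L) ζ - X)) =
      U.1 * diagonal (fun i => ζ ^ 2 + b i) * U.1ᵀ := by
  have h1 : (diagonal fun i => ζ ^ 2 + b i) = (ζ ^ 2) • (1 : Matrix (Fin L) (Fin L) ℝ) + diagonal b := by
    ext i j; by_cases h : i = j <;> simp [h]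
  rw [h1, mul_add, add_mul, ← hU, mul_smul_comm, mul_one, smul_mul_assoc, og_mul_tr]
  have h2 : Matrix.scalar (Fin L) ζ = ζ • (1 : Matrix (Fin L) (Fin L) ℝ) := by
    ext i j; by_cases h : i = j <;> simp [h]
  rw [h2]
  simp only [transpose_sub, transpose_smul, transpose_one, hX, Matrix.sub_mul, Matrix.mul_sub, Matrix.smul_mul, Matrix.mul_smul,
    Matrix.one_mul, Matrix.mul_one, smul_smul, sq, Matrix.neg_mul, sub_neg_eq_add, smul_neg, smul_add, smul_sub, Matrix.add_mul]
  abel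

lemma corner_key {N : ℕ} (X : Matrix (Fin (N + 1)) (Fin (N + 1)) ℝ) (hX : Xᵀ = -X) (U k : OG (N + 1))
    (b : Fin (N + 1) → ℝ) (hU : Xᵀ * X = U.1 * diagonal b * U.1ᵀ) (ζ : ℝ) :
    X.charpoly.eval ζ * (corner (k.1 * X * k.1ᵀ)).charpoly.eval ζ =
      ζ * ∑ i, ((k * U : OG (N + 1)).1 (Fin.last N) i) ^ 2 * rhoi b i (ζ ^ 2) := by
  set Y := k.1 * X * k.1ᵀ with hY
  have hYa : Yᵀ = -Y := conj_antisymm X _ hX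
  set V : OG (N + 1) := k * U with hV
  have hVv : V.1 = k.1 * U.1 := rfl
  have hYY : Yᵀ * Y = V.1 * diagonal b * V.1ᵀ := by
    rw [hVv, hY]
    simp only [transpose_mul, transpose_transpose, mul_assoc]
    rw [← mul_assoc k.1ᵀ k.1, og_tr_mul, one_mul, ← mul_assoc Xᵀ X, hU]
    simp only [mul_assoc]
  set A := Matrix.scalar (Fin (N + 1)) ζ - Y with hA
  have hAA : Aᵀ * A = V.1 * diagonal (fun i => ζ ^ 2 + b i) * V.1ᵀ := charpoly_sq Y hYa V b hYY ζ
  set B := adjugate A with hB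
  have hBB : B * Bᵀ = V.1 * diagonal (fun i => rhoi b i (ζ ^ 2)) * V.1ᵀ := by
    rw [hB, adjugate_transpose, ← adjugate_mul_distrib, hAA, adj_conj_og]
    rfl
  have hsum : Aᵀ + A = (2 * ζ) • (1 : Matrix (Fin (N + 1)) (Fin (N + 1)) ℝ) := by
    have h2 : Matrix.scalar (Fin (N + 1)) ζ = ζ • (1 : Matrix (Fin (N + 1)) (Fin (N + 1)) ℝ) := by
      ext i j; by_cases h : i = j <;> simp [h]
    rw [hA, h2, transpose_sub, hYa, transpose_smul, transpose_one, two_mul, add_smul]; abel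
  have hkey : A.det • (B + Bᵀ) = (2 * ζ) • (B * Bᵀ) := by
    have h1 : B * (Aᵀ + A) * Bᵀ = A.det • (B + Bᵀ) := by
      rw [mul_add, add_mul, mul_assoc B Aᵀ, ← transpose_mul, hB, adjugate_mul, transpose_smul, transpose_one,
        mul_smul_comm, mul_one, smul_mul_assoc, one_mul, smul_add]
    rw [← h1, hsum, mul_smul_comm, mul_one, smul_mul_assoc]
  have hdet : X.charpoly.eval ζ = A.det := by
    rw [← charpoly_conj_og X k, eval_charpoly]
  have hcor : (corner Y).charpoly.eval ζ = B (Fin.last N) (Fin.last N) := by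
    rw [eval_charpoly, hB, adjugate_fin_succ_eq_det_submatrix, Fin.succAbove_last, ← two_mul, pow_mul]
    simp only [even_two, Even.neg_pow, one_pow, one_mul]
    congr 1
    ext i j
    by_cases h : i = j <;> simp [corner, hA, h]
  have h3 := congrFun (congrFun hkey (Fin.last N)) (Fin.last N)
  simp only [Matrix.smul_apply, Matrix.add_apply, transpose_apply, smul_eq_mul] at h3
  have h4 : (B * Bᵀ) (Fin.last N) (Fin.last N) = ∑ i, (V.1 (Fin.last N) i) ^ 2 * rhoi b i (ζ ^ 2) := by
    rw [hBB, Matrix.mul_apply]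
    refine Finset.sum_congr rfl fun i _ => ?_
    rw [mul_diagonal, transpose_apply]; ring
  rw [hdet, hcor, ← h4]
  linarith

lemma exists_diag {L : ℕ} (X : Matrix (Fin L) (Fin L) ℝ) :
    ∃ (U : OG L) (b : Fin L → ℝ), (∀ i, 0 ≤ b i) ∧ Xᵀ * X = U.1 * diagonal b * U.1ᵀ := by
  have hp := posSemidef_conjTranspose_mul_self X
  refine ⟨hp.1.eigenvectorUnitary, hp.1.eigenvalues, hp.eigenvalues_nonneg, ?_⟩
  have := hp.1.spectral_theorem
  rw [Unitary.conjStarAlgAut_apply] at this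
  exact this

lemma eval_charpoly_sq {L : ℕ} (X : Matrix (Fin L) (Fin L) ℝ) (hX : Xᵀ = -X) (U : OG L) (b : Fin L → ℝ)
    (hU : Xᵀ * X = U.1 * diagonal b * U.1ᵀ) (ζ : ℝ) :
    X.charpoly.eval ζ * X.charpoly.eval ζ = rho b (ζ ^ 2) := by
  have h := congrArg Matrix.det (charpoly_sq X hX U b hU ζ)
  rw [det_mul, det_transpose, det_mul, det_mul, det_transpose, det_diagonal, mul_right_comm, det_og_sq, one_mul] at h
  rw [eval_charpoly, h]; rfl

lemma deriv_key {L : ℕ} (X : Matrix (Fin L) (Fin L) ℝ) (hX : Xᵀ = -X) (U : OG L) (b : Fin L → ℝ)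
    (hU : Xᵀ * X = U.1 * diagonal b * U.1ᵀ) (ζ : ℝ) :
    X.charpoly.eval ζ * X.charpoly.derivative.eval ζ = ζ * ∑ i, rhoi b i (ζ ^ 2) := by
  set P : Polynomial ℝ := ∏ i, (Polynomial.X ^ 2 + Polynomial.C (b i)) with hP
  have h1 : X.charpoly * X.charpoly = P := by
    apply Polynomial.funext
    intro r
    rw [Polynomial.eval_mul, eval_charpoly_sq X hX U b hU, hP, Polynomial.eval_prod]
    simp [rho]
  have h2 := congrArg (fun p => (Polynomial.derivative p).eval ζ) h1
  simp only [Polynomial.derivative_mul, Polynomial.eval_add, Polynomial.eval_mul, hP, Polynomial.derivative_prod_finset,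
    Polynomial.eval_finsetSum] at h2
  have h3 : ∀ i, Polynomial.eval ζ (Polynomial.derivative (Polynomial.X ^ 2 + Polynomial.C (b i))) = 2 * ζ := by
    intro i; simp; norm_num
  have h4 : ∀ i, Polynomial.eval ζ (∏ x ∈ Finset.univ.erase i, (Polynomial.X ^ 2 + Polynomial.C (b x))) =
     rhoi b i (ζ ^ 2) := by
    intro i; simp [Polynomial.eval_prod, rhoi]
  simp only [h3, h4] at h2
  rw [← Finset.sum_mul] at h2
  linarith

open Polynomial in
def Sdet {M : ℕ} (p : Fin M → ℕ) (χ : ℝ[X]) : ℝ :=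
  (Matrix.of fun j l : Fin M => (X ^ (2 * (l : ℕ)) * χ).coeff (p j)).det

end

section

lemma det_multi {M D : ℕ} (w : Fin M → Fin D → ℝ) (F : Fin D → Fin M → ℝ) :
    (Matrix.of fun j l : Fin M => ∑ t, w j t * F t l).det =
      ∑ f : Fin M → Fin D, (∏ j, w j (f j)) * (Matrix.of fun j l : Fin M => F (f j) l).det := by
  have h1 : (Matrix.of fun j l : Fin M => ∑ t, w j t * F t l) =
      Matrix.of (fun j => ∑ t, w j t • F t) := by
    ext j l; simp [Finset.sum_apply]
  rw [h1]
  have h2 := (Matrix.detRowAlternating (n := Fin M) (R := ℝ)).toMultilinearMap.map_sum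
    (fun (j : Fin M) (t : Fin D) => w j t • F t)
  refine h2.trans (Finset.sum_congr rfl fun f _ => ?_)
  have h3 := (Matrix.detRowAlternating (n := Fin M) (R := ℝ)).toMultilinearMap.map_smul_univ
    (fun j => w j (f j)) (fun j => F (f j))
  exact h3

open Polynomial in
lemma coeff_nodes (D : ℕ) : ∃ w : ℕ → Fin D → ℝ, ∀ P : ℝ[X], P.degree < D → ∀ p,
    P.coeff p = ∑ t, w p t * P.eval ((t : ℕ) + 1 : ℝ) := by
  refine ⟨fun p t => (Lagrange.basis Finset.univ (fun t : Fin D => ((t : ℕ) + 1 : ℝ)) t).coeff p, ?_⟩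
  intro P hP p
  have hinj : Function.Injective (fun t : Fin D => ((t : ℕ) + 1 : ℝ)) := by
    intro a b h
    simp only [add_left_inj, Nat.cast_inj] at h
    exact Fin.ext h
  have h := Lagrange.eq_interpolate (s := Finset.univ) (f := P) hinj.injOn (by simpa using hP)
  have h2 := congrArg (fun q => q.coeff p) h
  simp only [Lagrange.interpolate_apply, finsetSum_coeff, coeff_C_mul] at h2
  rw [h2]
  exact Finset.sum_congr rfl fun t _ => mul_comm _ _

open Polynomial in
lemma coeff_pass {Ω : Type*} [MeasurableSpace Ω] (μ : Measure Ω) {M : ℕ} (D : ℕ) (P : Ω → Fin M → ℝ[X])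
    (Q : Fin M → ℝ[X]) (c : ℝ) (hP : ∀ ω l, (P ω l).degree < D) (hQ : ∀ l, (Q l).degree < D)
    (hi : ∀ ζ : Fin M → ℝ, Integrable (fun ω => (Matrix.of fun j l : Fin M => (P ω l).eval (ζ j)).det) μ)
    (h : ∀ ζ : Fin M → ℝ, (∀ j, 0 < ζ j) → ∫ ω, (Matrix.of fun j l : Fin M => (P ω l).eval (ζ j)).det ∂μ =
      c * (Matrix.of fun j l : Fin M => (Q l).eval (ζ j)).det) (p : Fin M → ℕ) :
    ∫ ω, (Matrix.of fun j l : Fin M => (P ω l).coeff (p j)).det ∂μ =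
      c * (Matrix.of fun j l : Fin M => (Q l).coeff (p j)).det := by
  obtain ⟨w, hw⟩ := coeff_nodes D
  have h1 : ∀ R : Fin M → ℝ[X], (∀ l, (R l).degree < D) →
      (Matrix.of fun j l : Fin M => (R l).coeff (p j)).det = ∑ f : Fin M → Fin D, (∏ j, w (p j) (f j)) *
        (Matrix.of fun j l : Fin M => (R l).eval (((f j : Fin D) : ℕ) + 1 : ℝ)).det := by
    intro R hR
    rw [← det_multi (fun j t => w (p j) t) (fun t l => (R l).eval ((t : ℕ) + 1 : ℝ))]
    congr 1
    ext j l
    simp only [Matrix.of_apply]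
    exact hw _ (hR l) _
  rw [h1 Q hQ, integral_congr_ae (Filter.Eventually.of_forall fun ω => h1 (P ω) (hP ω)),
    integral_finsetSum, Finset.mul_sum]
  · refine Finset.sum_congr rfl fun f _ => ?_
    rw [integral_const_mul, h _ (fun j => by positivity)]
    ring
  · intro f _
    exact (hi _).const_mul _

lemma corner_cont {N : ℕ} (X : Matrix (Fin (N + 1)) (Fin (N + 1)) ℝ) :
    Continuous fun k : OG (N + 1) => corner (k.1 * X * k.1ᵀ) := by
  unfold corner
  apply Continuous.matrix_submatrix
  fun_prop

lemma charpoly_eval_pos {L : ℕ} (X : Matrix (Fin L) (Fin L) ℝ) (hX : Xᵀ = -X) (ζ : ℝ) (hζ : 0 < ζ) :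
    X.charpoly.eval ζ ≠ 0 := by
  obtain ⟨U, b, hb, hU⟩ := exists_diag X
  intro h
  have h1 := eval_charpoly_sq X hX U b hU ζ
  rw [h, mul_zero] at h1
  have : 0 < rho b (ζ ^ 2) := Finset.prod_pos fun i _ => by have := hb i; positivity
  linarith

open Polynomial in
lemma step_lemma (N M : ℕ) : ∃ c : ℝ, 0 < c ∧ ∀ (Y : Matrix (Fin (N + 1)) (Fin (N + 1)) ℝ), Yᵀ = -Y →
    ∀ p : Fin M → ℕ, ∫ k : OG (N + 1), Sdet p (corner (k.1 * Y * k.1ᵀ)).charpoly ∂(hK (N + 1)) =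
      c * ((∏ j, ((p j : ℝ) + 1)) * Sdet (fun j => p j + 1) Y.charpoly) := by
  obtain ⟨c, hc, hgi⟩ := gi_main (Fin.last N) M
  refine ⟨c, hc, fun Y hY p => ?_⟩
  obtain ⟨U, b, hb, hU⟩ := exists_diag Y
  have h := coeff_pass (hK (N + 1)) (2 * M + N + 2)
    (fun (k : OG (N + 1)) (l : Fin M) => X ^ (2 * (l : ℕ)) * (corner (k.1 * Y * k.1ᵀ)).charpoly)
    (fun l => derivative (X ^ (2 * (l : ℕ)) * Y.charpoly)) c ?_ ?_ ?_ ?_ p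
  · refine h.trans ?_
    congr 1
    unfold Sdet
    rw [← Matrix.det_mul_column]
    congr 1
    ext j l
    simp only [Matrix.of_apply, coeff_derivative]
    ring
  · intro k l
    refine lt_of_le_of_lt (degree_mul_le _ _) ?_
    rw [degree_X_pow, charpoly_degree_eq_dim, Fintype.card_fin]
    have := l.2
    norm_cast
    omega
  · intro l
    refine lt_of_le_of_lt (degree_derivative_le) ?_
    refine lt_of_le_of_lt (degree_mul_le _ _) ?_
    rw [degree_X_pow, charpoly_degree_eq_dim, Fintype.card_fin]
    have := l.2
    norm_cast
    omega
  · intro ζ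
    apply contK_integrable
    apply Continuous.matrix_det
    apply continuous_matrix
    intro j l
    simp only [Matrix.of_apply, eval_mul, eval_charpoly]
    exact continuous_const.mul (Continuous.matrix_det (continuous_const.sub (corner_cont Y)))
  · intro ζ hζ
    have hχ : ∏ j, Y.charpoly.eval (ζ j) ≠ 0 :=
      Finset.prod_ne_zero_iff.2 fun j _ => charpoly_eval_pos Y hY _ (hζ j)
    apply mul_left_cancel₀ hχ
    have hL : ∀ k : OG (N + 1), (∏ j, Y.charpoly.eval (ζ j)) *
        (Matrix.of fun j l : Fin M => (X ^ (2 * (l : ℕ)) * (corner (k.1 * Y * k.1ᵀ)).charpoly).eval (ζ j)).det =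
        (∏ j, ζ j) * (Matrix.of fun j l : Fin M =>
          giL b (fun i => ((k * U : OG (N + 1)).1 (Fin.last N) i) ^ 2) (ζ j ^ 2) l).det := by
      intro k
      rw [← Matrix.det_mul_column, ← Matrix.det_mul_column]
      congr 1
      ext j l
      simp only [Matrix.of_apply, eval_mul, eval_pow, eval_X, giL]
      have := corner_key Y hY U k b hU (ζ j)
      rw [pow_mul]
      linear_combination ((ζ j ^ 2) ^ (l : ℕ)) * this
    have hR : (∏ j, Y.charpoly.eval (ζ j)) *
        (Matrix.of fun j l : Fin M => (derivative (X ^ (2 * (l : ℕ)) * Y.charpoly)).eval (ζ j)).det =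
        (∏ j, ζ j) * (Matrix.of fun j l : Fin M => giR b (fun _ => 1) (ζ j ^ 2) l).det := by
      rw [← Matrix.det_mul_column, ← Matrix.det_mul_column]
      congr 1
      ext j l
      simp only [Matrix.of_apply, eval_mul, eval_pow, eval_X, giR, derivative_mul, derivative_X_pow, eval_add,
        eval_C, one_mul]
      have h1 := deriv_key Y hY U b hU (ζ j)
      have h2 := eval_charpoly_sq Y hY U b hU (ζ j)
      have h3 : (((2 * (l : ℕ) : ℕ) : ℝ)) * ζ j ^ (2 * (l : ℕ) - 1) =
          2 * (l : ℕ) * (ζ j * (ζ j ^ 2) ^ ((l : ℕ) - 1)) := by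
        rcases (l : ℕ) with _ | q
        · simp
        · rw [show 2 * (q + 1) - 1 = 2 * q + 1 by omega, Nat.add_sub_cancel, pow_succ, pow_mul]
          push_cast; ring
      rw [h3, pow_mul]
      linear_combination ((ζ j ^ 2) ^ (l : ℕ)) * h1 + (2 * (l : ℕ) * (ζ j * (ζ j ^ 2) ^ ((l : ℕ) - 1))) * h2
    rw [← integral_const_mul, integral_congr_ae (Filter.Eventually.of_forall hL), integral_const_mul,
      integral_mul_right_eq_self (μ := hK (N + 1)) (fun k : OG (N + 1) => (Matrix.of fun j l : Fin M =>
          giL b (fun i => (k.1 (Fin.last N) i) ^ 2) (ζ j ^ 2) l).det) U,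
      hgi b hb _ (fun j => by have := hζ j; positivity)]
    linear_combination (-c) * hR

end

section

def cmin : (N : ℕ) → ℕ → Matrix (Fin N) (Fin N) ℝ → ℝ
  | 0, _, _ => 1
  | N + 1, d, X => if N + 1 ≤ d then X.det else cmin N d (corner X)

lemma cmin_full (N : ℕ) (X : Matrix (Fin N) (Fin N) ℝ) : cmin N N X = X.det := by
  cases N with
  | zero => simp [cmin]
  | succ N => simp [cmin]

lemma cmin_corner {N d : ℕ} (h : d ≤ N) (X : Matrix (Fin (N + 1)) (Fin (N + 1)) ℝ) :
    cmin (N + 1) d X = cmin N d (corner X) := by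
  rw [cmin, if_neg (by omega)]

lemma cmin_cont (N d : ℕ) : Continuous fun X : Matrix (Fin N) (Fin N) ℝ => cmin N d X := by
  induction N with
  | zero => exact continuous_const
  | succ N ih =>
    by_cases h : N + 1 ≤ d
    · simp only [cmin, if_pos h]; exact continuous_id.matrix_det
    · simp only [cmin, if_neg h]
      exact ih.comp (continuous_id.matrix_submatrix _ _)

def embM {N : ℕ} (k : Matrix (Fin N) (Fin N) ℝ) : Matrix (Fin (N + 1)) (Fin (N + 1)) ℝ :=
  Matrix.of fun i j => Fin.lastCases (motive := fun _ => ℝ) (Fin.lastCases (motive := fun _ => ℝ) 1 (fun _ => 0) j)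
    (fun i' => Fin.lastCases (motive := fun _ => ℝ) 0 (fun j' => k i' j') j) i

@[simp] lemma embM_cc {N : ℕ} (k : Matrix (Fin N) (Fin N) ℝ) (i j : Fin N) : embM k i.castSucc j.castSucc = k i j := by
  simp [embM]
@[simp] lemma embM_cl {N : ℕ} (k : Matrix (Fin N) (Fin N) ℝ) (i : Fin N) : embM k i.castSucc (Fin.last N) = 0 := by
  simp [embM]
@[simp] lemma embM_lc {N : ℕ} (k : Matrix (Fin N) (Fin N) ℝ) (i : Fin N) : embM k (Fin.last N) i.castSucc = 0 := by
  simp [embM]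
@[simp] lemma embM_ll {N : ℕ} (k : Matrix (Fin N) (Fin N) ℝ) : embM k (Fin.last N) (Fin.last N) = 1 := by
  simp [embM]

lemma embM_mul {N : ℕ} (k l : Matrix (Fin N) (Fin N) ℝ) : embM k * embM l = embM (k * l) := by
  ext i j
  rw [Matrix.mul_apply, Fin.sum_univ_castSucc]
  refine Fin.lastCases ?_ (fun i => ?_) i <;> refine Fin.lastCases ?_ (fun j => ?_) j <;>
    simp [Matrix.mul_apply]

lemma embM_tr {N : ℕ} (k : Matrix (Fin N) (Fin N) ℝ) : (embM k)ᵀ = embM kᵀ := by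
  ext i j
  rw [transpose_apply]
  refine Fin.lastCases ?_ (fun i => ?_) i <;> refine Fin.lastCases ?_ (fun j => ?_) j <;> simp

lemma embM_one {N : ℕ} : embM (1 : Matrix (Fin N) (Fin N) ℝ) = 1 := by
  ext i j
  refine Fin.lastCases ?_ (fun i => ?_) i <;> refine Fin.lastCases ?_ (fun j => ?_) j
  · simp
  · rw [embM_lc, Matrix.one_apply_ne (Fin.castSucc_lt_last j).ne']
  · rw [embM_cl, Matrix.one_apply_ne (Fin.castSucc_lt_last i).ne]
  · simp [Matrix.one_apply]

lemma corner_embM {N : ℕ} (k : Matrix (Fin N) (Fin N) ℝ) (X : Matrix (Fin (N + 1)) (Fin (N + 1)) ℝ) :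
    corner (embM k * X * (embM k)ᵀ) = k * corner X * kᵀ := by
  rw [embM_tr]
  ext i j
  simp [corner, Matrix.mul_apply, Fin.sum_univ_castSucc]

def embO {N : ℕ} (k : OG N) : OG (N + 1) := ⟨embM k.1, by
  rw [mem_orthogonalGroup_iff]
  change embM k.1 * (embM k.1)ᵀ = 1
  rw [embM_tr, embM_mul, og_mul_tr, embM_one]⟩

lemma embO_cont {N : ℕ} : Continuous (embO : OG N → OG (N + 1)) := by
  apply Continuous.subtype_mk
  apply continuous_matrix
  intro i j
  refine Fin.lastCases ?_ (fun i => ?_) i <;> refine Fin.lastCases ?_ (fun j => ?_) j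
  · simp only [embM_ll]; exact continuous_const
  · simp only [embM_lc]; exact continuous_const
  · simp only [embM_cl]; exact continuous_const
  · simp only [embM_cc]; exact og_cont i j

lemma corner_antisymm {N : ℕ} (X : Matrix (Fin (N + 1)) (Fin (N + 1)) ℝ) (hX : Xᵀ = -X) :
    (corner X)ᵀ = - corner X := by
  ext i j
  exact congrFun (congrFun hX i.castSucc) j.castSucc

def phiI (N : ℕ) {M : ℕ} (d : Fin M → ℕ) (X : Matrix (Fin N) (Fin N) ℝ) : ℝ :=
  ∫ k : OG N, ∏ j, cmin N (d j) (k.1 * X * k.1ᵀ) ∂(hK N)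

lemma hprod_cont (N : ℕ) {M : ℕ} (d : Fin M → ℕ) :
    Continuous fun X : Matrix (Fin N) (Fin N) ℝ => ∏ j, cmin N (d j) X :=
  continuous_finsetProd _ fun j _ => cmin_cont N (d j)

lemma phi_corner (N : ℕ) {M : ℕ} (d : Fin M → ℕ) (hd : ∀ j, d j ≤ N)
    (X : Matrix (Fin (N + 1)) (Fin (N + 1)) ℝ) :
    phiI (N + 1) d X = ∫ k : OG (N + 1), phiI N d (corner (k.1 * X * k.1ᵀ)) ∂(hK (N + 1)) := by
  unfold phiI
  set F : OG (N + 1) → ℝ := fun k => ∏ j, cmin (N + 1) (d j) (k.1 * X * k.1ᵀ) with hF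
  have h1 : ∀ (k : OG (N + 1)) (k' : OG N),
      ∏ j, cmin N (d j) (k'.1 * corner (k.1 * X * k.1ᵀ) * k'.1ᵀ) = F (embO k' * k) := by
    intro k k'
    simp only [hF]
    refine Finset.prod_congr rfl fun j _ => ?_
    rw [cmin_corner (hd j), ← corner_embM]
    congr 2
    have : (embO k' * k : OG (N + 1)).1 = embM k'.1 * k.1 := rfl
    rw [this, transpose_mul]
    simp only [mul_assoc]
  have hFc : Continuous F := (hprod_cont (N + 1) d).comp (by fun_prop)
  simp_rw [h1]
  rw [integral_integral_swap_of_hasCompactSupport]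
  · have h2 : ∀ k' : OG N, ∫ k : OG (N + 1), F (embO k' * k) ∂(hK (N + 1)) = ∫ k, F k ∂(hK (N + 1)) := fun k' =>
      integral_mul_left_eq_self F (embO k')
    simp_rw [h2]
    simp
  · exact hFc.comp ((embO_cont.comp continuous_snd).mul continuous_fst)
  · exact HasCompactSupport.of_compactSpace _

open Polynomial in
lemma Sdet_zero {M : ℕ} (p : Fin M → ℕ) (χ : ℝ[X]) :
    Sdet (Fin.cons 0 (fun j => p j + 2) : Fin (M + 1) → ℕ) χ = χ.eval 0 * Sdet p χ := by
  unfold Sdet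
  rw [Matrix.det_succ_row_zero, Fin.sum_univ_succ, Finset.sum_eq_zero, add_zero]
  · simp only [Fin.val_zero, pow_zero, one_mul, Matrix.of_apply, Fin.cons_zero, mul_zero,
      coeff_zero_eq_eval_zero]
    congr 2
    ext j l
    simp only [submatrix_apply, Matrix.of_apply, Fin.cons_succ, Fin.succAbove_zero, Fin.val_succ]
    rw [show 2 * ((l : ℕ) + 1) = 2 * (l : ℕ) + 2 by ring, pow_add, mul_right_comm, coeff_mul_X_pow]
  · intro l _
    simp only [Matrix.of_apply, Fin.cons_zero, Fin.val_succ, coeff_zero_eq_eval_zero, eval_mul, eval_pow, eval_X]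
    rw [zero_pow (by omega)]; ring

lemma phi_main (s : ℕ) : ∀ (N M : ℕ) (d : Fin M → ℕ), N + M = s → Antitone d → (∀ j, d j ≤ N) →
    ∃ γ : ℝ, γ ≠ 0 ∧ ∀ X : Matrix (Fin N) (Fin N) ℝ, Xᵀ = -X →
      phiI N d X = γ * Sdet (fun j => N - d j + 2 * (j : ℕ)) X.charpoly := by
  induction s with
  | zero =>
    intro N M d hs hd hdN
    obtain rfl : M = 0 := by omega
    exact ⟨1, one_ne_zero, fun X _ => by simp [phiI, Sdet]⟩
  | succ s ih =>
    intro N M d hs hd hdN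
    rcases M with _ | M
    · exact ⟨1, one_ne_zero, fun X _ => by simp [phiI, Sdet]⟩
    by_cases h0 : d 0 = N
    · obtain ⟨γ, hγ, h⟩ := ih N M (fun j => d j.succ) (by omega)
        (fun i j hij => hd (Fin.succ_le_succ_iff.2 hij)) (fun j => hdN _)
      refine ⟨γ * (-1) ^ N, mul_ne_zero hγ (by simp), fun X hX => ?_⟩
      have h1 : phiI N d X = X.det * phiI N (fun j => d j.succ) X := by
        unfold phiI
        rw [← integral_const_mul]
        refine integral_congr_ae (Filter.Eventually.of_forall fun k => ?_)
        simp only [Fin.prod_univ_succ, h0, cmin_full, det_mul, det_transpose]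
        rw [mul_right_comm k.1.det, det_og_sq, one_mul]
      have h2 : (fun j : Fin (M + 1) => N - d j + 2 * (j : ℕ)) =
          Fin.cons 0 (fun j : Fin M => (N - d j.succ + 2 * (j : ℕ)) + 2) := by
        funext j
        refine Fin.cases ?_ (fun j => ?_) j
        · simp [h0]
        · simp; ring
      have h3 : X.charpoly.eval 0 = (-1) ^ N * X.det := by
        rw [eval_charpoly, map_zero, zero_sub, det_neg, Fintype.card_fin]
      rw [h1, h2, Sdet_zero, h X hX, h3]
      have : ((-1 : ℝ) ^ N) * (-1) ^ N = 1 := by rw [← mul_pow]; simp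
      linear_combination (-(X.det * γ * Sdet (fun j : Fin M => N - d j.succ + 2 * (j : ℕ)) X.charpoly)) * this
    · have hlt : ∀ j, d j < N := fun j =>
        lt_of_le_of_lt (hd (Fin.zero_le j)) (lt_of_le_of_ne (hdN 0) h0)
      rcases N with _ | N
      · exact absurd (hlt 0) (by omega)
      obtain ⟨γ, hγ, h⟩ := ih N (M + 1) d (by omega) hd (fun j => by have := hlt j; omega)
      obtain ⟨c, hc, hst⟩ := step_lemma N (M + 1)
      set p : Fin (M + 1) → ℕ := fun j => N - d j + 2 * (j : ℕ) with hp
      have hprod : 0 < ∏ j, ((p j : ℝ) + 1) := Finset.prod_pos fun j _ => by positivity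
      refine ⟨γ * (c * ∏ j, ((p j : ℝ) + 1)), mul_ne_zero hγ (mul_pos hc hprod).ne', fun X hX => ?_⟩
      rw [phi_corner N d (fun j => by have := hlt j; omega)]
      have h1 : ∀ k : OG (N + 1), phiI N d (corner (k.1 * X * k.1ᵀ)) =
          γ * Sdet p (corner (k.1 * X * k.1ᵀ)).charpoly := fun k =>
        h _ (corner_antisymm _ (conj_antisymm X _ hX))
      simp_rw [h1]
      rw [integral_const_mul, hst X hX p]
      have h2 : (fun j => p j + 1) = (fun j : Fin (M + 1) => N + 1 - d j + 2 * (j : ℕ)) := by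
        funext j
        have := hlt j
        simp only [hp]; omega
      rw [h2]; ring

end

section

def Tri {N : ℕ} (t : Matrix (Fin N) (Fin N) ℝ) : Prop := ∀ i j, i < j → t i j = 0

lemma exists_LQ {N : ℕ} (g : Matrix (Fin N) (Fin N) ℝ) : ∃ (t : Matrix (Fin N) (Fin N) ℝ) (k : OG N),
    Tri t ∧ g = t * k.1 := by
  set f : Fin N → EuclideanSpace ℝ (Fin N) := fun i => WithLp.toLp 2 (g i) with hf
  set b := InnerProductSpace.gramSchmidtOrthonormalBasis (𝕜 := ℝ) (ι := Fin N) (by simp) f with hb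
  refine ⟨Matrix.of fun i j => inner ℝ (b j) (f i), ⟨_, og_of_onb b⟩, ?_, ?_⟩
  · intro i j hij
    exact InnerProductSpace.gramSchmidtOrthonormalBasis_inv_triangular _ f hij
  · ext i j
    have h := b.sum_repr' (f i)
    have h2 := congrArg (fun v : EuclideanSpace ℝ (Fin N) => v j) h
    simp only [hf] at h2
    rw [Matrix.mul_apply]
    simp only [Matrix.of_apply]
    change g i j = _
    refine h2.symm.trans ?_
    simp [hf]

def tdiag (N d : ℕ) (t : Matrix (Fin N) (Fin N) ℝ) : ℝ := ∏ i : Fin N, if (i : ℕ) < d then (t i i) ^ 2 else 1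

lemma corner_tri {N : ℕ} (t X : Matrix (Fin (N + 1)) (Fin (N + 1)) ℝ) (ht : Tri t) :
    corner (t * X * tᵀ) = corner t * corner X * (corner t)ᵀ := by
  ext i j
  have h : ∀ i : Fin N, t i.castSucc (Fin.last N) = 0 := fun i => ht _ _ (Fin.castSucc_lt_last i)
  simp [corner, Matrix.mul_apply, Fin.sum_univ_castSucc, h]

lemma det_tri {N : ℕ} (t : Matrix (Fin N) (Fin N) ℝ) (ht : Tri t) : t.det = ∏ i, t i i := by
  apply Matrix.det_of_isLowerTriangular
  intro i j hij
  exact ht _ _ hij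

lemma cmin_tri (N d : ℕ) : ∀ (t X : Matrix (Fin N) (Fin N) ℝ), Tri t →
    cmin N d (t * X * tᵀ) = tdiag N d t * cmin N d X := by
  induction N with
  | zero => intro t X _; simp [cmin, tdiag]
  | succ N ih =>
    intro t X ht
    by_cases h : N + 1 ≤ d
    · simp only [cmin, if_pos h, det_mul, det_transpose, det_tri t ht, tdiag]
      have : ∀ i : Fin (N + 1), (i : ℕ) < d := fun i => by omega
      simp only [this, if_true, Finset.prod_pow]
      ring
    · rw [cmin_corner (by omega), cmin_corner (by omega), corner_tri _ _ ht, ih]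
      · congr 1
        rw [tdiag, tdiag, Fin.prod_univ_castSucc, if_neg (by simp; omega), mul_one]
        rfl
      · intro i j hij
        exact ht _ _ (by simpa using hij)

lemma cmin_one (N d : ℕ) : cmin N d 1 = 1 := by
  induction N with
  | zero => rfl
  | succ N ih =>
    by_cases h : N + 1 ≤ d
    · rw [cmin, if_pos h, det_one]
    · rw [cmin_corner (by omega)]
      have : corner (1 : Matrix (Fin (N + 1)) (Fin (N + 1)) ℝ) = 1 := by
        ext i j; simp [corner, Matrix.one_apply]
      rw [this, ih]

lemma cmin_tt (N d : ℕ) (t : Matrix (Fin N) (Fin N) ℝ) (ht : Tri t) : cmin N d (t * tᵀ) = tdiag N d t := by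
  have := cmin_tri N d t 1 ht
  rwa [mul_one, cmin_one, mul_one] at this

lemma LQ_tr {N : ℕ} (t : Matrix (Fin N) (Fin N) ℝ) (k : OG N) : (t * k.1) * (t * k.1)ᵀ = t * tᵀ := by
  rw [transpose_mul, mul_assoc, ← mul_assoc k.1, og_mul_tr, one_mul]

lemma cmin_nonneg (N d : ℕ) (g : Matrix (Fin N) (Fin N) ℝ) : 0 ≤ cmin N d (g * gᵀ) := by
  obtain ⟨t, k, ht, rfl⟩ := exists_LQ g
  rw [LQ_tr, cmin_tt _ _ _ ht]
  exact Finset.prod_nonneg fun i _ => by split_ifs <;> positivity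

lemma phi_LQ (N : ℕ) {M : ℕ} (d : Fin M → ℕ) (g Y : Matrix (Fin N) (Fin N) ℝ) :
    ∫ k : OG N, ∏ j, cmin N (d j) (g * (k.1 * Y * k.1ᵀ) * gᵀ) ∂(hK N) =
      (∏ j, cmin N (d j) (g * gᵀ)) * phiI N d Y := by
  obtain ⟨t, k0, ht, rfl⟩ := exists_LQ g
  unfold phiI
  rw [← integral_mul_left_eq_self (μ := hK N) (fun k : OG N => ∏ j, cmin N (d j) (k.1 * Y * k.1ᵀ)) k0,
    ← integral_const_mul]
  refine integral_congr_ae (Filter.Eventually.of_forall fun k => ?_)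
  simp only
  rw [← Finset.prod_mul_distrib]
  refine Finset.prod_congr rfl fun j _ => ?_
  rw [LQ_tr, cmin_tt _ _ _ ht, ← cmin_tri _ _ _ _ ht]
  congr 1
  have : (k0 * k : OG N).1 = k0.1 * k.1 := rfl
  rw [this]
  simp only [transpose_mul, mul_assoc]

abbrev FM (N : ℕ) := Fin N → Fin N → ℝ

lemma swap_bdd {N : ℕ} (m : Measure (FM N)) [IsFiniteMeasure m] (hb : ∀ᵐ u ∂m, ∀ i j, |u i j| ≤ 1)
    (F : FM N → OG N → ℝ) (hF : Continuous (Function.uncurry F)) :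
    ∫ u, ∫ k, F u k ∂(hK N) ∂m = ∫ k, ∫ u, F u k ∂m ∂(hK N) := by
  apply integral_integral_swap
  set K : Set (FM N) := Set.pi Set.univ (fun _ => Set.pi Set.univ (fun _ => Set.Icc (-1 : ℝ) 1)) with hK'
  have hKc : IsCompact K := isCompact_univ_pi fun _ => isCompact_univ_pi fun _ => isCompact_Icc
  obtain ⟨C, hC⟩ := (hKc.prod (isCompact_univ (X := OG N))).exists_bound_of_continuousOn hF.continuousOn
  refine Integrable.of_bound hF.aestronglyMeasurable C ?_
  have h1 : ∀ᵐ x ∂(m.prod (hK N)), ∀ i j, |x.1 i j| ≤ 1 :=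
    Measure.quasiMeasurePreserving_fst.ae hb
  filter_upwards [h1] with x hx
  exact hC x ⟨fun i _ j _ => abs_le.1 (hx i j), Set.mem_univ _⟩

/-- eigenfunction property -/
lemma eig {N M : ℕ} (m : Measure (FM N)) [IsFiniteMeasure m] (hb : ∀ᵐ u ∂m, ∀ i j, |u i j| ≤ 1)
    (hl : ∀ k : OG N, MeasurePreserving (fun (u : FM N) (i j : Fin N) => (k.1 * Matrix.of u) i j) m m)
    (hr : ∀ k : OG N, MeasurePreserving (fun (u : FM N) (i j : Fin N) => (Matrix.of u * k.1) i j) m m)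
    (d : Fin M → ℕ) (hd : Antitone d) (hdN : ∀ j, d j ≤ N) (Y : Matrix (Fin N) (Fin N) ℝ) (hY : Yᵀ = -Y) :
    ∫ u, Sdet (fun j => N - d j + 2 * (j : ℕ)) (Matrix.of u * Y * (Matrix.of u)ᵀ).charpoly ∂m =
      (∫ u, ∏ j, cmin N (d j) (Matrix.of u * (Matrix.of u)ᵀ) ∂m) *
        Sdet (fun j => N - d j + 2 * (j : ℕ)) Y.charpoly := by
  obtain ⟨γ, hγ, hphi⟩ := phi_main (N + M) N M d rfl hd hdN
  apply mul_left_cancel₀ hγ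
  set H : Matrix (Fin N) (Fin N) ℝ → ℝ := fun X => ∏ j, cmin N (d j) X with hH
  have hHc : Continuous H := hprod_cont N d
  have hofc : Continuous fun u : FM N => (Matrix.of u : Matrix (Fin N) (Fin N) ℝ) := continuous_id
  have e1 : ∀ u : FM N, γ * Sdet (fun j => N - d j + 2 * (j : ℕ)) (Matrix.of u * Y * (Matrix.of u)ᵀ).charpoly =
      ∫ k : OG N, H ((k.1 * Matrix.of u) * Y * (k.1 * Matrix.of u)ᵀ) ∂(hK N) := by
    intro u
    rw [← hphi _ (conj_antisymm Y _ hY)]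
    unfold phiI
    simp only [hH, transpose_mul, mul_assoc]
  have e2 : ∀ u : FM N, ∫ k : OG N, H ((Matrix.of u * k.1) * Y * (Matrix.of u * k.1)ᵀ) ∂(hK N) =
      (∏ j, cmin N (d j) (Matrix.of u * (Matrix.of u)ᵀ)) * phiI N d Y := by
    intro u
    rw [← phi_LQ]
    simp only [hH, transpose_mul, mul_assoc]
  have hG : Continuous fun u : FM N => H (Matrix.of u * Y * (Matrix.of u)ᵀ) :=
    hHc.comp ((hofc.matrix_mul continuous_const).matrix_mul hofc.matrix_transpose)
  rw [← integral_const_mul, integral_congr_ae (Filter.Eventually.of_forall e1),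
    swap_bdd m hb (fun u k => H ((k.1 * Matrix.of u) * Y * (k.1 * Matrix.of u)ᵀ))]
  · have h3 : ∀ k : OG N, ∫ u, H ((k.1 * Matrix.of u) * Y * (k.1 * Matrix.of u)ᵀ) ∂m =
        ∫ u, H ((Matrix.of u * k.1) * Y * (Matrix.of u * k.1)ᵀ) ∂m := by
      intro k
      have a1 : ∫ u, H ((k.1 * Matrix.of u) * Y * (k.1 * Matrix.of u)ᵀ) ∂m =
          ∫ u, H (Matrix.of u * Y * (Matrix.of u)ᵀ) ∂m := by
        have := integral_map (μ := m) (hl k).measurable.aemeasurable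
          (f := fun u : FM N => H (Matrix.of u * Y * (Matrix.of u)ᵀ)) hG.aestronglyMeasurable
        rw [(hl k).map_eq] at this
        exact this.symm
      have a2 : ∫ u, H ((Matrix.of u * k.1) * Y * (Matrix.of u * k.1)ᵀ) ∂m =
          ∫ u, H (Matrix.of u * Y * (Matrix.of u)ᵀ) ∂m := by
        have := integral_map (μ := m) (hr k).measurable.aemeasurable
          (f := fun u : FM N => H (Matrix.of u * Y * (Matrix.of u)ᵀ)) hG.aestronglyMeasurable
        rw [(hr k).map_eq] at this
        exact this.symm
      rw [a1, a2]
    simp_rw [h3]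
    rw [← swap_bdd m hb (fun u k => H ((Matrix.of u * k.1) * Y * (Matrix.of u * k.1)ᵀ))]
    · simp_rw [e2]
      rw [integral_mul_const, hphi Y hY]
      ring
    · have c1 : Continuous fun x : FM N × OG N => (Matrix.of x.1 * x.2.1 : Matrix (Fin N) (Fin N) ℝ) :=
        (hofc.comp continuous_fst).matrix_mul (continuous_subtype_val.comp continuous_snd)
      exact hHc.comp ((c1.matrix_mul continuous_const).matrix_mul c1.matrix_transpose)
  · have c1 : Continuous fun x : FM N × OG N => (x.2.1 * Matrix.of x.1 : Matrix (Fin N) (Fin N) ℝ) :=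
        (continuous_subtype_val.comp continuous_snd).matrix_mul (hofc.comp continuous_fst)
    exact hHc.comp ((c1.matrix_mul continuous_const).matrix_mul c1.matrix_transpose)

end

section

lemma betaPDF_int {α β : ℝ} (hα : 0 < α) (hβ : 0 < β) :
    Integrable (ProbabilityTheory.betaPDFReal α β) ∧ ∫ x, ProbabilityTheory.betaPDFReal α β x = 1 := by
  have h := ProbabilityTheory.lintegral_betaPDF_eq_one hα hβ
  have hnn : ∀ x, 0 ≤ ProbabilityTheory.betaPDFReal α β x := by
    intro x
    by_cases hx : 0 < x ∧ x < 1
    · exact (ProbabilityTheory.betaPDFReal_pos hx.1 hx.2 hα hβ).le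
    · rw [ProbabilityTheory.betaPDFReal, if_neg hx]
  have hm := ProbabilityTheory.measurable_betaPDFReal α β
  constructor
  · refine ⟨hm.aestronglyMeasurable, ?_⟩
    rw [hasFiniteIntegral_iff_ofReal (Filter.Eventually.of_forall hnn)]
    unfold ProbabilityTheory.betaPDF at h
    rw [h]; exact ENNReal.one_lt_top
  · rw [integral_eq_lintegral_of_nonneg_ae (Filter.Eventually.of_forall hnn) hm.aestronglyMeasurable]
    unfold ProbabilityTheory.betaPDF at h
    rw [h]; rfl

/-- radial weight -/
def rw' (a : ℕ) (ν s x : ℝ) : ℝ := if x < 1 then x ^ a * x ^ ν * (1 - x) ^ s else 0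

lemma rw'_meas (a : ℕ) (ν s : ℝ) : Measurable (rw' a ν s) := by
  unfold rw'
  exact Measurable.ite measurableSet_Iio (by fun_prop) measurable_const

lemma rw'_nonneg (a : ℕ) (ν s x : ℝ) (hx : 0 ≤ x) : 0 ≤ rw' a ν s x := by
  unfold rw'
  split_ifs with h
  · have : 0 ≤ 1 - x := by linarith
    positivity
  · rfl

lemma radial (m : ℕ) : ∃ C : ℝ, 0 < C ∧ ∀ (a : ℕ) (ν s : ℝ), 0 < (a : ℝ) + ν + (m + 1 : ℕ) / 2 → 0 < s + 1 →
    ∫⁻ r : Fin (m + 1) → ℝ, ENNReal.ofReal (rw' a ν s (r ⬝ᵥ r)) =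
      ENNReal.ofReal (C * ProbabilityTheory.beta (a + ν + (m + 1 : ℕ) / 2) (s + 1)) := by
  have hfr : Module.finrank ℝ (EuclideanSpace ℝ (Fin (m + 1))) = m + 1 := by simp
  haveI : Nontrivial (EuclideanSpace ℝ (Fin (m + 1))) := Module.nontrivial_of_finrank_pos (R := ℝ) (by rw [hfr]; omega)
  set V : ℝ := (volume : Measure (EuclideanSpace ℝ (Fin (m + 1)))).real (Metric.ball 0 1) with hV
  have hVpos : 0 < V := by
    rw [hV, Measure.real]
    exact ENNReal.toReal_pos (Metric.measure_ball_pos _ _ one_pos).ne' measure_ball_lt_top.ne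
  refine ⟨(m + 1 : ℕ) * V * (1 / 2), by positivity, fun a ν s hα hβ => ?_⟩
  set α := (a : ℝ) + ν + (m + 1 : ℕ) / 2 with hαd
  set β := s + 1 with hβd
  set B := ProbabilityTheory.beta α β with hB
  have hBpos : 0 < B := ProbabilityTheory.beta_pos hα hβ
  set g : ℝ → ℝ := fun x => (B / 2) * ProbabilityTheory.betaPDFReal α β x with hg
  have hgi : IntegrableOn g (Set.Ioi 0) := ((betaPDF_int hα hβ).1.const_mul _).integrableOn
  have hgv : ∫ x in Set.Ioi 0, g x = B / 2 := by
    have : ∫ x in Set.Ioi 0, g x = ∫ x, g x := by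
      apply setIntegral_eq_integral_of_forall_compl_eq_zero
      intro x hx
      simp only [Set.mem_Ioi, not_lt] at hx
      simp only [hg, ProbabilityTheory.betaPDFReal]
      rw [if_neg (fun h => absurd h.1 (not_lt.2 hx)), mul_zero]
    rw [this, hg, integral_const_mul, (betaPDF_int hα hβ).2, mul_one]
  have key : ∀ y ∈ Set.Ioi (0 : ℝ), (2 * y ^ ((2 : ℝ) - 1)) • g (y ^ (2 : ℝ)) = y ^ (m + 1 - 1) • rw' a ν s (y ^ 2) := by
    intro y hy
    simp only [Set.mem_Ioi] at hy
    simp only [hg, ProbabilityTheory.betaPDFReal, smul_eq_mul, rw']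
    have h2 : y ^ (2 : ℝ) = y ^ 2 := by norm_cast
    rw [h2]
    have hy2 : 0 < y ^ 2 := by positivity
    by_cases h : y ^ 2 < 1
    · rw [if_pos ⟨hy2, h⟩, if_pos h, ← hB]
      have e1 : (2 : ℝ) - 1 = 1 := by norm_num
      have e2 : β - 1 = s := by rw [hβd]; ring
      have e3 : (y ^ 2) ^ (α - 1) * y = y ^ m * ((y ^ 2) ^ a * (y ^ 2) ^ ν) := by
        rw [← Real.rpow_natCast (y ^ 2) a, ← Real.rpow_add hy2, ← h2, ← Real.rpow_mul hy.le, ← Real.rpow_mul hy.le,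
          ← Real.rpow_natCast y m, ← Real.rpow_add hy]
        nth_rw 2 [← Real.rpow_one y]
        rw [← Real.rpow_add hy]
        congr 1
        rw [hαd]; push_cast; ring
      rw [e1, Real.rpow_one, e2]
      have : 2 * y * (B / 2 * (1 / B * (y ^ 2) ^ (α - 1) * (1 - y ^ 2) ^ s)) =
        ((y ^ 2) ^ (α - 1) * y) * (1 - y ^ 2) ^ s := by field_simp
      rw [this, e3]
      simp only [Nat.add_sub_cancel]
      ring
    · rw [if_neg (fun hh => h hh.2), if_neg h]; simp
  have hI : IntegrableOn (fun y : ℝ => y ^ (m + 1 - 1) • rw' a ν s (y ^ 2)) (Set.Ioi 0) := by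
    rw [← integrableOn_congr_fun key measurableSet_Ioi]
    have := (integrableOn_Ioi_comp_rpow_iff g (p := 2) (by norm_num)).2 hgi
    simpa using this
  have hJ : ∫ y in Set.Ioi (0:ℝ), y ^ (m + 1 - 1) • rw' a ν s (y ^ 2) = B / 2 := by
    rw [← setIntegral_congr_fun measurableSet_Ioi key, ← hgv]
    have := integral_comp_rpow_Ioi_of_pos (g := g) (p := 2) (by norm_num)
    simpa using this
  have i1 := (integrable_fun_norm_addHaar (volume : Measure (EuclideanSpace ℝ (Fin (m + 1)))) (f := fun x => rw' a ν s (x ^ 2))).2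
    (by rw [hfr]; exact hI)
  have i2 := integral_fun_norm_addHaar (volume : Measure (EuclideanSpace ℝ (Fin (m + 1)))) (fun x => rw' a ν s (x ^ 2))
  rw [hfr, hJ] at i2
  have mp := (EuclideanSpace.volume_preserving_symm_measurableEquiv_toLp (Fin (m + 1))).symm
  have hd : ∀ x : EuclideanSpace ℝ (Fin (m + 1)), ‖x‖ ^ 2 = (WithLp.ofLp x) ⬝ᵥ (WithLp.ofLp x) := by
    intro x
    rw [EuclideanSpace.norm_sq_eq]
    simp [dotProduct, sq]
  have i3 : ∫⁻ r : Fin (m + 1) → ℝ, ENNReal.ofReal (rw' a ν s (r ⬝ᵥ r)) =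
      ∫⁻ x : EuclideanSpace ℝ (Fin (m + 1)), ENNReal.ofReal (rw' a ν s (‖x‖ ^ 2)) := by
    simp_rw [hd]
    have hmm : Measurable fun r : Fin (m + 1) → ℝ => ENNReal.ofReal (rw' a ν s (r ⬝ᵥ r)) := by
      refine ENNReal.measurable_ofReal.comp ((rw'_meas a ν s).comp ?_)
      unfold dotProduct
      fun_prop
    exact ((EuclideanSpace.volume_preserving_symm_measurableEquiv_toLp (Fin (m + 1))).lintegral_comp hmm).symm
  rw [i3, ← ofReal_integral_eq_lintegral_ofReal i1 (Filter.Eventually.of_forall fun x => rw'_nonneg _ _ _ _ (by positivity)), i2]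
  congr 1
  simp only [nsmul_eq_mul, smul_eq_mul, hV]
  ring

end

section

open Classical in
def WE {ι : Type} [Fintype ι] [DecidableEq ι] (μ : ℝ) (S : Matrix ι ι ℝ) : ENNReal :=
  if S.PosDef then ENNReal.ofReal (S.det ^ μ) else 0

lemma posDef_iff' {ι : Type} [Fintype ι] [DecidableEq ι] (S : Matrix ι ι ℝ) :
    S.PosDef ↔ S.PosSemidef ∧ S.det ≠ 0 :=
  ⟨fun h => ⟨h.posSemidef, h.posSemidef.posDef_iff_det_ne_zero.1 h⟩, fun h => h.1.posDef_iff_det_ne_zero.2 h.2⟩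

lemma WE_meas {N : ℕ} (μ : ℝ) {α : Type} [TopologicalSpace α] [MeasurableSpace α] [BorelSpace α]
    (f : α → Matrix (Fin N) (Fin N) ℝ) (hf : Continuous f) : Measurable (fun x => WE μ (f x)) := by
  unfold WE
  have hdet : Continuous fun x => (f x).det := hf.matrix_det
  refine Measurable.ite ?_ ?_ measurable_const
  · simp_rw [posDef_iff']
    refine MeasurableSet.inter (IsClosed.measurableSet ?_) ?_
    · show IsClosed {a | (f a).PosSemidef}
      simp_rw [posSemidef_iff_dotProduct_mulVec]
      refine IsClosed.inter ?_ ?_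
      · exact isClosed_eq hf.matrix_conjTranspose hf
      · have : {a | ∀ x : Fin N → ℝ, 0 ≤ star x ⬝ᵥ f a *ᵥ x} = ⋂ x : Fin N → ℝ, {a | 0 ≤ star x ⬝ᵥ f a *ᵥ x} := by
          ext; simp
        show IsClosed {a | ∀ x : Fin N → ℝ, 0 ≤ star x ⬝ᵥ f a *ᵥ x}
        rw [this]
        refine isClosed_iInter fun x => isClosed_le continuous_const ?_
        exact continuous_const.dotProduct (hf.matrix_mulVec continuous_const)
    · exact (isOpen_ne.preimage hdet).measurableSet
  · exact ENNReal.measurable_ofReal.comp (hdet.measurable.pow_const μ)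

lemma WE_conj {N : ℕ} (μ : ℝ) (T S : Matrix (Fin N) (Fin N) ℝ) (hT : T.det ≠ 0) :
    WE μ (T * S * Tᵀ) = ENNReal.ofReal ((T.det ^ 2) ^ μ) * WE μ S := by
  have hU : IsUnit T := (Matrix.isUnit_iff_isUnit_det _).2 (isUnit_iff_ne_zero.2 hT)
  have h : (T * S * Tᵀ).PosDef ↔ S.PosDef := by
    have := Matrix.IsUnit.posDef_star_right_conjugate_iff (x := S) hU
    rwa [Matrix.star_eq_conjTranspose, conjTranspose_eq_transpose_of_trivial] at this
  unfold WE
  by_cases hS : S.PosDef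
  · rw [if_pos (h.2 hS), if_pos hS, det_mul, det_mul, det_transpose, ← ENNReal.ofReal_mul (by positivity),
      ← Real.mul_rpow (by positivity) hS.det_pos.le]
    congr 2; ring
  · rw [if_neg (fun x => hS (h.1 x)), if_neg hS, mul_zero]

lemma cv_mat {N : ℕ} (T : Matrix (Fin N) (Fin N) ℝ) (hT : T.det ≠ 0) (f : (Fin N → ℝ) → ENNReal) (hf : Measurable f) :
    ∫⁻ c, f c = ENNReal.ofReal |T.det| * ∫⁻ c, f (T *ᵥ c) := by
  have h := Real.map_matrix_volume_pi_eq_smul_volume_pi hT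
  have h2 : ∫⁻ c, f (T *ᵥ c) = ∫⁻ c, f c ∂(Measure.map (Matrix.toLin' T) volume) := by
    rw [lintegral_map hf]
    · rfl
    · exact (LinearMap.continuous_of_finiteDimensional _).measurable
  rw [h2, h, lintegral_smul_measure, smul_eq_mul, ← mul_assoc, ← ENNReal.ofReal_mul (abs_nonneg _), ← abs_mul,
    mul_inv_cancel₀ hT]
  simp

lemma one_sub_vec {N : ℕ} (μ : ℝ) (c : Fin N → ℝ) : WE μ (1 - vecMulVec c c) = ENNReal.ofReal (rw' 0 0 μ (c ⬝ᵥ c)) := by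
  have hdet : (1 - vecMulVec c c).det = 1 - c ⬝ᵥ c := by
    have := det_one_add_replicateCol_mul_replicateRow (ι := Unit) (-c) c
    rw [← vecMulVec_eq, neg_vecMulVec, ← sub_eq_add_neg] at this
    rw [this]; simp [sub_eq_add_neg]
  have hpd : (1 - vecMulVec c c).PosDef ↔ c ⬝ᵥ c < 1 := by
    constructor
    · intro h
      have := h.det_pos
      rw [hdet] at this; linarith
    · intro h
      rw [posDef_iff_dotProduct_mulVec]
      refine ⟨?_, fun x hx => ?_⟩
      · ext i j; simp [vecMulVec_apply, Matrix.one_apply, eq_comm, mul_comm]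
      · rw [Matrix.sub_mulVec, Matrix.one_mulVec, dotProduct_sub, star_trivial]
        have e : x ⬝ᵥ (vecMulVec c c *ᵥ x) = (c ⬝ᵥ x) ^ 2 := by
          rw [vecMulVec_mulVec]
          simp [dotProduct_comm x c, sq, dotProduct_smul]
        rw [e]
        have cs : (c ⬝ᵥ x) ^ 2 ≤ (c ⬝ᵥ c) * (x ⬝ᵥ x) := by
          have := Finset.sum_mul_sq_le_sq_mul_sq Finset.univ c x
          simpa [dotProduct, sq] using this
        have hxx : 0 < x ⬝ᵥ x := by
          have h1 := dot_nonneg x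
          have h2 : x ⬝ᵥ x ≠ 0 := fun h => hx (dotProduct_self_eq_zero.1 h)
          exact lt_of_le_of_ne h1 (Ne.symm h2)
        nlinarith
  unfold WE rw'
  by_cases h : c ⬝ᵥ c < 1
  · rw [if_pos (hpd.2 h), if_pos h, hdet]; simp
  · rw [if_neg (fun x => h (hpd.1 x)), if_neg h]; simp

def kap (N : ℕ) (μ : ℝ) : ENNReal := ∫⁻ c : Fin N → ℝ, ENNReal.ofReal (rw' 0 0 μ (c ⬝ᵥ c))

lemma cont_vmv {N : ℕ} : Continuous fun c : Fin N → ℝ => vecMulVec c c :=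
  continuous_matrix fun i j => by simp only [vecMulVec_apply]; fun_prop

open scoped MatrixOrder Matrix.Norms.L2Operator in
lemma psd_fac {N : ℕ} (S : Matrix (Fin N) (Fin N) ℝ) (hS : S.PosSemidef) : ∃ B : Matrix (Fin N) (Fin N) ℝ, S = star B * B :=
  CStarAlgebra.nonneg_iff_eq_star_mul_self.mp hS.nonneg

lemma WE_int {N : ℕ} (μ : ℝ) (S : Matrix (Fin N) (Fin N) ℝ) :
    ∫⁻ c, WE μ (S - vecMulVec c c) = kap N μ * WE (μ + 1 / 2) S := by
  by_cases hS : S.PosDef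
  · obtain ⟨B, hB⟩ := psd_fac S hS.posSemidef
    obtain ⟨T, hST⟩ : ∃ T : Matrix (Fin N) (Fin N) ℝ, S = T * Tᵀ :=
      ⟨Bᵀ, by rw [hB, transpose_transpose, star_eq_conjTranspose, conjTranspose_eq_transpose_of_trivial]⟩
    have hdS : S.det = T.det ^ 2 := by rw [hST, det_mul, det_transpose, sq]
    have hT : T.det ≠ 0 := by
      intro h
      have := hS.det_pos
      rw [hdS, h] at this; simp at this
    rw [cv_mat T hT (fun c => WE μ (S - vecMulVec c c)) (WE_meas μ (fun c => S - vecMulVec c c) (continuous_const.sub cont_vmv))]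
    have : ∀ c, WE μ (S - vecMulVec (T *ᵥ c) (T *ᵥ c)) = ENNReal.ofReal ((T.det ^ 2) ^ μ) * ENNReal.ofReal (rw' 0 0 μ (c ⬝ᵥ c)) := by
      intro c
      rw [← one_sub_vec, ← WE_conj _ _ _ hT]
      congr 1
      rw [Matrix.mul_sub, Matrix.sub_mul, mul_one, ← hST, mul_vecMulVec, vecMulVec_mul, vecMul_transpose]
    simp_rw [this]
    rw [lintegral_const_mul' _ _ ENNReal.ofReal_ne_top, WE, if_pos hS, hdS, kap, ← mul_assoc, mul_comm, ← ENNReal.ofReal_mul (abs_nonneg _)]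
    congr 2
    have h2 : 0 < T.det ^ 2 := by positivity
    rw [Real.rpow_add h2, ← Real.sqrt_eq_rpow, Real.sqrt_sq_eq_abs, mul_comm]
  · have : ∀ c, WE μ (S - vecMulVec c c) = 0 := by
      intro c
      rw [WE, if_neg]
      intro h
      apply hS
      have h2 : (vecMulVec c c).PosSemidef := by simpa using posSemidef_vecMulVec_self_star c
      have := h.add_posSemidef h2
      simpa using this
    simp_rw [this]
    simp [WE, hS]

def sumFinE (N : ℕ) : Unit ⊕ Fin N ≃ Fin (N + 1) where
  toFun := Sum.elim (fun _ => 0) Fin.succ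
  invFun := Fin.cases (Sum.inl ()) Sum.inr
  left_inv := by rintro (_ | i) <;> simp
  right_inv := by intro i; refine Fin.cases ?_ (fun j => ?_) i <;> simp

lemma WE_reindex {ι κ : Type} [Fintype ι] [DecidableEq ι] [Fintype κ] [DecidableEq κ] (e : ι ≃ κ) (μ : ℝ)
    (S : Matrix κ κ ℝ) : WE μ (S.submatrix e e) = WE μ S := by
  have h : (S.submatrix e e).PosDef ↔ S.PosDef := by
    constructor
    · intro h
      have := h.submatrix (e := e.symm) e.symm.injective
      simpa using this
    · intro h
      exact h.submatrix e.injective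
  unfold WE
  rw [det_submatrix_equiv_self]
  by_cases hS : S.PosDef
  · rw [if_pos hS, if_pos (h.2 hS)]
  · rw [if_neg hS, if_neg (fun x => hS (h.1 x))]

lemma WE_block {N : ℕ} (μ α : ℝ) (b : Fin N → ℝ) (C : Matrix (Fin N) (Fin N) ℝ) :
    WE μ (fromBlocks (Matrix.of fun _ _ : Unit => α) (replicateRow Unit b) (replicateCol Unit b) C) =
      if 0 < α then ENNReal.ofReal (α ^ μ) * WE μ (C - α⁻¹ • vecMulVec b b) else 0 := by
  set A : Matrix Unit Unit ℝ := Matrix.of fun _ _ : Unit => α with hA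
  split_ifs with h
  · have hAd : A = diagonal (fun _ => α) := by ext i j; simp [hA]
    have hApd : A.PosDef := by rw [hAd]; exact PosDef.diagonal (fun _ => h)
    have hAi : A * (α⁻¹ • (1 : Matrix Unit Unit ℝ)) = 1 := by
      rw [hAd]; ext i j; simp [h.ne']
    letI : Invertible A := invertibleOfRightInverse _ _ hAi
    have hinv : A⁻¹ = α⁻¹ • (1 : Matrix Unit Unit ℝ) := inv_eq_right_inv hAi
    have hbT : (replicateRow Unit b)ᴴ = replicateCol Unit b := by ext i j; simp
    have hs : replicateCol Unit b * A⁻¹ * replicateRow Unit b = α⁻¹ • vecMulVec b b := by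
      rw [hinv, Matrix.mul_smul, Matrix.mul_one, Matrix.smul_mul, ← vecMulVec_eq]
    have hdet : (fromBlocks A (replicateRow Unit b) (replicateCol Unit b) C).det = α * (C - α⁻¹ • vecMulVec b b).det := by
      rw [det_fromBlocks₁₁, invOf_eq_nonsing_inv, hs]
      simp [hA]
    have hps := PosDef.fromBlocks₁₁ (replicateRow Unit b) C hApd
    rw [hbT, hs] at hps
    have hpd : (fromBlocks A (replicateRow Unit b) (replicateCol Unit b) C).PosDef ↔ (C - α⁻¹ • vecMulVec b b).PosDef := by
      rw [posDef_iff', posDef_iff', hps, hdet]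
      simp [h.ne']
    unfold WE
    by_cases hp : (C - α⁻¹ • vecMulVec b b).PosDef
    · rw [if_pos hp, if_pos (hpd.2 hp), hdet, Real.mul_rpow h.le hp.det_pos.le, ENNReal.ofReal_mul (by positivity)]
    · rw [if_neg hp, if_neg (fun x => hp (hpd.1 x)), mul_zero]
  · rw [WE, if_neg]
    intro hp
    have := hp.diag_pos (i := Sum.inl ())
    simp [hA] at this
    exact h this

lemma WE_scale {N : ℕ} (μ q : ℝ) (hq : 0 < q) (S : Matrix (Fin N) (Fin N) ℝ) :
    ∫⁻ c, WE μ (S - q⁻¹ • vecMulVec c c) = ENNReal.ofReal (q ^ ((N : ℝ) / 2)) * (kap N μ * WE (μ + 1 / 2) S) := by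
  have hs : 0 < Real.sqrt q := Real.sqrt_pos.2 hq
  have hd : (Real.sqrt q • (1 : Matrix (Fin N) (Fin N) ℝ)).det = q ^ ((N : ℝ) / 2) := by
    rw [det_smul, det_one, mul_one, Fintype.card_fin, Real.sqrt_eq_rpow, ← Real.rpow_natCast, ← Real.rpow_mul hq.le]
    congr 1; ring
  rw [cv_mat (Real.sqrt q • 1) (by rw [hd]; positivity) (fun c => WE μ (S - q⁻¹ • vecMulVec c c))
    (WE_meas μ (fun c => S - q⁻¹ • vecMulVec c c) (continuous_const.sub (cont_vmv.const_smul q⁻¹ : Continuous fun c : Fin N → ℝ => q⁻¹ • vecMulVec c c))), hd,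
    abs_of_pos (by positivity), ← WE_int]
  congr 2
  ext c
  congr 2
  rw [smul_mulVec, one_mulVec, smul_vecMulVec, vecMulVec_smul, smul_smul, smul_smul, mul_assoc, Real.mul_self_sqrt hq.le,
    inv_mul_cancel₀ hq.ne', one_smul]

end

section

def blk {N : ℕ} (ρ : ℝ) (c : Fin N → ℝ) (h : FM N) : FM (N + 1) :=
  Fin.cons (Fin.cons ρ 0) (fun i => Fin.cons (c i) (h i))

def grm {N : ℕ} (u : FM N) : Matrix (Fin N) (Fin N) ℝ := Matrix.of u * (Matrix.of u)ᵀ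

lemma grm_blk_sub {N : ℕ} (ρ : ℝ) (c : Fin N → ℝ) (h : FM N) :
    (1 - grm (blk ρ c h)).submatrix (sumFinE N) (sumFinE N) =
      fromBlocks (Matrix.of fun _ _ : Unit => 1 - ρ ^ 2) (replicateRow Unit (-(ρ • c))) (replicateCol Unit (-(ρ • c)))
        (1 - grm h - vecMulVec c c) := by
  ext i j
  rcases i with i | i <;> rcases j with j | j <;>
    simp [sumFinE, grm, blk, Matrix.mul_apply, Fin.sum_univ_succ, Matrix.one_apply, vecMulVec_apply, sq, Fin.succ_ne_zero, (Fin.succ_ne_zero _).symm, ← sub_sub, sub_right_comm]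
  exact mul_comm _ _

lemma grm_blk_eq {N : ℕ} (ρ : ℝ) (c : Fin N → ℝ) (h h' : FM N) (hh : grm h = grm h') :
    grm (blk ρ c h) = grm (blk ρ c h') := by
  have : (1 - grm (blk ρ c h)).submatrix (sumFinE N) (sumFinE N) = (1 - grm (blk ρ c h')).submatrix (sumFinE N) (sumFinE N) := by
    rw [grm_blk_sub, grm_blk_sub, hh]
  have h2 := congrArg (fun A => A.submatrix (sumFinE N).symm (sumFinE N).symm) this
  simp only [submatrix_submatrix, Equiv.self_comp_symm, submatrix_id_id] at h2
  exact sub_right_injective h2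

lemma cmin_blk {N : ℕ} (d : ℕ) (ρ : ℝ) (c : Fin N → ℝ) (h : FM N) :
    cmin (N + 1) d (grm (blk ρ c h)) = (if 1 ≤ d then ρ ^ 2 else 1) * cmin N (d - 1) (grm h) := by
  obtain ⟨t, k, ht, hk⟩ := exists_LQ (Matrix.of h)
  have hg : grm h = grm (fun i j => t i j) := by
    unfold grm
    rw [hk, LQ_tr]; rfl
  rw [grm_blk_eq ρ c h _ hg, hg]
  have hT : Tri (Matrix.of (blk ρ c fun i j => t i j)) := by
    intro i j hij
    refine Fin.cases (fun hij => ?_) (fun i hij => ?_) i hij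
    · obtain ⟨j, rfl⟩ := Fin.exists_succ_eq.2 hij.ne'
      simp [blk]
    · obtain ⟨j, rfl⟩ := Fin.exists_succ_eq.2 (Fin.ne_zero_of_lt hij)
      simpa [blk] using ht i j (by simpa using hij)
  have e1 := cmin_tt (N + 1) d _ hT
  have e2 := cmin_tt N (d - 1) t ht
  unfold grm
  rw [e1, show (Matrix.of fun i j => t i j) = t from rfl, e2, tdiag, tdiag, Fin.prod_univ_succ]
  have h0 : (Matrix.of (blk ρ c fun i j => t i j)) 0 0 = ρ := rfl
  have hs : ∀ i : Fin N, (Matrix.of (blk ρ c fun i j => t i j)) i.succ i.succ = t i i := fun i => rfl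
  rw [h0]
  congr 1
  refine Finset.prod_congr rfl fun i _ => ?_
  rw [hs, Fin.val_succ]
  by_cases hh : (i : ℕ) < d - 1
  · rw [if_pos hh, if_pos (by omega)]
  · rw [if_neg hh, if_neg (by omega)]

lemma det_blk {N : ℕ} (ρ : ℝ) (c : Fin N → ℝ) (h : FM N) : (grm (blk ρ c h)).det = ρ ^ 2 * (grm h).det := by
  have := cmin_blk (N + 1) ρ c h
  rw [cmin_full] at this
  rw [this, if_pos (by omega), Nat.add_sub_cancel, cmin_full]

lemma cmin_zero (N : ℕ) (X : Matrix (Fin N) (Fin N) ℝ) : cmin N 0 X = 1 := by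
  induction N with
  | zero => rfl
  | succ N ih => rw [cmin_corner (by omega), ih]

def JF {N M : ℕ} (d : Fin M → ℕ) (ν μ : ℝ) (P : Matrix (Fin N) (Fin N) ℝ) : ENNReal :=
  ENNReal.ofReal ((∏ j, cmin N (d j) P) * P.det ^ ν) * WE μ (1 - P)

lemma JF_meas {N M : ℕ} (d : Fin M → ℕ) (ν μ : ℝ) {α : Type} [TopologicalSpace α] [MeasurableSpace α] [BorelSpace α]
    (f : α → Matrix (Fin N) (Fin N) ℝ) (hf : Continuous f) : Measurable (fun x => JF d ν μ (f x)) := by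
  unfold JF
  refine Measurable.mul (ENNReal.measurable_ofReal.comp (Measurable.mul ?_ ?_)) ?_
  · exact ((hprod_cont N d).comp hf).measurable
  · exact hf.matrix_det.measurable.pow_const ν
  · exact WE_meas μ (fun x => 1 - f x) (continuous_const.sub hf)

lemma grm_cont {N : ℕ} : Continuous (grm : FM N → Matrix (Fin N) (Fin N) ℝ) := by
  have hofc : Continuous fun u : FM N => (Matrix.of u : Matrix (Fin N) (Fin N) ℝ) := continuous_id
  exact hofc.matrix_mul hofc.matrix_transpose

def JI (N : ℕ) {M : ℕ} (d : Fin M → ℕ) (ν μ : ℝ) : ENNReal := ∫⁻ u : FM N, JF d ν μ (grm u)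

lemma grm_det_nonneg {N : ℕ} (u : FM N) : 0 ≤ (grm u).det := by
  unfold grm; rw [det_mul, det_transpose]; exact mul_self_nonneg _

lemma JF_blk {N M : ℕ} (d : Fin M → ℕ) (ν μ : ℝ) (ρ : ℝ) (h : FM N) :
    ∫⁻ c, JF d ν μ (grm (blk ρ c h)) =
      ENNReal.ofReal (rw' (Finset.univ.filter fun j => 1 ≤ d j).card ν (μ + (N : ℝ) / 2) (ρ ^ 2)) * kap N μ *
        JF (fun j => d j - 1) ν (μ + 1 / 2) (grm h) := by
  have h1 : ∀ c, JF d ν μ (grm (blk ρ c h)) =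
      ENNReal.ofReal ((ρ ^ 2) ^ (Finset.univ.filter fun j => 1 ≤ d j).card * (ρ ^ 2) ^ ν) *
      (ENNReal.ofReal ((∏ j, cmin N (d j - 1) (grm h)) * (grm h).det ^ ν) *
      if 0 < 1 - ρ ^ 2 then ENNReal.ofReal ((1 - ρ ^ 2) ^ μ) * WE μ (1 - grm h - (1 - ρ ^ 2)⁻¹ • vecMulVec c c) else 0) := by
    intro c
    have hW : WE μ (1 - grm (blk ρ c h)) = if 0 < 1 - ρ ^ 2 then ENNReal.ofReal ((1 - ρ ^ 2) ^ μ) * WE μ (1 - grm h - (1 - ρ ^ 2)⁻¹ • vecMulVec c c) else 0 := by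
      rw [← WE_reindex (sumFinE N), grm_blk_sub, WE_block]
      split_ifs with hq
      · congr 2
        rw [sub_sub]
        congr 1
        rw [neg_vecMulVec, vecMulVec_neg, neg_neg, smul_vecMulVec, vecMulVec_smul, smul_smul, smul_smul]
        have : (1 - ρ ^ 2)⁻¹ = 1 + (1 - ρ ^ 2)⁻¹ * (ρ * ρ) := by field_simp; ring
        nth_rw 2 [this]
        rw [add_smul, one_smul]
        simp [mul_assoc]
      · rfl
    rw [JF, hW, ← mul_assoc, ← ENNReal.ofReal_mul (by positivity)]
    congr 2
    simp_rw [cmin_blk]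
    rw [Finset.prod_mul_distrib, det_blk, Real.mul_rpow (by positivity) (grm_det_nonneg h), Finset.prod_ite,
      Finset.prod_const, Finset.prod_const_one, mul_one]
    ring
  simp_rw [h1]
  rw [lintegral_const_mul' _ _ ENNReal.ofReal_ne_top, lintegral_const_mul' _ _ ENNReal.ofReal_ne_top]
  unfold rw'
  by_cases hq : ρ ^ 2 < 1
  · have hq' : 0 < 1 - ρ ^ 2 := by linarith
    simp only [if_pos hq', if_pos hq]
    rw [lintegral_const_mul' _ _ ENNReal.ofReal_ne_top, WE_scale _ _ hq', Real.rpow_add hq', JF,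
      ENNReal.ofReal_mul (p := (ρ ^ 2) ^ (Finset.univ.filter fun j => 1 ≤ d j).card * (ρ ^ 2) ^ ν) (by positivity),
      ENNReal.ofReal_mul (p := (1 - ρ ^ 2) ^ μ) (by positivity)]
    ac_rfl
  · have hq' : ¬ 0 < 1 - ρ ^ 2 := by linarith
    simp only [if_neg hq', if_neg hq]
    simp

end

section

/-- right multiplication on rows, rectangular -/
lemma rows_mp {N K : ℕ} (k : OG K) :
    MeasurePreserving (fun (G : Fin N → Fin K → ℝ) (i : Fin N) => (G i) ᵥ* k.1) volume volume :=
  volume_preserving_pi (fun _ => og_vecMul_mp k)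

lemma grm_mul_og {N : ℕ} (u : FM N) (k : OG N) : grm (fun i => u i ᵥ* k.1) = grm u := by
  have : (Matrix.of fun i => u i ᵥ* k.1) = Matrix.of u * k.1 := by
    ext i j; rfl
  unfold grm
  rw [this, LQ_tr]

lemma cons_cont {N : ℕ} : Continuous fun x : (Fin (N + 1) → ℝ) × (Fin N → Fin (N + 1) → ℝ) => (Fin.cons x.1 x.2 : FM (N + 1)) := by
  refine continuous_pi fun i => ?_
  refine Fin.cases ?_ (fun i => ?_) i
  · simpa using continuous_fst
  · simp only [Fin.cons_succ]; exact (continuous_apply i).comp continuous_snd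

lemma step1 {N : ℕ} (F : FM (N + 1) → ENNReal) (hF : Measurable F) :
    ∫⁻ u, F u = ∫⁻ r : Fin (N + 1) → ℝ, ∫⁻ G : Fin N → Fin (N + 1) → ℝ, F (Fin.cons r G) := by
  have mp := (volume_preserving_piFinSuccAbove (fun _ : Fin (N + 1) => Fin (N + 1) → ℝ) 0).symm
  rw [← mp.lintegral_comp hF, Measure.volume_eq_prod, lintegral_prod]
  · refine lintegral_congr fun r => lintegral_congr fun G => ?_
    congr 1
    exact Fin.insertNth_zero' r G
  · exact (hF.comp mp.measurable).aemeasurable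

lemma step2 {N : ℕ} (F : FM (N + 1) → ENNReal) (hF : Measurable F) (hinv : ∀ u (k : OG (N + 1)), F (fun i => u i ᵥ* k.1) = F u)
    (r : Fin (N + 1) → ℝ) :
    ∫⁻ G : Fin N → Fin (N + 1) → ℝ, F (Fin.cons r G) = ∫⁻ G : Fin N → Fin (N + 1) → ℝ, F (Fin.cons (Fin.cons (Real.sqrt (r ⬝ᵥ r)) 0) G) := by
  obtain ⟨k, hk⟩ := og_trans r 0
  have hr : r = (Fin.cons (Real.sqrt (r ⬝ᵥ r)) 0 : Fin (N + 1) → ℝ) ᵥ* k.1 := by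
    nth_rw 1 [hk]
    ext j
    simp [vecMul, dotProduct, Fin.sum_univ_succ]
  have hm : Measurable fun G : Fin N → Fin (N + 1) → ℝ => F (Fin.cons r G) :=
    hF.comp ((cons_cont.comp (Continuous.prodMk continuous_const continuous_id)).measurable)
  rw [← (rows_mp (N := N) k).lintegral_comp hm]
  refine lintegral_congr fun G => ?_
  rw [← hinv (Fin.cons (Fin.cons (Real.sqrt (r ⬝ᵥ r)) 0) G) k]
  congr 1
  ext i j
  refine Fin.cases ?_ (fun i => ?_) i
  · simp only [Fin.cons_zero]; nth_rw 1 [hr]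
  · simp only [Fin.cons_succ]

lemma blk_cont {N : ℕ} : Continuous fun x : ℝ × (Fin N → ℝ) × FM N => blk x.1 x.2.1 x.2.2 := by
  refine continuous_pi fun i => continuous_pi fun j => ?_
  unfold blk
  refine Fin.cases ?_ (fun i => ?_) i <;> refine Fin.cases ?_ (fun j => ?_) j <;> simp
  · exact continuous_fst
  · exact continuous_const
  · fun_prop
  · fun_prop

lemma step3 {N : ℕ} (F : FM (N + 1) → ENNReal) (hF : Measurable F) (ρ : ℝ) :
    ∫⁻ G : Fin N → Fin (N + 1) → ℝ, F (Fin.cons (Fin.cons ρ 0) G) =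
      ∫⁻ h : FM N, ∫⁻ c : Fin N → ℝ, F (blk ρ c h) := by
  have mp1 : MeasurePreserving (fun (G : Fin N → ℝ × (Fin N → ℝ)) (i : Fin N) =>
      (MeasurableEquiv.piFinSuccAbove (fun _ : Fin (N + 1) => ℝ) 0).symm (G i)) volume volume :=
    volume_preserving_pi (fun _ => (volume_preserving_piFinSuccAbove (fun _ : Fin (N + 1) => ℝ) 0).symm)
  have mp2 := (volume_measurePreserving_arrowProdEquivProdArrow ℝ (Fin N → ℝ) (Fin N)).symm
  have hm : Measurable fun G : Fin N → Fin (N + 1) → ℝ => F (Fin.cons (Fin.cons ρ 0) G) :=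
    hF.comp ((cons_cont.comp (Continuous.prodMk continuous_const continuous_id)).measurable)
  rw [← mp1.lintegral_comp hm]
  have := mp2.lintegral_comp (hm.comp mp1.measurable)
  simp only [Function.comp] at this
  rw [← this, Measure.volume_eq_prod, lintegral_prod_symm]
  · refine lintegral_congr fun h => lintegral_congr fun c => ?_
    unfold blk
    congr 2
    ext1 i
    exact Fin.insertNth_zero' (c i) (h i)
  · exact ((hm.comp mp1.measurable).comp mp2.measurable).aemeasurable

lemma JI_rec {N M : ℕ} (d : Fin M → ℕ) (ν μ : ℝ) :
    JI (N + 1) d ν μ = (∫⁻ r : Fin (N + 1) → ℝ, ENNReal.ofReal (rw' (Finset.univ.filter fun j => 1 ≤ d j).card ν (μ + (N : ℝ) / 2) (r ⬝ᵥ r))) *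
      kap N μ * JI N (fun j => d j - 1) ν (μ + 1 / 2) := by
  have hF : Measurable fun u : FM (N + 1) => JF d ν μ (grm u) := JF_meas d ν μ grm grm_cont
  have hm : Measurable fun r : Fin (N + 1) → ℝ => ENNReal.ofReal (rw' (Finset.univ.filter fun j => 1 ≤ d j).card ν (μ + (N : ℝ) / 2) (r ⬝ᵥ r)) := by
    refine ENNReal.measurable_ofReal.comp ((rw'_meas _ ν _).comp ?_)
    unfold dotProduct
    fun_prop
  rw [JI, step1 _ hF, mul_assoc, ← lintegral_mul_const _ hm]
  refine lintegral_congr fun r => ?_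
  rw [step2 _ hF (fun u k => by rw [grm_mul_og]), step3 _ hF]
  simp_rw [JF_blk]
  rw [lintegral_const_mul _ (JF_meas _ ν _ grm grm_cont), Real.sq_sqrt (dot_nonneg r), JI, mul_assoc]

def GG : (N : ℕ) → {M : ℕ} → (Fin M → ℕ) → ℝ → ℝ → ℝ
  | 0, _, _, _, _ => 1
  | N + 1, _, d, ν, μ => Real.Gamma ((Finset.univ.filter fun j => 1 ≤ d j).card + ν + ((N : ℝ) + 1) / 2) /
      Real.Gamma ((Finset.univ.filter fun j => 1 ≤ d j).card + ν + ((N : ℝ) + 1) / 2 + (μ + (N : ℝ) / 2 + 1)) *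
      GG N (fun j => d j - 1) ν (μ + 1 / 2)

lemma kap_pos (N : ℕ) (μ : ℝ) (hμ : -(1/2) < μ) : ∃ c : ℝ, 0 < c ∧ kap N μ = ENNReal.ofReal c := by
  cases N with
  | zero =>
    refine ⟨1, one_pos, ?_⟩
    rw [kap]
    have : ∀ c : Fin 0 → ℝ, ENNReal.ofReal (rw' 0 0 μ (c ⬝ᵥ c)) = 1 := by
      intro c; simp [rw', dotProduct]
    simp_rw [this]
    simp [volume_pi, Measure.pi_of_empty]
  | succ N =>
    obtain ⟨C, hC, h⟩ := radial N
    have hp : (0:ℝ) < (0:ℕ) + 0 + (N + 1 : ℕ) / 2 := by push_cast; positivity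
    exact ⟨_, mul_pos hC (ProbabilityTheory.beta_pos hp (by linarith)), h 0 0 μ hp (by linarith)⟩

lemma JI_eq (N : ℕ) : ∀ (ν μ : ℝ), -(1/2) < ν → -(1/2) < μ → ∃ C : ℝ, 0 < C ∧ ∀ (M : ℕ) (d : Fin M → ℕ),
    JI N d ν μ = ENNReal.ofReal (C * GG N d ν μ) := by
  induction N with
  | zero =>
    intro ν μ _ _
    refine ⟨1, one_pos, fun M d => ?_⟩
    have : ∀ u : FM 0, JF d ν μ (grm u) = 1 := by
      intro u
      have hp : (1 - grm u : Matrix (Fin 0) (Fin 0) ℝ).PosDef := by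
        rw [show (1 - grm u : Matrix (Fin 0) (Fin 0) ℝ) = 1 from Subsingleton.elim _ _]; exact PosDef.one
      simp [JF, WE, hp, cmin]
    rw [JI]; simp_rw [this]; simp [GG, volume_pi, Measure.pi_of_empty]
  | succ N ih =>
    intro ν μ hν hμ
    obtain ⟨C, hC, h⟩ := ih ν (μ + 1 / 2) hν (by linarith)
    obtain ⟨K, hK, hk⟩ := kap_pos N μ hμ
    obtain ⟨R, hR, hr⟩ := radial N
    have hs : 0 < μ + (N : ℝ) / 2 + 1 := by have : (0:ℝ) ≤ N := Nat.cast_nonneg N; linarith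
    refine ⟨C * K * R * Real.Gamma (μ + (N : ℝ) / 2 + 1), by have := Real.Gamma_pos_of_pos hs; positivity, fun M d => ?_⟩
    have hx : (0:ℝ) < ((Finset.univ.filter fun j => 1 ≤ d j).card : ℝ) + ν + (N + 1 : ℕ) / 2 := by
      have h1 : (0:ℝ) ≤ N := Nat.cast_nonneg N
      have h2 : (0:ℝ) ≤ ((Finset.univ.filter fun j => 1 ≤ d j).card : ℝ) := Nat.cast_nonneg _
      push_cast; linarith
    have hb := ProbabilityTheory.beta_pos hx hs
    rw [JI_rec, hr _ ν _ hx hs, hk, h, ← ENNReal.ofReal_mul (by positivity), ← ENNReal.ofReal_mul (by positivity)]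
    congr 1
    rw [GG, ProbabilityTheory.beta]
    push_cast
    ring

end

section

def flipL (N : ℕ) : FM N →ₗ[ℝ] FM N where
  toFun u := fun i j => u j i
  map_add' _ _ := rfl
  map_smul' _ _ := rfl

lemma flip_mp (N : ℕ) : MeasurePreserving (fun (u : FM N) (i j : Fin N) => u j i) volume volume := by
  have hd : LinearMap.det (flipL N) * LinearMap.det (flipL N) = 1 := by
    rw [← LinearMap.det_comp]
    have : (flipL N) ∘ₗ (flipL N) = LinearMap.id := by ext; rfl
    rw [this, LinearMap.det_id]
  have h0 : LinearMap.det (flipL N) ≠ 0 := by intro h; rw [h] at hd; simp at hd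
  have h1 : |(LinearMap.det (flipL N))⁻¹| = 1 := by
    rw [abs_inv]
    rcases mul_self_eq_one_iff.1 hd with h | h <;> simp [h]
  have := Measure.map_linearMap_addHaar_eq_smul_addHaar (volume : Measure (FM N)) h0
  rw [h1, ENNReal.ofReal_one, one_smul] at this
  exact ⟨(LinearMap.continuous_of_finiteDimensional (flipL N)).measurable, this⟩

lemma rmul_mp {N : ℕ} (k : OG N) : MeasurePreserving (fun (u : FM N) (i j : Fin N) => (Matrix.of u * k.1) i j) volume volume :=
  rows_mp k

lemma lmul_mp {N : ℕ} (k : OG N) : MeasurePreserving (fun (u : FM N) (i j : Fin N) => (k.1 * Matrix.of u) i j) volume volume := by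
  have h := ((flip_mp N).comp (rmul_mp (k⁻¹))).comp (flip_mp N)
  convert h using 1
  ext u i j
  have : (k⁻¹ : OG N).1 = k.1ᵀ := by
    rw [← mul_one (k⁻¹ : OG N).1, ← og_mul_tr k, ← mul_assoc]
    have : (k⁻¹ : OG N).1 * k.1 = 1 := congrArg Subtype.val (inv_mul_cancel k)
    rw [this, one_mul]
  simp only [Function.comp, Matrix.mul_apply, this, transpose_apply, Matrix.of_apply]
  exact Finset.sum_congr rfl fun _ _ => mul_comm _ _

lemma mp_withDensity {α : Type} [MeasurableSpace α] {m : Measure α} {f : α → α} (hf : MeasurePreserving f m m)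
    {w : α → ENNReal} (hw : Measurable w) (hfw : ∀ x, w (f x) = w x) : MeasurePreserving f (m.withDensity w) (m.withDensity w) := by
  refine ⟨hf.measurable, ?_⟩
  ext s hs
  rw [Measure.map_apply hf.measurable hs, withDensity_apply _ hs, withDensity_apply _ (hf.measurable hs),
    ← lintegral_indicator hs, ← lintegral_indicator (hf.measurable hs), ← hf.lintegral_comp (hw.indicator hs)]
  refine lintegral_congr fun x => ?_
  by_cases h : f x ∈ s
  · rw [Set.indicator_of_mem h, Set.indicator_of_mem (show x ∈ f ⁻¹' s from h), hfw]
  · rw [Set.indicator_of_notMem h, Set.indicator_of_notMem (show x ∉ f ⁻¹' s from h)]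

def jm (N : ℕ) (ν μ : ℝ) : Measure (FM N) := volume.withDensity fun u => JF (Fin.elim0 : Fin 0 → ℕ) ν μ (grm u)

lemma JF_conj {N : ℕ} (ν μ : ℝ) (k : OG N) (P : Matrix (Fin N) (Fin N) ℝ) :
    JF (Fin.elim0 : Fin 0 → ℕ) ν μ (k.1 * P * k.1ᵀ) = JF (Fin.elim0 : Fin 0 → ℕ) ν μ P := by
  have hd : k.1.det ^ 2 = 1 := by
    have := congrArg Matrix.det (og_mul_tr k)
    rw [Matrix.det_mul, Matrix.det_transpose, Matrix.det_one] at this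
    rw [sq, this]
  unfold JF
  have h1 : (1 - k.1 * P * k.1ᵀ) = k.1 * (1 - P) * k.1ᵀ := by
    rw [Matrix.mul_sub, Matrix.sub_mul, mul_one, og_mul_tr]
  have h2 : (k.1 * P * k.1ᵀ).det = P.det := by
    rw [det_mul, det_mul, det_transpose]
    linear_combination P.det * hd
  rw [h1, WE_conj _ _ _ (by intro h; rw [h] at hd; simp at hd), hd, h2]
  simp

lemma jm_r (N : ℕ) (ν μ : ℝ) (k : OG N) : MeasurePreserving (fun (u : FM N) (i j : Fin N) => (Matrix.of u * k.1) i j) (jm N ν μ) (jm N ν μ) :=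
  mp_withDensity (rmul_mp k) (JF_meas _ ν μ grm grm_cont) fun u => by
    congr 1
    exact LQ_tr _ k

lemma jm_l (N : ℕ) (ν μ : ℝ) (k : OG N) : MeasurePreserving (fun (u : FM N) (i j : Fin N) => (k.1 * Matrix.of u) i j) (jm N ν μ) (jm N ν μ) :=
  mp_withDensity (lmul_mp k) (JF_meas _ ν μ grm grm_cont) fun u => by
    have : grm (fun (i j : Fin N) => (k.1 * Matrix.of u) i j) = k.1 * grm u * k.1ᵀ := by
      unfold grm
      rw [show (Matrix.of fun (i j : Fin N) => (k.1 * Matrix.of u) i j) = k.1 * Matrix.of u from rfl, transpose_mul]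
      simp only [mul_assoc]
    rw [this, JF_conj]

lemma jm_bdd (N : ℕ) (ν μ : ℝ) : ∀ᵐ u ∂(jm N ν μ), ∀ i j, |u i j| ≤ 1 := by
  unfold jm
  rw [ae_withDensity_iff (JF_meas _ ν μ grm grm_cont)]
  refine Filter.Eventually.of_forall fun u hu i j => ?_
  have hp : (1 - grm u).PosDef := by
    by_contra h
    exact hu (by simp [JF, WE, h])
  have h1 := hp.diag_pos (i := i)
  have h2 : (1 - grm u) i i = 1 - ∑ l, u i l ^ 2 := by
    simp [grm, Matrix.mul_apply, sq]
  rw [h2] at h1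
  have h3 : u i j ^ 2 ≤ ∑ l, u i l ^ 2 := Finset.single_le_sum (f := fun l => u i l ^ 2) (fun _ _ => by positivity) (Finset.mem_univ j)
  rw [← sq_le_one_iff_abs_le_one]
  linarith

lemma jm_moment (N : ℕ) {M : ℕ} (ν μ : ℝ) (d : Fin M → ℕ) :
    ∫⁻ u, ENNReal.ofReal (∏ j, cmin N (d j) (grm u)) ∂(jm N ν μ) = JI N d ν μ := by
  unfold jm JI
  have hmm : Measurable fun u : FM N => ENNReal.ofReal (∏ j, cmin N (d j) (grm u)) :=
    ENNReal.measurable_ofReal.comp ((hprod_cont N d).comp grm_cont).measurable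
  rw [lintegral_withDensity_eq_lintegral_mul _ (JF_meas _ ν μ grm grm_cont) hmm]
  refine lintegral_congr fun u => ?_
  simp only [Pi.mul_apply, JF]
  rw [ENNReal.ofReal_mul (p := ∏ j, cmin N (d j) (grm u)) (Finset.prod_nonneg fun j _ => cmin_nonneg _ _ _)]
  simp
  ring

lemma GG_pos (N : ℕ) {M : ℕ} (d : Fin M → ℕ) : ∀ (ν μ : ℝ), -(1/2) < ν → -(1/2) < μ → 0 < GG N d ν μ := by
  induction N generalizing M with
  | zero => intros; simp [GG]
  | succ N ih =>
    intro ν μ hν hμ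
    rw [GG]
    have h1 : (0:ℝ) ≤ N := Nat.cast_nonneg N
    have h2 : (0:ℝ) ≤ ((Finset.univ.filter fun j => 1 ≤ d j).card : ℝ) := Nat.cast_nonneg _
    have := Real.Gamma_pos_of_pos (s := ((Finset.univ.filter fun j => 1 ≤ d j).card : ℝ) + ν + ((N : ℝ) + 1) / 2) (by linarith)
    have := Real.Gamma_pos_of_pos (s := ((Finset.univ.filter fun j => 1 ≤ d j).card : ℝ) + ν + ((N : ℝ) + 1) / 2 + (μ + (N : ℝ) / 2 + 1)) (by linarith)
    have := ih (fun j => d j - 1) ν (μ + 1 / 2) hν (by linarith)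
    positivity

lemma jm_eig (N : ℕ) (ν μ : ℝ) (hν : -(1/2) < ν) (hμ : -(1/2) < μ) : IsFiniteMeasure (jm N ν μ) ∧ 0 < (jm N ν μ).real Set.univ ∧
    ∀ (M : ℕ) (d : Fin M → ℕ), Antitone d → (∀ j, d j ≤ N) → ∀ Y : Matrix (Fin N) (Fin N) ℝ, Yᵀ = -Y →
    ∫ u, Sdet (fun j => N - d j + 2 * (j : ℕ)) (Matrix.of u * Y * (Matrix.of u)ᵀ).charpoly ∂(jm N ν μ) =
      (jm N ν μ).real Set.univ * (GG N d ν μ / GG N (Fin.elim0 : Fin 0 → ℕ) ν μ) *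
        Sdet (fun j => N - d j + 2 * (j : ℕ)) Y.charpoly := by
  obtain ⟨C, hC, h⟩ := JI_eq N ν μ hν hμ
  have hg := GG_pos N (Fin.elim0 : Fin 0 → ℕ) ν μ hν hμ
  have hu : (jm N ν μ) Set.univ = ENNReal.ofReal (C * GG N (Fin.elim0 : Fin 0 → ℕ) ν μ) := by
    rw [← h, ← jm_moment]; simp
  have hr : (jm N ν μ).real Set.univ = C * GG N (Fin.elim0 : Fin 0 → ℕ) ν μ := by
    rw [Measure.real, hu, ENNReal.toReal_ofReal (by positivity)]
  haveI : IsFiniteMeasure (jm N ν μ) := ⟨by rw [hu]; exact ENNReal.ofReal_lt_top⟩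
  refine ⟨this, by rw [hr]; positivity, fun M d hd hdN Y hY => ?_⟩
  rw [eig (jm N ν μ) (jm_bdd N ν μ) (jm_l N ν μ) (jm_r N ν μ) d hd hdN Y hY, hr]
  congr 1
  have e := integral_eq_lintegral_of_nonneg_ae (μ := jm N ν μ) (f := fun u => ∏ j, cmin N (d j) (grm u))
    (Filter.Eventually.of_forall fun u => Finset.prod_nonneg fun j _ => cmin_nonneg _ _ _)
    ((hprod_cont N d).comp grm_cont).aestronglyMeasurable
  have hgd := GG_pos N d ν μ hν hμ
  rw [jm_moment, h, ENNReal.toReal_ofReal (by positivity)] at e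
  refine e.trans ?_
  field_simp

end

section

def hh (ν σ : ℝ) (q : ℕ) : ℝ := Real.Gamma (2 * q + 2 * ν + 1) / Real.Gamma (2 * q + 2 * ν + 1 + σ)

lemma hh_pos (ν σ : ℝ) (hν : -(1/2) < ν) (hσ : 0 ≤ σ) (q : ℕ) : 0 < hh ν σ q := by
  have h1 : (0:ℝ) ≤ q := Nat.cast_nonneg q
  exact div_pos (Real.Gamma_pos_of_pos (by linarith)) (Real.Gamma_pos_of_pos (by linarith))

def qf (n : ℕ) {M : ℕ} (c : Fin M → ℕ) (l : ℕ) : ℕ := (Finset.univ.filter fun j => l + 1 ≤ c j).card + (n - 1 - l)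

lemma GG_pair (n : ℕ) {M : ℕ} (c : Fin M → ℕ) (ν μ : ℝ) (hν : -(1/2) < ν) (hμ : -(1/2) < μ) :
    GG (2 * n + 1 + 1) (fun j => 2 * c j) ν μ =
      (2 : ℝ) ^ (2 * μ + 2 * n + 3) * hh ν (2 * μ + 2 * (n + 1) + 1) ((Finset.univ.filter fun j => 1 ≤ c j).card + n) *
        GG (2 * n) (fun j => 2 * (c j - 1)) ν (μ + 1) := by
  rw [GG, GG]
  have e1 : (Finset.univ.filter fun j => 1 ≤ 2 * c j) = Finset.univ.filter fun j => 1 ≤ c j := by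
    ext j; simp; omega
  have e2 : (Finset.univ.filter fun j => 1 ≤ 2 * c j - 1) = Finset.univ.filter fun j => 1 ≤ c j := by
    ext j; simp; omega
  have e3 : (fun j => 2 * c j - 1 - 1) = fun j => 2 * (c j - 1) := by ext j; omega
  have e4 : μ + 1 / 2 + 1 / 2 = μ + 1 := by ring
  rw [e1, e2, e3, e4]
  set a : ℝ := ((Finset.univ.filter fun j => 1 ≤ c j).card : ℝ) with ha
  have ha0 : 0 ≤ a := Nat.cast_nonneg _
  have hn0 : (0:ℝ) ≤ n := Nat.cast_nonneg _
  rw [← mul_assoc]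
  congr 1
  rw [hh]
  push_cast
  have d1 := Real.Gamma_mul_Gamma_add_half (a + ν + n + 1 / 2)
  have d2 := Real.Gamma_mul_Gamma_add_half (a + ν + μ + 2 * n + 2)
  have f1 : a + ν + (2 * (n:ℝ) + 1 + 1) / 2 = a + ν + n + 1 / 2 + 1 / 2 := by ring
  have f2 : a + ν + n + 1 / 2 + 1 / 2 + (μ + (2 * (n:ℝ) + 1) / 2 + 1) = a + ν + μ + 2 * n + 2 + 1 / 2 := by ring
  have f3 : a + ν + (2 * (n:ℝ) + 1) / 2 = a + ν + n + 1 / 2 := by ring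
  have f4 : a + ν + n + 1 / 2 + (μ + 1 / 2 + 2 * (n:ℝ) / 2 + 1) = a + ν + μ + 2 * n + 2 := by ring
  have f5 : 2 * (a + n) + 2 * ν + 1 = 2 * (a + ν + n + 1 / 2) := by ring
  have f6 : 2 * (a + ν + n + 1 / 2) + (2 * μ + 2 * ((n:ℝ) + 1) + 1) = 2 * (a + ν + μ + 2 * n + 2) := by ring
  rw [f1, f2, f3, f4, ← ha, f5, f6]
  have g1 : 0 < Real.Gamma (a + ν + n + 1 / 2) := Real.Gamma_pos_of_pos (by linarith)
  have g2 : 0 < Real.Gamma (a + ν + n + 1 / 2 + 1 / 2) := Real.Gamma_pos_of_pos (by linarith)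
  have g3 : 0 < Real.Gamma (a + ν + μ + 2 * n + 2) := Real.Gamma_pos_of_pos (by linarith)
  have g4 : 0 < Real.Gamma (a + ν + μ + 2 * n + 2 + 1 / 2) := Real.Gamma_pos_of_pos (by linarith)
  have g5 : 0 < Real.Gamma (2 * (a + ν + n + 1 / 2)) := Real.Gamma_pos_of_pos (by linarith)
  have g6 : 0 < Real.Gamma (2 * (a + ν + μ + 2 * n + 2)) := Real.Gamma_pos_of_pos (by linarith)
  have hpw : (2:ℝ) ^ (1 - 2 * (a + ν + n + 1 / 2)) = (2:ℝ) ^ (2 * μ + 2 * n + 3) * (2:ℝ) ^ (1 - 2 * (a + ν + μ + 2 * n + 2)) := by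
    rw [← Real.rpow_add two_pos]; congr 1; ring
  rw [div_mul_div_comm, mul_div_assoc', div_eq_div_iff (by positivity) (by positivity)]
  rw [mul_comm (Real.Gamma (a + ν + n + 1 / 2 + 1 / 2)), d1, mul_comm (Real.Gamma (a + ν + μ + 2 * n + 2 + 1 / 2)), d2, hpw]
  ring

lemma GG_even (n : ℕ) : ∀ (ν μ : ℝ), -(1/2) < ν → -(1/2) < μ → ∃ K : ℝ, 0 < K ∧ ∀ (M : ℕ) (c : Fin M → ℕ),
    GG (2 * n) (fun j => 2 * c j) ν μ = K * ∏ l ∈ Finset.range n, hh ν (2 * μ + 2 * n + 1) (qf n c l) := by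
  induction n with
  | zero => intro ν μ _ _; exact ⟨1, one_pos, fun M c => by simp [GG]⟩
  | succ n ih =>
    intro ν μ hν hμ
    obtain ⟨K, hK, h⟩ := ih ν (μ + 1) hν (by linarith)
    refine ⟨(2 : ℝ) ^ (2 * μ + 2 * n + 3) * K, by positivity, fun M c => ?_⟩
    show GG (2 * n + 1 + 1) _ ν μ = _
    rw [GG_pair n c ν μ hν hμ, h, Finset.prod_range_succ']
    have e0 : qf (n + 1) c 0 = (Finset.univ.filter fun j => 1 ≤ c j).card + n := by simp [qf]
    have es : ∀ l ∈ Finset.range n, hh ν (2 * μ + 2 * (n + 1 : ℕ) + 1) (qf (n + 1) c (l + 1)) = hh ν (2 * (μ + 1) + 2 * n + 1) (qf n (fun j => c j - 1) l) := by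
      intro l hl
      congr 1
      · push_cast; ring
      · unfold qf
        have h1 : (Finset.univ.filter fun j => l + 1 + 1 ≤ c j) = Finset.univ.filter fun j => l + 1 ≤ c j - 1 := by
          ext j; simp; omega
        have h2 : n + 1 - 1 - (l + 1) = n - 1 - l := by omega
        rw [h1, h2]
    rw [Finset.prod_congr rfl es, e0]
    push_cast
    ring

lemma GG_ratio (n : ℕ) (ν μ : ℝ) (hν : -(1/2) < ν) (hμ : -(1/2) < μ) (M : ℕ) (c : Fin M → ℕ) :
    GG (2 * n) (fun j => 2 * c j) ν μ / GG (2 * n) (Fin.elim0 : Fin 0 → ℕ) ν μ =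
      (∏ l : Fin n, hh ν (2 * μ + 2 * n + 1) (qf n c l)) / ∏ l : Fin n, hh ν (2 * μ + 2 * n + 1) (n - 1 - l) := by
  obtain ⟨K, hK, h⟩ := GG_even n ν μ hν hμ
  have h0 := h 0 Fin.elim0
  have e : (fun j : Fin 0 => 2 * (Fin.elim0 j : ℕ)) = (Fin.elim0 : Fin 0 → ℕ) := Subsingleton.elim _ _
  rw [e] at h0
  have e2 : ∀ l, qf n (Fin.elim0 : Fin 0 → ℕ) l = n - 1 - l := by intro l; simp [qf]
  simp_rw [e2] at h0
  rw [h, h0, mul_div_mul_left _ _ hK.ne', Finset.prod_range, Finset.prod_range]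

end

section

open Polynomial in
lemma qf_anti (n M : ℕ) (c : Fin M → ℕ) {l l' : ℕ} (h : l < l') (hl : l' < n) : qf n c l' < qf n c l := by
  unfold qf
  have : (Finset.univ.filter fun j => l' + 1 ≤ c j).card ≤ (Finset.univ.filter fun j => l + 1 ≤ c j).card := by
    apply Finset.card_le_card
    intro j; simp; omega
  omega

lemma qf_ne (n M : ℕ) (c : Fin M → ℕ) (hc : Antitone c) (hcn : ∀ j, c j ≤ n) (j : Fin M) (l : ℕ) (hl : l < n) :
    qf n c l ≠ n + j - c j := by
  unfold qf
  have h1 := hcn j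
  rcases le_or_gt (l + 1) (c j) with h | h
  · have : (Finset.Iic j).card ≤ (Finset.univ.filter fun j => l + 1 ≤ c j).card := by
      apply Finset.card_le_card
      intro i; simp; intro hi; exact h.trans (hc hi)
    rw [Fin.card_Iic] at this
    omega
  · have : (Finset.univ.filter fun j => l + 1 ≤ c j).card ≤ (Finset.Iio j).card := by
      apply Finset.card_le_card
      intro i; simp; intro hi
      by_contra hji
      have := hc (not_lt.mp hji)
      omega
    rw [Fin.card_Iio] at this
    omega

lemma qf_lt (n M : ℕ) (c : Fin M → ℕ) (l : ℕ) (hl : l < n) : qf n c l < M + n := by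
  unfold qf
  have : (Finset.univ.filter fun j => l + 1 ≤ c j).card ≤ M := (Finset.card_le_univ _).trans (by simp)
  omega

open Polynomial in
lemma altern (n M : ℕ) (c : Fin M → ℕ) (hc : Antitone c) (hcn : ∀ j, c j ≤ n) :
    ∃ ε : ℝ, ε * ε = 1 ∧ ∀ x : Fin n → ℝ,
      (Matrix.of fun j k : Fin M => (X ^ (k : ℕ) * ∏ i, (X - C (x i)) : ℝ[X]).coeff (n + j - c j)).det *
        (Matrix.of fun i l : Fin n => x i ^ (l : ℕ)).det = ε * (Matrix.of fun i l : Fin n => x i ^ (qf n c l)).det := by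
  have b0 : ∀ s : Fin M ⊕ Fin n, Sum.elim (fun k : Fin M => n + (k : ℕ)) (fun l : Fin n => (l : ℕ)) s < M + n := by
    rintro (k | l) <;> simp <;> omega
  have b1 : ∀ s : Fin M ⊕ Fin n, Sum.elim (fun k : Fin M => n + (k : ℕ) - c k) (fun l : Fin n => qf n c l) s < M + n := by
    rintro (k | l)
    · simp; omega
    · simpa using qf_lt n M c l l.2
  let e0 : Fin M ⊕ Fin n → Fin (M + n) := fun s => ⟨_, b0 s⟩
  let e1 : Fin M ⊕ Fin n → Fin (M + n) := fun s => ⟨_, b1 s⟩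
  have hb0 : Function.Bijective e0 := by
    rw [Fintype.bijective_iff_injective_and_card]
    refine ⟨?_, by simp⟩
    rintro (k | k) (l | l) h <;> simp [e0] at h <;> first | omega | (simp; omega)
  have qinj : ∀ k l : Fin n, qf n c k = qf n c l → k = l := by
    intro k l h
    rcases lt_trichotomy k l with h' | h' | h'
    · have := qf_anti n M c (Fin.lt_def.mp h') l.2; omega
    · exact h'
    · have := qf_anti n M c (Fin.lt_def.mp h') k.2; omega
  have hb1 : Function.Bijective e1 := by
    rw [Fintype.bijective_iff_injective_and_card]
    refine ⟨?_, by simp⟩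
    rintro (k | k) (l | l) h <;> simp [e1] at h
    · congr 1
      rcases lt_trichotomy k l with h' | h' | h'
      · have := hc h'.le; have := hcn k; have := hcn l; rw [Fin.lt_def] at h'; omega
      · exact h'
      · have := hc h'.le; have := hcn k; have := hcn l; rw [Fin.lt_def] at h'; omega
    · exact absurd h.symm (qf_ne n M c hc hcn k l l.2)
    · exact absurd h (qf_ne n M c hc hcn l k k.2)
    · rw [qinj k l h]
  let E0 := Equiv.ofBijective e0 hb0
  let E1 := Equiv.ofBijective e1 hb1
  let σ : Equiv.Perm (Fin M ⊕ Fin n) := E1.trans E0.symm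
  have hσ : ∀ s, e0 (σ s) = e1 s := fun s => E0.apply_symm_apply (E1 s)
  refine ⟨((Equiv.Perm.sign σ : ℤ) : ℝ), ?_, fun x => ?_⟩
  · rw [← Int.cast_mul, ← Units.val_mul, Int.units_mul_self]; simp
  set R : ℝ[X] := ∏ i, (X - C (x i)) with hR
  have hRm : R.Monic := monic_prod_of_monic _ _ fun i _ => monic_X_sub_C _
  have hRd : R.natDegree = n := by rw [hR, natDegree_prod_of_monic _ _ fun i _ => monic_X_sub_C _]; simp
  let Λ : Fin M ⊕ Fin n → (ℝ[X] →ₗ[ℝ] ℝ) := Sum.elim (fun k => lcoeff ℝ (n + k)) (fun i => leval (x i))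
  let P : Fin M ⊕ Fin n → ℝ[X] := Sum.elim (fun k => X ^ (k : ℕ) * R) (fun l => X ^ (qf n c l))
  have hPd : ∀ s, (P s).natDegree < M + n := by
    rintro (k | l)
    · refine (natDegree_mul_le).trans_lt ?_
      rw [hRd, natDegree_X_pow]; omega
    · simpa [P] using qf_lt n M c l l.2
  let V0 : Matrix (Fin M ⊕ Fin n) (Fin M ⊕ Fin n) ℝ := Matrix.of fun r s => Λ r (X ^ (e0 s : ℕ))
  let V1 : Matrix (Fin M ⊕ Fin n) (Fin M ⊕ Fin n) ℝ := Matrix.of fun r s => Λ r (X ^ (e1 s : ℕ))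
  let C1 : Matrix (Fin M ⊕ Fin n) (Fin M ⊕ Fin n) ℝ := Matrix.of fun s t => (P t).coeff (e1 s : ℕ)
  have hmul : V1 * C1 = Matrix.of fun r t => Λ r (P t) := by
    ext r t
    rw [Matrix.mul_apply]
    simp only [V1, C1, Matrix.of_apply]
    have := (P t).as_sum_range' (M + n) (hPd t)
    conv_rhs => rw [this, map_sum, Finset.sum_range]
    rw [← E1.sum_comp]
    refine Finset.sum_congr rfl fun s _ => ?_
    rw [← C_mul_X_pow_eq_monomial, ← smul_eq_C_mul, map_smul, smul_eq_mul, mul_comm]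
    rfl
  have hV : V1 = V0.submatrix id σ := by
    ext r s
    simp only [V0, V1, Matrix.of_apply, Matrix.submatrix_apply, id, hσ]
  have dV1 : V1.det = (Equiv.Perm.sign σ : ℤ) * V0.det := by rw [hV, Matrix.det_permute']
  have dV0 : V0.det = (Matrix.of fun i l : Fin n => x i ^ (l : ℕ)).det := by
    have : V0 = Matrix.fromBlocks 1 0 (Matrix.of fun (i : Fin n) (k : Fin M) => x i ^ (n + (k : ℕ))) (Matrix.of fun i l : Fin n => x i ^ (l : ℕ)) := by
      ext (r | r) (s | s)
      · simp [V0, Λ, e0, coeff_X_pow, Matrix.one_apply, Fin.ext_iff]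
      · simp [V0, Λ, e0, coeff_X_pow]; omega
      · simp [V0, Λ, e0]
      · simp [V0, Λ, e0]
    rw [this, Matrix.det_fromBlocks_zero₁₂, Matrix.det_one, one_mul]
  have dC1 : C1.det = (Matrix.of fun j k : Fin M => (X ^ (k : ℕ) * R : ℝ[X]).coeff (n + j - c j)).det := by
    have : C1 = Matrix.fromBlocks (Matrix.of fun j k : Fin M => (X ^ (k : ℕ) * R : ℝ[X]).coeff (n + j - c j)) 0
        (Matrix.of fun (i : Fin n) (k : Fin M) => (X ^ (k : ℕ) * R : ℝ[X]).coeff (qf n c i)) 1 := by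
      ext (r | r) (s | s)
      · simp [C1, P, e1]
      · simp [C1, P, e1, coeff_X_pow]; exact fun h => (qf_ne n M c hc hcn r s s.2 h.symm).elim
      · simp [C1, P, e1]
      · simp only [C1, P, e1, Matrix.of_apply, Sum.elim_inr, coeff_X_pow, Matrix.fromBlocks_apply₂₂, Matrix.one_apply]
        congr 1
        exact propext ⟨fun h => qinj _ _ h, fun h => by rw [h]⟩
    rw [this, Matrix.det_fromBlocks_zero₁₂, Matrix.det_one, mul_one]
  have dP : (V1 * C1).det = (Matrix.of fun i l : Fin n => x i ^ (qf n c l)).det := by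
    have : V1 * C1 = Matrix.fromBlocks (Matrix.of fun j k : Fin M => (X ^ (k : ℕ) * R : ℝ[X]).coeff (n + j))
        (Matrix.of fun (j : Fin M) (l : Fin n) => (X ^ (qf n c l) : ℝ[X]).coeff (n + j)) 0 (Matrix.of fun i l : Fin n => x i ^ (qf n c l)) := by
      rw [hmul]
      ext (r | r) (s | s)
      · simp [Λ, P]
      · simp [Λ, P]
      · simp only [Λ, P, Matrix.of_apply, Sum.elim_inr, Sum.elim_inl, leval_apply, Matrix.fromBlocks_apply₂₁, Matrix.zero_apply, hR, eval_mul, eval_prod]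
        rw [Finset.prod_eq_zero (Finset.mem_univ r) (by simp), mul_zero]
      · simp [Λ, P]
    rw [this, Matrix.det_fromBlocks_zero₂₁, Matrix.det_of_isUpperTriangular]
    · rw [Finset.prod_eq_one, one_mul]
      intro k _
      rw [Matrix.of_apply, coeff_X_pow_mul, ← hRd]; exact hRm
    · intro j k hkj
      have hkj' : (k : ℕ) < j := hkj
      rw [Matrix.of_apply]
      apply coeff_eq_zero_of_natDegree_lt
      refine (natDegree_mul_le).trans_lt ?_
      rw [hRd, natDegree_X_pow]; omega
  rw [← dP, Matrix.det_mul, dV1, dC1, dV0]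
  have : ((Equiv.Perm.sign σ : ℤ) : ℝ) * ((Equiv.Perm.sign σ : ℤ) : ℝ) = 1 := by
    rw [← Int.cast_mul, ← Units.val_mul, Int.units_mul_self]; simp
  linear_combination (-(Matrix.of fun j k : Fin M => (X ^ (k : ℕ) * R : ℝ[X]).coeff (n + j - c j)).det * (Matrix.of fun i l : Fin n => x i ^ (l : ℕ)).det) * this

end

section

def eB (n : ℕ) : Fin 2 × Fin n ≃ Fin (2 * n) where
  toFun x := ⟨2 * x.2 + x.1, by omega⟩
  invFun k := (⟨k % 2, by omega⟩, ⟨k / 2, by omega⟩)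
  left_inv x := by ext <;> simp <;> omega
  right_inv k := by ext; simp; omega

lemma Dmat_eB {n : ℕ} (a : Fin n → ℝ) :
    (Dmat a).submatrix (eB n) (eB n) = Matrix.blockDiagonal fun i => !![0, a i; -a i, 0] := by
  ext ⟨r, i⟩ ⟨s, j⟩
  have hr := r.2
  have hs := s.2
  have e1 : (2 * (i : ℕ) + r) / 2 = i := by omega
  have e2 : (2 * (j : ℕ) + s) / 2 = j := by omega
  have e3 : (2 * (i : ℕ) + r) % 2 = r := by omega
  have e4 : (2 * (j : ℕ) + s) % 2 = s := by omega
  simp only [Matrix.submatrix_apply, Dmat, Matrix.of_apply, eB, Equiv.coe_fn_mk, e1, e2, e3, e4, Matrix.blockDiagonal_apply, Fin.eta, Fin.val_inj]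
  split_ifs with h1 h2 h3
  · fin_cases r <;> fin_cases s <;> simp_all
  · fin_cases r <;> fin_cases s <;> simp_all
  · fin_cases r <;> fin_cases s <;> simp_all
  · rfl

open Polynomial in
lemma Dmat_charpoly {n : ℕ} (a : Fin n → ℝ) : (Dmat a).charpoly = ∏ i, (X ^ 2 + C (a i ^ 2)) := by
  rw [← Matrix.charpoly_reindex (eB n).symm]
  rw [Matrix.reindex_apply, Equiv.symm_symm, Dmat_eB, Matrix.charpoly]
  have : (Matrix.blockDiagonal fun i => !![0, a i; -a i, 0]).charmatrix = Matrix.blockDiagonal fun i => (!![X, - C (a i); C (a i), X] : Matrix (Fin 2) (Fin 2) ℝ[X]) := by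
    ext1 ⟨r, i⟩ ⟨s, j⟩ 
    rw [Matrix.charmatrix_apply, Matrix.blockDiagonal_apply, Matrix.blockDiagonal_apply, Matrix.diagonal_apply]
    by_cases h : i = j
    · subst h
      fin_cases r <;> fin_cases s <;> simp
    · simp [h]
  rw [this, Matrix.det_blockDiagonal]
  refine Finset.prod_congr rfl fun i _ => ?_
  rw [Matrix.det_fin_two_of]; rw [C_pow]; ring

/-- Schur-like function. -/
def SS (n : ℕ) {M : ℕ} (c : Fin M → ℕ) (b : Fin n → ℝ) : ℝ :=
  (Matrix.of fun j k : Fin M => (Polynomial.X ^ (k : ℕ) * ∏ i, (Polynomial.X + Polynomial.C (b i)) : Polynomial ℝ).coeff (n + j - c j)).det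

open Polynomial in
lemma Sdet_Dmat (n M : ℕ) (c : Fin M → ℕ) (hcn : ∀ j, c j ≤ n) (a : Fin n → ℝ) :
    Sdet (fun j => 2 * n - 2 * c j + 2 * (j : ℕ)) (Dmat a).charpoly = SS n c (fun i => a i ^ 2) := by
  rw [Dmat_charpoly, Sdet, SS]
  congr 1
  ext j k
  rw [Matrix.of_apply, Matrix.of_apply]
  have : (X ^ (2 * (k:ℕ)) * ∏ i, (X ^ 2 + C (a i ^ 2)) : ℝ[X]) = expand ℝ 2 (X ^ (k : ℕ) * ∏ i, (X + C (a i ^ 2))) := by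
    simp [map_prod, expand_C, pow_mul]
  have h := hcn j
  rw [this, show 2 * n - 2 * c j + 2 * (j : ℕ) = (n + j - c j) * 2 by omega, coeff_expand_mul two_pos]

lemma vdm_eq {n : ℕ} (x : Fin n → ℝ) : vdm x = (Matrix.of fun i l : Fin n => x i ^ (l : ℕ)).det := by
  have := Matrix.det_vandermonde x
  rw [Matrix.vandermonde] at this
  rw [this, vdm, Finset.prod_sigma']
  refine Finset.prod_bij' (fun p _ => ⟨p.1, p.2⟩) (fun p _ => (p.1, p.2)) ?_ ?_ ?_ ?_ ?_ <;> simp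

lemma SS_alt (n M : ℕ) (c : Fin M → ℕ) (hc : Antitone c) (hcn : ∀ j, c j ≤ n) :
    ∃ ε : ℝ, ε * ε = 1 ∧ ∀ b : Fin n → ℝ, SS n c b * vdm b = ε * (Matrix.of fun i l : Fin n => b i ^ (qf n c l)).det := by
  obtain ⟨ε, h1, h2⟩ := altern n M c hc hcn
  have hs : ∀ (q : Fin n → ℕ) (b : Fin n → ℝ), (Matrix.of fun i l : Fin n => (-b i) ^ (q l)).det =
      (∏ l, (-1 : ℝ) ^ (q l)) * (Matrix.of fun i l : Fin n => b i ^ (q l)).det := by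
    intro q b
    rw [← Matrix.det_mul_row]
    congr 1
    ext i l
    simp only [Matrix.of_apply]
    rw [neg_pow]
  have hss : ∀ (q : Fin n → ℕ), (∏ l, (-1 : ℝ) ^ (q l)) * (∏ l, (-1 : ℝ) ^ (q l)) = 1 := by
    intro q
    rw [← Finset.prod_mul_distrib]
    apply Finset.prod_eq_one
    intro l _
    rw [← mul_pow]; simp
  refine ⟨ε * (∏ l : Fin n, (-1 : ℝ) ^ (l : ℕ)) * ∏ l : Fin n, (-1 : ℝ) ^ (qf n c l), ?_, fun b => ?_⟩
  · linear_combination h1 * ((∏ l : Fin n, (-1 : ℝ) ^ (l : ℕ)) * (∏ l : Fin n, (-1 : ℝ) ^ (l : ℕ)) * ((∏ l : Fin n, (-1 : ℝ) ^ (qf n c l)) * ∏ l : Fin n, (-1 : ℝ) ^ (qf n c l))) + hss (fun l => l) * ((∏ l : Fin n, (-1 : ℝ) ^ (qf n c l)) * ∏ l : Fin n, (-1 : ℝ) ^ (qf n c l)) + hss (fun l => qf n c l)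
  · have h3 := h2 (fun i => - b i)
    rw [hs (fun l => l), hs (fun l => qf n c l)] at h3
    simp only [Polynomial.C_neg, sub_neg_eq_add] at h3
    rw [vdm_eq]
    unfold SS
    linear_combination (∏ l : Fin n, (-1 : ℝ) ^ (l : ℕ)) * h3 - (Matrix.of fun j k : Fin M => (Polynomial.X ^ (k : ℕ) * ∏ i, (Polynomial.X + Polynomial.C (b i)) : Polynomial ℝ).coeff (n + j - c j)).det * (Matrix.of fun i l : Fin n => b i ^ (l : ℕ)).det * hss (fun l => l)

end

section

open Polynomial in
lemma coeff_cont (n : ℕ) (s : Finset (Fin n)) (m : ℕ) : Continuous fun b : Fin n → ℝ => (∏ i ∈ s, (X + C (b i)) : ℝ[X]).coeff m := by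
  induction s using Finset.induction_on generalizing m with
  | empty => simp [continuous_const]
  | insert i s hi ih =>
    simp_rw [Finset.prod_insert hi, add_mul, coeff_add, coeff_C_mul]
    refine Continuous.add ?_ ((continuous_apply i).mul (ih m))
    cases m with
    | zero => simp [continuous_const]
    | succ m => simpa [coeff_X_mul] using ih m

lemma SS_cont (n M : ℕ) (c : Fin M → ℕ) : Continuous (SS n c) := by
  unfold SS
  apply Continuous.matrix_det
  refine continuous_matrix fun j k => ?_
  simp only [Matrix.of_apply, Polynomial.coeff_X_pow_mul']
  split_ifs
  · exact coeff_cont n _ _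
  · exact continuous_const

lemma vdm_pow_lim (n : ℕ) (e : Fin n → ℕ) :
    Filter.Tendsto (fun x : ℝ => vdm (fun l => x ^ (e l)) / (x - 1) ^ (Finset.univ.filter (fun p : Fin n × Fin n => p.1 < p.2)).card)
      (nhdsWithin 1 {1}ᶜ) (nhds (vdm fun l => (e l : ℝ))) := by
  unfold vdm
  simp_rw [← Finset.prod_const, ← Finset.prod_div_distrib]
  refine tendsto_finset_prod _ fun p _ => ?_
  have h := ((hasDerivAt_pow (e p.2) (1:ℝ)).sub (hasDerivAt_pow (e p.1) (1:ℝ))).tendsto_slope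
  simp only [one_pow, mul_one] at h
  refine h.congr fun x => ?_
  rw [slope_def_field]; simp

lemma SS_full (n M : ℕ) (c : Fin M → ℕ) (hc : Antitone c) (hcn : ∀ j, c j ≤ n) :
    ∃ ε : ℝ, ε * ε = 1 ∧ (∀ b : Fin n → ℝ, SS n c b * vdm b = ε * (Matrix.of fun i l : Fin n => b i ^ (qf n c l)).det) ∧
      SS n c (fun _ => 1) * vdm (fun l : Fin n => ((l : ℕ) : ℝ)) = ε * vdm (fun l : Fin n => (qf n c l : ℝ)) := by
  obtain ⟨ε, h1, h2⟩ := SS_alt n M c hc hcn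
  refine ⟨ε, h1, h2, ?_⟩
  have key : ∀ x : ℝ, SS n c (fun i => x ^ (i : ℕ)) * vdm (fun i : Fin n => x ^ (i : ℕ)) = ε * vdm (fun l : Fin n => x ^ (qf n c l)) := by
    intro x
    rw [h2, vdm_eq (fun l : Fin n => x ^ (qf n c l)), ← Matrix.det_transpose]
    congr 2
    ext i l
    simp [← pow_mul, mul_comm]
  have t1 : Filter.Tendsto (fun x : ℝ => SS n c (fun i => x ^ (i : ℕ))) (nhdsWithin 1 {1}ᶜ) (nhds (SS n c (fun _ => 1))) := by
    have : Continuous (fun x : ℝ => SS n c (fun i => x ^ (i : ℕ))) := (SS_cont n M c).comp (by fun_prop)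
    have h := this.tendsto 1
    simp only [one_pow] at h
    exact h.mono_left nhdsWithin_le_nhds
  have t2 := t1.mul (vdm_pow_lim n (fun l => l))
  have t3 := (vdm_pow_lim n (fun l => qf n c l)).const_mul ε
  refine tendsto_nhds_unique t2 (t3.congr fun x => ?_)
  rw [← mul_div_assoc, ← mul_div_assoc, key]

end

section

lemma andre (n : ℕ) (m : Measure ℝ) [SigmaFinite m] (f g : Fin n → ℝ → ℝ) (h : ∀ l k, Integrable (fun t => f l t * g k t) m) :
    Integrable (fun a : Fin n → ℝ => (Matrix.of fun i l => f l (a i)).det * (Matrix.of fun i k => g k (a i)).det) (Measure.pi fun _ => m) ∧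
    ∫ a : Fin n → ℝ, (Matrix.of fun i l => f l (a i)).det * (Matrix.of fun i k => g k (a i)).det ∂(Measure.pi fun _ => m) =
      (n.factorial : ℝ) * (Matrix.of fun l k => ∫ t, f l t * g k t ∂m).det := by
  have e : ∀ a : Fin n → ℝ, (Matrix.of fun i l => f l (a i)).det * (Matrix.of fun i k => g k (a i)).det =
      ∑ σ : Equiv.Perm (Fin n), ∑ τ : Equiv.Perm (Fin n), (((Equiv.Perm.sign σ : ℤ) : ℝ) * ((Equiv.Perm.sign τ : ℤ) : ℝ)) * ∏ i, (f (σ i) (a i) * g (τ i) (a i)) := by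
    intro a
    rw [← Matrix.det_transpose, Matrix.det_apply', ← Matrix.det_transpose (Matrix.of fun i k => g k (a i)), Matrix.det_apply', Finset.sum_mul_sum]
    refine Finset.sum_congr rfl fun σ _ => Finset.sum_congr rfl fun τ _ => ?_
    simp only [Matrix.transpose_apply, Matrix.of_apply]
    rw [Finset.prod_mul_distrib]; ring
  have hi : ∀ σ τ : Equiv.Perm (Fin n), Integrable (fun a : Fin n → ℝ => (((Equiv.Perm.sign σ : ℤ) : ℝ) * ((Equiv.Perm.sign τ : ℤ) : ℝ)) * ∏ i, (f (σ i) (a i) * g (τ i) (a i))) (Measure.pi fun _ => m) := by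
    intro σ τ
    exact (Integrable.fintype_prod (f := fun i t => f (σ i) t * g (τ i) t) fun i => h (σ i) (τ i)).const_mul _
  simp_rw [e]
  refine ⟨integrable_finsetSum _ fun σ _ => integrable_finsetSum _ fun τ _ => hi σ τ, ?_⟩
  rw [integral_finsetSum _ fun σ _ => integrable_finsetSum _ fun τ _ => hi σ τ]
  have e2 : ∀ σ : Equiv.Perm (Fin n), ∫ a : Fin n → ℝ, ∑ τ : Equiv.Perm (Fin n), (((Equiv.Perm.sign σ : ℤ) : ℝ) * ((Equiv.Perm.sign τ : ℤ) : ℝ)) * ∏ i, (f (σ i) (a i) * g (τ i) (a i)) ∂(Measure.pi fun _ => m) =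
      (Matrix.of fun l k => ∫ t, f l t * g k t ∂m).det := by
    intro σ
    rw [integral_finsetSum _ fun τ _ => hi σ τ, ← Matrix.det_transpose, Matrix.det_apply', ← Equiv.sum_comp (Equiv.mulRight σ)]
    refine Finset.sum_congr rfl fun τ _ => ?_
    rw [integral_const_mul, integral_fintype_prod_eq_prod (𝕜 := ℝ) (f := fun i t => f (σ i) t * g ((Equiv.mulRight σ) τ i) t)]
    conv_rhs => rw [← Equiv.prod_comp σ]
    simp only [Equiv.coe_mulRight, Equiv.Perm.coe_mul, Function.comp_apply, Matrix.transpose_apply, Matrix.of_apply, Equiv.Perm.sign_mul]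
    congr 1
    push_cast
    have : ((Equiv.Perm.sign σ : ℤ) : ℝ) * ((Equiv.Perm.sign σ : ℤ) : ℝ) = 1 := by
      rw [← Int.cast_mul, ← Units.val_mul, Int.units_mul_self]; simp
    linear_combination ((Equiv.Perm.sign τ : ℤ) : ℝ) * this
  rw [Finset.sum_congr rfl fun σ _ => e2 σ]
  simp [Fintype.card_perm]

lemma Gamma_Ico (y : ℝ) (hy : 0 < y) (k m : ℕ) (h : k ≤ m) : Real.Gamma (y + m) = Real.Gamma (y + k) * ∏ i ∈ Finset.Ico k m, (y + i) := by
  induction m, h using Nat.le_induction with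
  | base => simp
  | succ m hm ih =>
    rw [Finset.prod_Ico_succ_top hm, ← mul_assoc, ← ih]
    push_cast
    rw [← add_assoc, Real.Gamma_add_one (by positivity)]; ring

open Polynomial in
lemma det_poly (n : ℕ) (β : ℝ) : ∃ s : ℝ, s * s = 1 ∧ ∀ q : Fin n → ℕ, ∀ r : ℝ,
    (Matrix.of fun l k : Fin n => ∏ i ∈ Finset.Ico (k:ℕ) (n - 1), (2 * (q l : ℝ) + r + (β + i))).det = s * 2 ^ (n * (n - 1) / 2) * vdm (fun l => (q l : ℝ)) := by
  refine ⟨((Equiv.Perm.sign (Fin.revPerm : Equiv.Perm (Fin n)) : ℤ) : ℝ), ?_, fun q r => ?_⟩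
  · rw [← Int.cast_mul, ← Units.val_mul, Int.units_mul_self]; simp
  have h := Matrix.det_eval_matrixOfPolynomials_eq_det_vandermonde (fun l => 2 * (q l : ℝ) + r)
    (fun k : Fin n => ∏ i ∈ Finset.Ico (n - 1 - (k : ℕ)) (n - 1), (X + C (β + i) : ℝ[X])) ?_ ?_
  · rw [Matrix.det_vandermonde_add] at h
    have h2 : (Matrix.vandermonde fun l => 2 * (q l : ℝ)).det = 2 ^ (n * (n - 1) / 2) * vdm (fun l => (q l : ℝ)) := by
      rw [vdm_eq, ← Finset.sum_range_id, ← Finset.prod_pow_eq_pow_sum, Finset.prod_range, ← Matrix.det_mul_row]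
      congr 1
      ext i l
      simp [mul_pow]
    rw [mul_assoc, ← h2, h, ← Matrix.det_permute']
    congr 1
    ext l k
    simp only [Matrix.of_apply, Matrix.submatrix_apply, id, eval_prod, eval_add, eval_X, eval_C, Fin.revPerm_apply, Fin.val_rev]
    rw [show n - 1 - (n - ((k:ℕ) + 1)) = k by omega]
  · intro k
    rw [natDegree_prod_of_monic _ _ fun i _ => monic_X_add_C _]
    simp only [natDegree_X_add_C]
    simp; omega
  · intro k
    exact monic_prod_of_monic _ _ fun i _ => monic_X_add_C _

lemma beta_int {x y : ℝ} (hx : 0 < x) (hy : 0 < y) :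
    Integrable (fun t => t ^ (x - 1) * (1 - t) ^ (y - 1)) (volume.restrict (Set.Ioo (0:ℝ) 1)) ∧
    ∫ t in Set.Ioo (0:ℝ) 1, t ^ (x - 1) * (1 - t) ^ (y - 1) = Real.Gamma x * Real.Gamma y / Real.Gamma (x + y) := by
  obtain ⟨h1, h2⟩ := betaPDF_int hx hy
  have hb := ProbabilityTheory.beta_pos hx hy
  have e : Set.EqOn (fun t => ProbabilityTheory.beta x y * ProbabilityTheory.betaPDFReal x y t) (fun t => t ^ (x - 1) * (1 - t) ^ (y - 1)) (Set.Ioo (0:ℝ) 1) := by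
    intro t ht
    have ht' : 0 < t ∧ t < 1 := ht
    simp only [ProbabilityTheory.betaPDFReal, if_pos ht']
    field_simp
  constructor
  · exact ((h1.const_mul (ProbabilityTheory.beta x y)).integrableOn (s := Set.Ioo 0 1)).congr_fun e measurableSet_Ioo
  · rw [← setIntegral_congr_fun measurableSet_Ioo e, integral_const_mul, setIntegral_eq_integral_of_forall_compl_eq_zero, h2, mul_one]
    · rfl
    · intro t ht
      simp only [ProbabilityTheory.betaPDFReal]
      exact if_neg ht

abbrev cube (n : ℕ) : Set (Fin n → ℝ) := {a | ∀ j, a j ∈ Set.Ioo (0:ℝ) 1}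

lemma cube_pi (n : ℕ) : (volume.restrict (cube n) : Measure (Fin n → ℝ)) = Measure.pi fun _ => volume.restrict (Set.Ioo (0:ℝ) 1) := by
  rw [← Measure.restrict_pi_pi, ← volume_pi]
  congr 1
  ext a; simp [cube]

lemma cube_meas (n : ℕ) : MeasurableSet (cube n) := by
  have : cube n = Set.pi Set.univ fun _ => Set.Ioo (0:ℝ) 1 := by ext a; simp [cube]
  rw [this]
  exact MeasurableSet.univ_pi fun _ => measurableSet_Ioo

lemma vdm_one_sub (n : ℕ) : ∃ s : ℝ, s * s = 1 ∧ ∀ a : Fin n → ℝ, vdm a = s * vdm (fun i => 1 - a i) := by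
  refine ⟨(-1) ^ (Finset.univ.filter (fun p : Fin n × Fin n => p.1 < p.2)).card, by rw [← mul_pow]; simp, fun a => ?_⟩
  unfold vdm
  rw [← Finset.prod_const, ← Finset.prod_mul_distrib]
  refine Finset.prod_congr rfl fun p _ => by ring

lemma MB_int (n : ℕ) (ν μ : ℝ) (hν : -(1/2) < ν) (hμ : -(1/2) < μ) : ∃ s : ℝ, s * s = 1 ∧ ∀ q : Fin n → ℕ,
    Integrable (fun a : Fin n → ℝ => (Matrix.of fun i l : Fin n => ((a i) ^ 2) ^ (q l)).det * vdm a * ∏ j, (a j) ^ (2 * ν) * (1 - a j) ^ (2 * μ + n + 1)) (volume.restrict (cube n)) ∧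
    ∫ a in cube n, (Matrix.of fun i l : Fin n => ((a i) ^ 2) ^ (q l)).det * vdm a * ∏ j, (a j) ^ (2 * ν) * (1 - a j) ^ (2 * μ + n + 1) =
      s * (n.factorial * (2 ^ (n * (n - 1) / 2) * ∏ k : Fin n, Real.Gamma (2 * μ + n + 2 + (k : ℕ)))) * (∏ l, hh ν (2 * μ + 2 * n + 1) (q l)) * vdm (fun l => (q l : ℝ)) := by
  obtain ⟨s1, hs1, h1⟩ := vdm_one_sub n
  obtain ⟨s2, hs2, h2⟩ := det_poly n (2 * μ + n + 2)
  have hn0 : (0:ℝ) ≤ n := Nat.cast_nonneg _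
  refine ⟨s1 * s2, by linear_combination s2 * s2 * hs1 + hs2, fun q => ?_⟩
  let f : Fin n → ℝ → ℝ := fun l t => (t ^ (2 * ν) * (1 - t) ^ (2 * μ + n + 1)) * (t ^ 2) ^ (q l)
  let g : Fin n → ℝ → ℝ := fun k t => (1 - t) ^ (k : ℕ)
  have e : ∀ a : Fin n → ℝ, (Matrix.of fun i l : Fin n => ((a i) ^ 2) ^ (q l)).det * vdm a * ∏ j, (a j) ^ (2 * ν) * (1 - a j) ^ (2 * μ + n + 1) =
      s1 * ((Matrix.of fun i l => f l (a i)).det * (Matrix.of fun i k => g k (a i)).det) := by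
    intro a
    have : (Matrix.of fun i l => f l (a i)).det = (∏ j, (a j) ^ (2 * ν) * (1 - a j) ^ (2 * μ + n + 1)) * (Matrix.of fun i l : Fin n => ((a i) ^ 2) ^ (q l)).det := by
      rw [← Matrix.det_mul_column]; rfl
    rw [this, h1, vdm_eq]
    ring
  have hx : ∀ l, 0 < 2 * (q l : ℝ) + 2 * ν + 1 := fun l => by
    have : (0:ℝ) ≤ q l := Nat.cast_nonneg _
    linarith
  have hy : ∀ k : Fin n, 0 < 2 * μ + n + 2 + ((k : ℕ) : ℝ) := fun k => by
    have : (0:ℝ) ≤ (k : ℕ) := Nat.cast_nonneg _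
    linarith
  have hfg : ∀ l (k : Fin n), Set.EqOn (fun t => t ^ ((2 * (q l : ℝ) + 2 * ν + 1) - 1) * (1 - t) ^ ((2 * μ + n + 2 + ((k : ℕ) : ℝ)) - 1)) (fun t => f l t * g k t) (Set.Ioo (0:ℝ) 1) := by
    intro l k t ht
    have ht0 : 0 < t := ht.1
    have ht1 : 0 < 1 - t := sub_pos.2 ht.2
    simp only [f, g]
    rw [show (2 * (q l : ℝ) + 2 * ν + 1) - 1 = 2 * ν + ((2 * q l : ℕ) : ℝ) by push_cast; ring,
      show (2 * μ + n + 2 + ((k : ℕ) : ℝ)) - 1 = 2 * μ + n + 1 + ((k : ℕ) : ℝ) by ring,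
      Real.rpow_add ht0, Real.rpow_add ht1, Real.rpow_natCast, Real.rpow_natCast, pow_mul]
    ring
  have hI : ∀ l k, Integrable (fun t => f l t * g k t) (volume.restrict (Set.Ioo (0:ℝ) 1)) := fun l k =>
    IntegrableOn.congr_fun (beta_int (hx l) (hy k)).1 (hfg l k) measurableSet_Ioo
  have hV : ∀ l k, ∫ t in Set.Ioo (0:ℝ) 1, f l t * g k t = hh ν (2 * μ + 2 * n + 1) (q l) * (Real.Gamma (2 * μ + n + 2 + (k : ℕ)) *
      ∏ i ∈ Finset.Ico (k:ℕ) (n - 1), (2 * (q l : ℝ) + (2 * ν + 1) + ((2 * μ + n + 2) + i))) := by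
    intro l k
    rw [← setIntegral_congr_fun measurableSet_Ioo (hfg l k), (beta_int (hx l) (hy k)).2, hh]
    have hk : (k : ℕ) ≤ n - 1 := by omega
    have hn1 : ((n - 1 : ℕ) : ℝ) = n - 1 := by rw [Nat.cast_sub (by omega)]; simp
    have hp : 0 < 2 * (q l : ℝ) + 2 * ν + 1 + (2 * μ + n + 2) := by have := hx l; linarith
    have G := Gamma_Ico _ hp k (n - 1) hk
    rw [hn1] at G
    have g1 : 0 < Real.Gamma (2 * (q l : ℝ) + 2 * ν + 1 + (2 * μ + n + 2) + (k : ℕ)) := Real.Gamma_pos_of_pos (by positivity)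
    have g2 : 0 < Real.Gamma (2 * (q l : ℝ) + 2 * ν + 1 + (2 * μ + n + 2) + (n - 1)) := by
      rw [← hn1]; exact Real.Gamma_pos_of_pos (by positivity)
    have r1 : 2 * (q l : ℝ) + 2 * ν + 1 + (2 * μ + 2 * n + 1) = 2 * (q l : ℝ) + 2 * ν + 1 + (2 * μ + n + 2) + (n - 1) := by ring
    have r2 : ∀ i : ℕ, 2 * (q l : ℝ) + (2 * ν + 1) + ((2 * μ + n + 2) + i) = 2 * (q l : ℝ) + 2 * ν + 1 + (2 * μ + n + 2) + i := fun i => by ring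
    simp_rw [r2]
    rw [r1, ← add_assoc, div_mul_eq_mul_div, div_eq_div_iff g1.ne' g2.ne', G]
    ring
  obtain ⟨a1, a2⟩ := andre n (volume.restrict (Set.Ioo (0:ℝ) 1)) f g hI
  simp_rw [e]
  rw [cube_pi]
  refine ⟨a1.const_mul _, ?_⟩
  rw [integral_const_mul, a2]
  simp_rw [hV]
  have : (Matrix.of fun l k : Fin n => hh ν (2 * μ + 2 * n + 1) (q l) * (Real.Gamma (2 * μ + n + 2 + (k : ℕ)) *
      ∏ i ∈ Finset.Ico (k:ℕ) (n - 1), (2 * (q l : ℝ) + (2 * ν + 1) + ((2 * μ + n + 2) + i)))).det =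
      (∏ l, hh ν (2 * μ + 2 * n + 1) (q l)) * ((∏ k : Fin n, Real.Gamma (2 * μ + n + 2 + (k : ℕ))) * (Matrix.of fun l k : Fin n =>
      ∏ i ∈ Finset.Ico (k:ℕ) (n - 1), (2 * (q l : ℝ) + (2 * ν + 1) + ((2 * μ + n + 2) + i))).det) := by
    rw [← Matrix.det_mul_row, ← Matrix.det_mul_column]; rfl
  rw [this, h2]
  ring

end

section

def kapJ (n : ℕ) (ν μ : ℝ) : ℝ := (1 / ((2 : ℝ) ^ (n * (n - 1) / 2) * (Nat.factorial n : ℝ))) *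
    (∏ j ∈ Finset.range n,
      Real.Gamma (2 * ν + 2 * μ + 2 * n + 2 * ((j : ℝ) + 1)) /
        (Real.Gamma ((j : ℝ) + 1) * Real.Gamma (2 * ν + 2 * ((j : ℝ) + 1) - 1) *
          Real.Gamma (2 * μ + 2 * n + 2 - ((j : ℝ) + 1))))

lemma kap_aux (n : ℕ) (ν μ : ℝ) (hν : -(1/2) < ν) (hμ : -(1/2) < μ) (j : ℕ) (hj : j ∈ Finset.range n) :
    0 < Real.Gamma (2 * ν + 2 * μ + 2 * n + 2 * ((j : ℝ) + 1)) ∧ 0 < Real.Gamma ((j : ℝ) + 1) ∧ 0 < Real.Gamma (2 * ν + 2 * ((j : ℝ) + 1) - 1) ∧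
          0 < Real.Gamma (2 * μ + 2 * n + 2 - ((j : ℝ) + 1)) := by
  have h1 : (j : ℝ) + 1 ≤ n := by exact_mod_cast Finset.mem_range.1 hj
  have h0 : (0 : ℝ) ≤ j := Nat.cast_nonneg _
  refine ⟨?_, ?_, ?_, ?_⟩ <;> apply Real.Gamma_pos_of_pos <;> linarith

lemma kapJ_pos (n : ℕ) (ν μ : ℝ) (hν : -(1/2) < ν) (hμ : -(1/2) < μ) : 0 < kapJ n ν μ := by
  unfold kapJ
  have : 0 < (∏ j ∈ Finset.range n,
      Real.Gamma (2 * ν + 2 * μ + 2 * n + 2 * ((j : ℝ) + 1)) /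
        (Real.Gamma ((j : ℝ) + 1) * Real.Gamma (2 * ν + 2 * ((j : ℝ) + 1) - 1) *
          Real.Gamma (2 * μ + 2 * n + 2 - ((j : ℝ) + 1)))) := by
    refine Finset.prod_pos fun j hj => ?_
    obtain ⟨h1, h2, h3, h4⟩ := kap_aux n ν μ hν hμ j hj
    positivity
  positivity

lemma vdm_id (n : ℕ) : vdm (fun l : Fin n => ((l : ℕ) : ℝ)) = ∏ j ∈ Finset.range n, Real.Gamma ((j : ℝ) + 1) := by
  have : ∀ j : ℕ, Real.Gamma ((j : ℝ) + 1) = (j.factorial : ℝ) := fun j => Real.Gamma_nat_eq_factorial j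
  simp_rw [this]
  cases n with
  | zero => simp [vdm]
  | succ n =>
    rw [vdm_eq, Finset.prod_range_succ']
    have h := Matrix.det_vandermonde_id_eq_superFactorial (R := ℝ) n
    simp only [Matrix.vandermonde] at h
    rw [h, ← Nat.prod_range_factorial_succ]; push_cast; simp [-Nat.prod_range_factorial_succ, Nat.factorial_succ]

lemma kap_norm (n : ℕ) (ν μ : ℝ) (hν : -(1/2) < ν) (hμ : -(1/2) < μ) :
    kapJ n ν μ * (n.factorial * (2 ^ (n * (n - 1) / 2) * ∏ k : Fin n, Real.Gamma (2 * μ + n + 2 + (k : ℕ)))) *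
      (∏ l : Fin n, hh ν (2 * μ + 2 * n + 1) (n - 1 - l)) * vdm (fun l : Fin n => ((l : ℕ) : ℝ)) = 1 := by
  rw [vdm_id, ← Finset.prod_range (fun k => Real.Gamma (2 * μ + n + 2 + (k : ℕ))), ← Finset.prod_range (fun l => hh ν (2 * μ + 2 * n + 1) (n - 1 - l)),
    Finset.prod_range_reflect (fun l => hh ν (2 * μ + 2 * n + 1) l), ← Finset.prod_range_reflect, kapJ]
  have : (∏ j ∈ Finset.range n,
      Real.Gamma (2 * ν + 2 * μ + 2 * n + 2 * ((j : ℝ) + 1)) /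
        (Real.Gamma ((j : ℝ) + 1) * Real.Gamma (2 * ν + 2 * ((j : ℝ) + 1) - 1) *
          Real.Gamma (2 * μ + 2 * n + 2 - ((j : ℝ) + 1)))) * (∏ j ∈ Finset.range n, Real.Gamma (2 * μ + n + 2 + (n - 1 - j : ℕ))) *
        (∏ j ∈ Finset.range n, hh ν (2 * μ + 2 * n + 1) j) * (∏ j ∈ Finset.range n, Real.Gamma ((j : ℝ) + 1)) = 1 := by
    rw [← Finset.prod_mul_distrib, ← Finset.prod_mul_distrib, ← Finset.prod_mul_distrib]
    refine Finset.prod_eq_one fun j hj => ?_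
    obtain ⟨h1, h2, h3, h4⟩ := kap_aux n ν μ hν hμ j hj
    have hj' := Finset.mem_range.1 hj
    have e1 : 2 * μ + n + 2 + ((n - 1 - j : ℕ) : ℝ) = 2 * μ + 2 * n + 2 - ((j : ℝ) + 1) := by
      rw [Nat.sub_sub, Nat.cast_sub (by omega)]; push_cast; ring
    have e2 : 2 * (j : ℝ) + 2 * ν + 1 = 2 * ν + 2 * ((j : ℝ) + 1) - 1 := by ring
    have e3 : 2 * ν + 2 * ((j : ℝ) + 1) - 1 + (2 * μ + 2 * n + 1) = 2 * ν + 2 * μ + 2 * n + 2 * ((j : ℝ) + 1) := by ring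
    rw [e1, hh, e2, e3]
    generalize Real.Gamma (2 * ν + 2 * μ + 2 * n + 2 * ((j : ℝ) + 1)) = A at *
    generalize Real.Gamma (2 * ν + 2 * ((j : ℝ) + 1) - 1) = B at *
    generalize Real.Gamma (2 * μ + 2 * n + 2 - ((j : ℝ) + 1)) = D at *
    field_simp
  have hf : (0:ℝ) < n.factorial := by exact_mod_cast Nat.factorial_pos n
  have h2 : (0:ℝ) < 2 ^ (n * (n - 1) / 2) := by positivity
  refine Eq.trans ?_ this
  generalize (∏ j ∈ Finset.range n,
      Real.Gamma (2 * ν + 2 * μ + 2 * n + 2 * ((j : ℝ) + 1)) /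
        (Real.Gamma ((j : ℝ) + 1) * Real.Gamma (2 * ν + 2 * ((j : ℝ) + 1) - 1) *
          Real.Gamma (2 * μ + 2 * n + 2 - ((j : ℝ) + 1)))) = A at *
  generalize (2:ℝ) ^ (n * (n - 1) / 2) = T at *
  generalize (n.factorial : ℝ) = F at *
  field_simp

lemma jacMB_nonneg (n : ℕ) (ν μ : ℝ) (hν : -(1/2) < ν) (hμ : -(1/2) < μ) (a : Fin n → ℝ) (ha : a ∈ cube n) : 0 ≤ jacMB n ν μ a := by
  show 0 ≤ kapJ n ν μ * (vdm fun j => (a j) ^ 2) * (vdm a) * ∏ j, (a j) ^ (2 * ν) * (1 - a j) ^ (2 * μ + n + 1)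
  rw [mul_assoc (kapJ n ν μ)]
  refine mul_nonneg (mul_nonneg (kapJ_pos n ν μ hν hμ).le ?_) ?_
  · unfold vdm
    rw [← Finset.prod_mul_distrib]
    refine Finset.prod_nonneg fun p _ => ?_
    have h1 := (ha p.1).1
    have h2 := (ha p.2).1
    have : (a p.2 ^ 2 - a p.1 ^ 2) * (a p.2 - a p.1) = (a p.2 - a p.1) ^ 2 * (a p.2 + a p.1) := by ring
    rw [this]; positivity
  · refine Finset.prod_nonneg fun j _ => ?_
    exact mul_nonneg (Real.rpow_nonneg (ha j).1.le _) (Real.rpow_nonneg (sub_nonneg.2 (ha j).2.le) _)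

lemma SS_MB (n : ℕ) (ν μ : ℝ) (hν : -(1/2) < ν) (hμ : -(1/2) < μ) :
    IntegrableOn (jacMB n ν μ) (cube n) ∧ ∫ a in cube n, jacMB n ν μ a = 1 ∧ 
    ∀ (M : ℕ) (c : Fin M → ℕ), Antitone c → (∀ j, c j ≤ n) →
      ∫ a in cube n, SS n c (fun i => a i ^ 2) * jacMB n ν μ a =
        (∏ l : Fin n, hh ν (2 * μ + 2 * n + 1) (qf n c l)) / (∏ l : Fin n, hh ν (2 * μ + 2 * n + 1) (n - 1 - l)) * SS n c (fun _ => 1) := by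
  obtain ⟨s, hs, hI⟩ := MB_int n ν μ hν hμ
  have main : ∀ (M : ℕ) (c : Fin M → ℕ), Antitone c → (∀ j, c j ≤ n) →
      IntegrableOn (fun a => SS n c (fun i => a i ^ 2) * jacMB n ν μ a) (cube n) ∧
      ∫ a in cube n, SS n c (fun i => a i ^ 2) * jacMB n ν μ a = 
       s * (kapJ n ν μ * (n.factorial * (2 ^ (n * (n - 1) / 2) * ∏ k : Fin n, Real.Gamma (2 * μ + n + 2 + (k : ℕ)))) * vdm (fun l : Fin n => ((l : ℕ) : ℝ))) *
        (∏ l : Fin n, hh ν (2 * μ + 2 * n + 1) (qf n c l)) * SS n c (fun _ => 1) := by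
    intro M c hc hcn
    obtain ⟨ε, h1, h2, h3⟩ := SS_full n M c hc hcn
    obtain ⟨i1, i2⟩ := hI (fun l => qf n c l)
    have e : ∀ a : Fin n → ℝ, SS n c (fun i => a i ^ 2) * jacMB n ν μ a = (kapJ n ν μ * ε) * ((Matrix.of fun i l : Fin n => ((a i) ^ 2) ^ (qf n c l)).det * vdm a * ∏ j, (a j) ^ (2 * ν) * (1 - a j) ^ (2 * μ + n + 1)) := by
      intro a
      have : jacMB n ν μ a = kapJ n ν μ * (vdm fun j => (a j) ^ 2) * (vdm a) * ∏ j, (a j) ^ (2 * ν) * (1 - a j) ^ (2 * μ + n + 1) := rfl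
      rw [this]
      linear_combination (kapJ n ν μ * (vdm a) * ∏ j, (a j) ^ (2 * ν) * (1 - a j) ^ (2 * μ + n + 1)) * h2 (fun i => a i ^ 2)
    simp_rw [e]
    refine ⟨i1.const_mul _, ?_⟩
    rw [integral_const_mul, i2]
    linear_combination (-s * (kapJ n ν μ * (n.factorial * (2 ^ (n * (n - 1) / 2) * ∏ k : Fin n, Real.Gamma (2 * μ + n + 2 + (k : ℕ))))) *
        (∏ l : Fin n, hh ν (2 * μ + 2 * n + 1) (qf n c l))) * h3
  obtain ⟨j1, j2⟩ := main 0 Fin.elim0 (fun i => i.elim0) (fun i => i.elim0)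
  have q0 : ∀ l, qf n (Fin.elim0 : Fin 0 → ℕ) l = n - 1 - l := by intro l; simp [qf]
  have S0 : ∀ b, SS n (Fin.elim0 : Fin 0 → ℕ) b = 1 := by intro b; simp [SS]
  simp only [S0, one_mul, mul_one, q0] at j1 j2
  have kn := kap_norm n ν μ hν hμ
  have hP : 0 < ∏ l : Fin n, hh ν (2 * μ + 2 * n + 1) (n - 1 - l) := Finset.prod_pos fun l _ => hh_pos _ _ hν (by have : (0:ℝ) ≤ n := Nat.cast_nonneg _; linarith) _
  have hs1 : ∫ a in cube n, jacMB n ν μ a = s := by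
    rw [j2]; linear_combination s * kn
  have hs0 : 0 ≤ s := by
    rw [← hs1]; exact setIntegral_nonneg (cube_meas n) fun a ha => jacMB_nonneg n ν μ hν hμ a ha
  have hs' : s = 1 := by nlinarith
  refine ⟨j1, hs1.trans hs', fun M c hc hcn => ?_⟩
  rw [(main M c hc hcn).2, hs', div_mul_eq_mul_div, eq_div_iff hP.ne']
  linear_combination (∏ l : Fin n, hh ν (2 * μ + 2 * n + 1) (qf n c l)) * SS n c (fun _ => 1) * kn

end

section

def ex {n : ℕ} (e : Fin n → ℝ) (i : ℤ) : ℝ :=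
  if i = 0 then 1 else if h : 1 ≤ i ∧ i ≤ n then e ⟨(i - 1).toNat, by omega⟩ else 0

lemma ex_cont {n : ℕ} (i : ℤ) : Continuous fun e : Fin n → ℝ => ex e i := by
  unfold ex
  split_ifs
  · exact continuous_const
  · exact continuous_apply _
  · exact continuous_const

lemma ex_out {n : ℕ} (e : Fin n → ℝ) (i : ℤ) (h : i < 0 ∨ (n : ℤ) < i) : ex e i = 0 := by
  unfold ex
  rw [if_neg (by omega), dif_neg (by omega)]

def JT {n M : ℕ} (c : Fin M → ℕ) (e : Fin n → ℝ) : ℝ :=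
  (Matrix.of fun j k : Fin M => ex e ((c j : ℤ) - j + k)).det

lemma perm_sq {M : ℕ} (c : Fin M → ℕ) (hc : Antitone c) (σ : Equiv.Perm (Fin M)) (hσ : σ ≠ 1) :
    ∑ j, (c j : ℤ) ^ 2 < ∑ j, ((c j : ℤ) - j + (σ j : ℕ)) ^ 2 := by
  have hanti : Antivary (fun j : Fin M => (c j : ℤ) - j) (fun j : Fin M => ((j : ℕ) : ℤ)) := by
    intro i j hij
    have h1 : (i : ℕ) < j := by have h' : ((i : ℕ) : ℤ) < ((j : ℕ) : ℤ) := hij; exact_mod_cast h'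
    have := hc (Fin.le_def.2 h1.le)
    show (c j : ℤ) - j ≤ (c i : ℤ) - i
    omega
  have h := (hanti.sum_mul_lt_sum_mul_comp_perm_iff (σ := σ)).2 ?_
  · have h2 : ∑ j, (((σ j : ℕ) : ℤ)) ^ 2 = ∑ j : Fin M, ((j : ℕ) : ℤ) ^ 2 := Equiv.sum_comp σ (fun j : Fin M => ((j : ℕ) : ℤ) ^ 2)
    have h3 : ∑ j, ((c j : ℤ) - j + (σ j : ℕ)) ^ 2 = ∑ j, ((c j : ℤ) - (j : ℕ)) ^ 2 + 2 * ∑ j, ((c j : ℤ) - (j : ℕ)) * (σ j : ℕ) + ∑ j, (((σ j : ℕ) : ℤ)) ^ 2 := by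
      rw [Finset.mul_sum, ← Finset.sum_add_distrib, ← Finset.sum_add_distrib]
      exact Finset.sum_congr rfl fun j _ => by ring
    have h4 : ∑ j, (c j : ℤ) ^ 2 = ∑ j, ((c j : ℤ) - (j : ℕ)) ^ 2 + 2 * ∑ j, ((c j : ℤ) - (j : ℕ)) * (j : ℕ) + ∑ j : Fin M, ((j : ℕ) : ℤ) ^ 2 := by
      rw [Finset.mul_sum, ← Finset.sum_add_distrib, ← Finset.sum_add_distrib]
      exact Finset.sum_congr rfl fun j _ => by ring
    simp only [smul_eq_mul] at h
    rw [h3, h4, h2]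
    linarith
  · intro hav
    apply hσ
    have hm : Monotone σ := by
      intro i j hij
      rcases hij.eq_or_lt with rfl | hij
      · exact le_rfl
      by_contra hlt
      have hlt' : σ j < σ i := not_le.1 hlt
      have h1 := hav (i := j) (j := i) (by simpa using hlt')
      have h2 := hc hij.le
      have h3 : (i : ℕ) < j := hij
      simp only at h1
      omega
    have hs : StrictMono σ := hm.strictMono_of_injective σ.injective
    have := Subsingleton.elim (hs.orderIsoOfSurjective σ σ.surjective) (OrderIso.refl (Fin M))
    ext j
    have h := congrArg (fun f : Fin M ≃o Fin M => (f j : ℕ)) this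
    simpa using h

lemma mom_eq (n : ℕ) {Q : Type*} [TopologicalSpace Q] [CompactSpace Q] [MeasurableSpace Q] [BorelSpace Q]
    (m1 m2 : Measure Q) [IsFiniteMeasure m1] [IsFiniteMeasure m2] (e : Q → Fin n → ℝ) (he : Continuous e)
    (H : ∀ (M : ℕ) (c : Fin M → ℕ), Antitone c → (∀ j, c j ≤ n) → ∫ x, JT c (e x) ∂m1 = ∫ x, JT c (e x) ∂m2) (M : ℕ) :
    ∀ (r : ℕ) (c : Fin M → ℕ), (∀ j, c j ≤ n) → (M * n ^ 2 ≤ r + ∑ j, c j ^ 2) → 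
      ∫ x, ∏ j, ex (e x) (c j) ∂m1 = ∫ x, ∏ j, ex (e x) (c j) ∂m2 := by
  have hint : ∀ (m : Measure Q) [IsFiniteMeasure m] (f : Q → ℝ), Continuous f → Integrable f m := fun m _ f hf =>
    hf.integrable_of_hasCompactSupport (HasCompactSupport.of_compactSpace f)
  intro r
  induction r using Nat.strong_induction_on with
  | _ r ih =>
  -- antitone case
  have anti : ∀ c : Fin M → ℕ, Antitone c → (∀ j, c j ≤ n) → (M * n ^ 2 ≤ r + ∑ j, c j ^ 2) → 
      ∫ x, ∏ j, ex (e x) (c j) ∂m1 = ∫ x, ∏ j, ex (e x) (c j) ∂m2 := by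
    intro c hc hcn hr
    let T : Equiv.Perm (Fin M) → Q → ℝ := fun σ x => ((Equiv.Perm.sign σ : ℤ) : ℝ) * ∏ j, ex (e x) ((c j : ℤ) - j + (σ j : ℕ))
    have hT : ∀ σ, Continuous (T σ) := fun σ => continuous_const.mul (continuous_finsetProd _ fun j _ => (ex_cont _).comp he)
    have hJ : ∀ x, JT c (e x) = (∏ j, ex (e x) (c j)) + ∑ σ ∈ Finset.univ.erase (1 : Equiv.Perm (Fin M)), T σ x := by
      intro x
      rw [JT, ← Matrix.det_transpose, Matrix.det_apply', ← Finset.add_sum_erase _ _ (Finset.mem_univ (1 : Equiv.Perm (Fin M)))]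
      congr 1
      simp
    have hs : ∀ σ ∈ Finset.univ.erase (1 : Equiv.Perm (Fin M)), ∫ x, T σ x ∂m1 = ∫ x, T σ x ∂m2 := by
      intro σ hσ
      have hσ1 := (Finset.mem_erase.1 hσ).1
      simp only [T]
      rw [integral_const_mul, integral_const_mul]
      congr 1
      by_cases hb : ∀ j, 0 ≤ (c j : ℤ) - j + (σ j : ℕ) ∧ (c j : ℤ) - j + (σ j : ℕ) ≤ n
      · have e1 : ∀ j, (c j : ℤ) - j + (σ j : ℕ) = (((c j : ℤ) - j + (σ j : ℕ)).toNat : ℤ) := fun j => (Int.toNat_of_nonneg (hb j).1).symm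
        have hlt := perm_sq c hc σ hσ1
        have hlt' : ∑ j, c j ^ 2 < ∑ j, ((c j : ℤ) - j + (σ j : ℕ)).toNat ^ 2 := by
          have : ((∑ j, c j ^ 2 : ℕ) : ℤ) < ((∑ j, ((c j : ℤ) - j + (σ j : ℕ)).toNat ^ 2 : ℕ) : ℤ) := by
            push_cast [← e1] 
            simpa [← e1] using hlt
          exact_mod_cast this
        have hle : ∑ j, ((c j : ℤ) - j + (σ j : ℕ)).toNat ^ 2 ≤ M * n ^ 2 := by
          calc _ ≤ ∑ j : Fin M, n ^ 2 := Finset.sum_le_sum fun j _ => Nat.pow_le_pow_left (by have := hb j; omega) 2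
            _ = _ := by simp
        have := ih (r - 1) (by omega) (fun j => ((c j : ℤ) - j + (σ j : ℕ)).toNat) (fun j => by have := hb j; omega) (by omega)
        simp only [← e1] at this
        exact this
      · push Not at hb
        obtain ⟨j, hj⟩ := hb
        have z : ∀ x, ∏ j, ex (e x) ((c j : ℤ) - j + (σ j : ℕ)) = 0 := fun x =>
          Finset.prod_eq_zero (Finset.mem_univ j) (ex_out _ _ (by by_cases h : 0 ≤ (c j : ℤ) - j + (σ j : ℕ); exact Or.inr (hj h); exact Or.inl (not_le.1 h)))
        simp [z]
    have h0 := H M c hc hcn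
    simp_rw [hJ] at h0
    have cP : Continuous fun x => ∏ j, ex (e x) (c j) := continuous_finsetProd _ fun j _ => (ex_cont _).comp he
    have cS : Continuous fun x => ∑ σ ∈ Finset.univ.erase (1 : Equiv.Perm (Fin M)), T σ x := continuous_finsetSum _ fun σ _ => hT σ
    rw [integral_add (hint _ _ cP) (hint _ _ cS), integral_add (hint _ _ cP) (hint _ _ cS), integral_finsetSum _ (fun σ _ => hint _ _ (hT σ)),
      integral_finsetSum _ (fun σ _ => hint _ _ (hT σ)), Finset.sum_congr rfl hs] at h0
    linarith
  intro c hcn hr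
  let s := Tuple.sort (fun j => OrderDual.toDual (c j))
  have hmono : Monotone ((fun j => OrderDual.toDual (c j)) ∘ s) := Tuple.monotone_sort _
  have := anti (fun j => c (s j)) (fun i j hij => hmono hij) (fun j => hcn _) (by rwa [Equiv.sum_comp s (fun j => c j ^ 2)])
  have e1 : ∀ x, ∏ j, ex (e x) (c (s j)) = ∏ j, ex (e x) (c j) := fun x => Equiv.prod_comp s (fun j => ex (e x) (c j))
  simpa only [e1] using this

end

section

lemma ex_coord {n : ℕ} (e : Fin n → ℝ) (i : Fin n) : ex e (((i : ℕ) + 1 : ℕ) : ℤ) = e i := by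
  unfold ex
  rw [if_neg (by omega), dif_pos (by omega)]
  congr 1
  ext
  simp

open BoundedContinuousFunction in
lemma meas_eq_cpt (n : ℕ) (B : ℝ) (m1 m2 : Measure (Fin n → Set.Icc (-B) B)) [IsFiniteMeasure m1] [IsFiniteMeasure m2]
    (H : ∀ (M : ℕ) (c : Fin M → ℕ), Antitone c → (∀ j, c j ≤ n) →
      ∫ x, JT c (fun i => (x i : ℝ)) ∂m1 = ∫ x, JT c (fun i => (x i : ℝ)) ∂m2) : m1 = m2 := by
  have he : Continuous fun (x : Fin n → Set.Icc (-B) B) (i : Fin n) => (x i : ℝ) := by fun_prop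
  have mom := mom_eq n m1 m2 _ he H
  let cf : Fin n → ((Fin n → Set.Icc (-B) B) →ᵇ ℝ) := fun i => mkOfCompact ⟨fun x => (x i : ℝ), by fun_prop⟩
  let A : StarSubalgebra ℝ ((Fin n → Set.Icc (-B) B) →ᵇ ℝ) := StarAlgebra.adjoin ℝ (Set.range cf)
  refine ext_of_forall_mem_subalgebra_integral_eq_of_polish (𝕜 := ℝ) (A := A) ?_ ?_
  · intro x y hxy
    obtain ⟨i, hi⟩ : ∃ i, x i ≠ y i := by by_contra h; push Not at h; exact hxy (funext h)
    refine ⟨_, ⟨_, ⟨cf i, StarAlgebra.subset_adjoin ℝ _ ⟨i, rfl⟩, rfl⟩, rfl⟩, ?_⟩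
    simpa [cf, Subtype.ext_iff] using hi
  · have hst : Set.range cf ∪ star (Set.range cf) = Set.range cf := by
      apply Set.union_eq_self_of_subset_right
      rintro g ⟨i, hi⟩
      refine ⟨i, ?_⟩
      rw [← star_star g, ← hi]
      ext x
      simp
    have hspan : ∀ g ∈ A, g ∈ Submodule.span ℝ (Submonoid.closure (Set.range cf) : Set ((Fin n → Set.Icc (-B) B) →ᵇ ℝ)) := by
      intro g hg
      have hg' : g ∈ (StarAlgebra.adjoin ℝ (Set.range cf)).toSubalgebra := hg
      rw [StarAlgebra.adjoin_toSubalgebra, hst] at hg'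
      rw [← Algebra.adjoin_eq_span]
      exact hg'
    intro g hg
    have hgs := hspan g hg
    clear hg
    induction hgs using Submodule.span_induction with
    | mem g hg =>
      obtain ⟨L, hL, rfl⟩ := Submonoid.exists_list_of_mem_closure hg
      have hL' : ∀ j : Fin L.length, ∃ i, cf i = L.get j := fun j => hL _ (List.get_mem L j)
      choose i hi using hL'
      have hp : ∀ x, (L.prod : (Fin n → Set.Icc (-B) B) →ᵇ ℝ) x = ∏ j : Fin L.length, ex (fun i => (x i : ℝ)) (((i j : ℕ) + 1 : ℕ) : ℤ) := by
        intro x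
        have e1 : L.prod = ∏ j : Fin L.length, cf (i j) := by
          rw [Finset.prod_congr rfl fun j _ => hi j]
          rw [← List.prod_ofFn, List.ofFn_get]
        rw [e1]
        have : (∏ j : Fin L.length, cf (i j)) x = ∏ j : Fin L.length, cf (i j) x := by
          exact map_prod (MonoidHom.mk (OneHom.mk (fun f : (Fin n → Set.Icc (-B) B) →ᵇ ℝ => f x) rfl) (fun _ _ => rfl)) _ _
        rw [this]
        refine Finset.prod_congr rfl fun j _ => ?_
        rw [ex_coord]; rfl
      simp_rw [hp]
      exact mom L.length (L.length * n ^ 2) (fun j => (i j : ℕ) + 1) (fun j => (i j).2) (by omega)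
    | zero => simp
    | add f g hf hg ihf ihg =>
      simp only [BoundedContinuousFunction.coe_add, Pi.add_apply]
      rw [integral_add (f.integrable m1) (g.integrable m1), integral_add (f.integrable m2) (g.integrable m2), ihf, ihg]
    | smul a f hf ih =>
      simp only [BoundedContinuousFunction.coe_smul, smul_eq_mul]
      rw [integral_const_mul, integral_const_mul, ih]

lemma meas_eq (n : ℕ) (B : ℝ) (hB : 0 ≤ B) (m1 m2 : Measure (Fin n → ℝ)) [IsFiniteMeasure m1] [IsFiniteMeasure m2]
    (h1 : ∀ᵐ e ∂m1, ∀ i, |e i| ≤ B) (h2 : ∀ᵐ e ∂m2, ∀ i, |e i| ≤ B)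
    (H : ∀ (M : ℕ) (c : Fin M → ℕ), Antitone c → (∀ j, c j ≤ n) → ∫ x, JT c x ∂m1 = ∫ x, JT c x ∂m2) : m1 = m2 := by
  have hBB : -B ≤ B := by linarith
  let cl : (Fin n → ℝ) → (Fin n → Set.Icc (-B) B) := fun e i => Set.projIcc (-B) B hBB (e i)
  let vl : (Fin n → Set.Icc (-B) B) → (Fin n → ℝ) := fun x i => x i
  have hcl : Continuous cl := continuous_pi fun i => continuous_projIcc.comp (continuous_apply i)
  have hvl : Continuous vl := by fun_prop
  have hid : ∀ e : Fin n → ℝ, (∀ i, |e i| ≤ B) → vl (cl e) = e := by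
    intro e he
    ext i
    show ((Set.projIcc (-B) B hBB (e i) : Set.Icc (-B) B) : ℝ) = e i
    rw [Set.projIcc_of_mem hBB (abs_le.1 (he i))]
  have hJ : ∀ (M : ℕ) (c : Fin M → ℕ), Continuous fun x : Fin n → ℝ => JT c x := by
    intro M c
    unfold JT
    exact Continuous.matrix_det (continuous_matrix fun j k => ex_cont _)
  have hm : m1.map cl = m2.map cl := by
    apply meas_eq_cpt
    intro M c hc hcn
    have : ∀ (m : Measure (Fin n → ℝ)), (∀ᵐ e ∂m, ∀ i, |e i| ≤ B) → ∫ x, JT c (vl x) ∂(m.map cl) = ∫ x, JT c x ∂m := by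
      intro m hm
      have ms : AEStronglyMeasurable (fun x => JT c (vl x)) (m.map cl) := ((hJ M c).comp hvl).aestronglyMeasurable
      rw [integral_map hcl.measurable.aemeasurable ms]
      refine integral_congr_ae ?_
      filter_upwards [hm] with e he
      rw [hid e he]
    exact (this m1 h1).trans ((H M c hc hcn).trans (this m2 h2).symm)
  have hr : ∀ (m : Measure (Fin n → ℝ)), (∀ᵐ e ∂m, ∀ i, |e i| ≤ B) → (m.map cl).map vl = m := by
    intro m hm
    rw [Measure.map_map hvl.measurable hcl.measurable]
    conv_rhs => rw [← Measure.map_id (μ := m)]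
    refine Measure.map_congr ?_
    filter_upwards [hm] with e he
    exact hid e he
  rw [← hr m1 h1, ← hr m2 h2, hm]

end

section

open Module in
lemma skew_nf : ∀ (n : ℕ) (E : Type) [NormedAddCommGroup E] [InnerProductSpace ℝ E] [FiniteDimensional ℝ E] (T : E →ₗ[ℝ] E),
    (∀ x y, inner ℝ (T x) y = - inner ℝ x (T y)) → finrank ℝ E = 2 * n →
    ∃ (B : Fin 2 × Fin n → E) (a : Fin n → ℝ), Orthonormal ℝ B ∧ (∀ i, 0 ≤ a i) ∧
      ∀ i, T (B (0, i)) = -(a i • B (1, i)) ∧ T (B (1, i)) = a i • B (0, i) := by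
  intro n
  induction n with
  | zero =>
    intro E _ _ _ T hT hE
    exact ⟨fun p => p.2.elim0, fun i => i.elim0, ⟨fun p => p.2.elim0, fun p => p.2.elim0⟩, fun i => i.elim0, fun i => i.elim0⟩
  | succ n ih =>
    intro E _ _ _ T hT hE
    by_cases hT0 : T = 0
    · have hc : Fintype.card (Fin 2 × Fin (n + 1)) = finrank ℝ E := by rw [hE]; simp
      let b := (stdOrthonormalBasis ℝ E).reindex (Fintype.equivOfCardEq (by rw [Fintype.card_fin, hc]) : Fin (finrank ℝ E) ≃ Fin 2 × Fin (n + 1))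
      refine ⟨b, 0, b.orthonormal, fun i => le_rfl, fun i => by simp [hT0]⟩
    · have hS : (T.comp T).IsSymmetric := by
        intro x y
        simp only [LinearMap.comp_apply]
        rw [hT, hT, neg_neg]
      let b := hS.eigenvectorBasis rfl
      obtain ⟨i, hi⟩ : ∃ i, T (b i) ≠ 0 := by
        by_contra h
        push Not at h
        apply hT0
        apply b.toBasis.ext
        intro i
        simpa using h i
      set u := b i with hu
      have hu1 : ‖u‖ = 1 := b.orthonormal.1 i
      have hTT : T (T u) = (hS.eigenvalues rfl i) • u := hS.apply_eigenvectorBasis rfl i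
      set e := hS.eigenvalues rfl i
      set l := ‖T u‖ with hl
      have hl0 : 0 < l := norm_pos_iff.2 hi
      have huu : inner ℝ u u = 1 := by rw [real_inner_self_eq_norm_sq, hu1]; norm_num
      have hle : e = -l ^ 2 := by
        have h1 : inner ℝ (T u) (T u) = l ^ 2 := real_inner_self_eq_norm_sq _
        rw [hT, hTT, inner_smul_right, huu] at h1
        linarith
      have huT : inner ℝ u (T u) = 0 := by
        have := hT u u
        rw [real_inner_comm] at this
        linarith
      set v := -(l⁻¹ • T u) with hv
      have hv1 : ‖v‖ = 1 := by rw [hv, norm_neg, norm_smul, norm_inv, Real.norm_of_nonneg hl0.le, ← hl]; field_simp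
      have hTu : T u = -(l • v) := by rw [hv, smul_neg, neg_neg, smul_smul, mul_inv_cancel₀ hl0.ne', one_smul]
      have hTv : T v = l • u := by
        rw [hv, map_neg, map_smul, hTT, hle, smul_smul, ← neg_smul]
        congr 1; field_simp
      have huv : inner ℝ u v = 0 := by rw [hv, inner_neg_right, inner_smul_right, huT]; simp
      have hvu : inner ℝ v u = 0 := by rw [real_inner_comm]; exact huv
      have hvv : inner ℝ v v = 1 := by rw [real_inner_self_eq_norm_sq, hv1]; norm_num
      have hon : Orthonormal ℝ ![u, v] := by
        rw [orthonormal_iff_ite]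
        intro i j
        fin_cases i <;> fin_cases j <;> simp [huu, hvv, huv, hvu, hu1, hv1]
      set K := Submodule.span ℝ (Set.range ![u, v]) with hK
      have hKf : finrank ℝ K = 2 := by
        rw [hK, finrank_span_eq_card hon.linearIndependent]; simp
      have hKo : finrank ℝ Kᗮ = 2 * n := by
        have := Submodule.finrank_add_finrank_orthogonal K
        rw [hKf, hE] at this; omega
      have huK : u ∈ K := Submodule.subset_span ⟨0, rfl⟩
      have hvK : v ∈ K := Submodule.subset_span ⟨1, rfl⟩
      have hwu : ∀ w ∈ Kᗮ, inner ℝ u w = 0 := fun w hw => (Submodule.mem_orthogonal K w).1 hw u huK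
      have hwv : ∀ w ∈ Kᗮ, inner ℝ v w = 0 := fun w hw => (Submodule.mem_orthogonal K w).1 hw v hvK
      have hinv : ∀ w ∈ Kᗮ, T w ∈ Kᗮ := by
        intro w hw
        rw [Submodule.mem_orthogonal]
        intro x hx
        rw [hK] at hx
        induction hx using Submodule.span_induction with
        | mem x hx =>
          obtain ⟨j, rfl⟩ := hx
          have hh : ∀ z, inner ℝ z (T w) = - inner ℝ (T z) w := fun z => by rw [hT, neg_neg]
          fin_cases j
          · simp [hh, hTu, inner_neg_left, inner_smul_left, hwv w hw]
          · simp [hh, hTv, inner_neg_left, inner_smul_left, hwu w hw]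
        | zero => simp
        | add x y _ _ h1 h2 => rw [inner_add_left, h1, h2, add_zero]
        | smul c x _ h => rw [inner_smul_left, h, mul_zero]
      obtain ⟨B, a, hB, ha, hBa⟩ := ih Kᗮ (T.restrict hinv) (fun x y => hT x y) hKo
      refine ⟨fun p => Fin.cases (if p.1 = 0 then u else v) (fun i => (B (p.1, i) : E)) p.2, Fin.cons l a, ?_, ?_, ?_⟩
      · rw [orthonormal_iff_ite] at hB ⊢
        have hB' : ∀ i j, inner ℝ ((B i : E)) (B j : E) = if i = j then (1:ℝ) else 0 := fun i j => by simpa using hB i j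
        have c1 : ∀ p, inner ℝ u (B p : E) = 0 := fun p => hwu _ (B p).2
        have c2 : ∀ p, inner ℝ v (B p : E) = 0 := fun p => hwv _ (B p).2
        have c3 : ∀ p, inner ℝ (B p : E) u = 0 := fun p => by rw [real_inner_comm]; exact c1 p
        have c4 : ∀ p, inner ℝ (B p : E) v = 0 := fun p => by rw [real_inner_comm]; exact c2 p
        rintro ⟨r, i⟩ ⟨s, j⟩
        refine Fin.cases ?_ (fun i => ?_) i <;> refine Fin.cases ?_ (fun j => ?_) j
        · fin_cases r <;> fin_cases s <;> simp [huu, hvv, huv, hvu, hu1, hv1]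
        · fin_cases r <;> simp [c1, c2, (Fin.succ_ne_zero _).symm]
        · fin_cases s <;> simp [c3, c4, (Fin.succ_ne_zero _)]
        · simp [hB', Prod.ext_iff]
      · intro i
        refine Fin.cases ?_ (fun i => ?_) i
        · exact hl0.le
        · exact ha i
      · intro i
        refine Fin.cases ?_ (fun i => ?_) i
        · exact ⟨by simpa using hTu, by simpa using hTv⟩
        · have h1 := congrArg Subtype.val (hBa i).1
          have h2 := congrArg Subtype.val (hBa i).2
          exact ⟨by simpa using h1, by simpa using h2⟩

lemma antisymm_nf (n : ℕ) (X : Matrix (Fin (2 * n)) (Fin (2 * n)) ℝ) (hX : Xᵀ = -X) :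
    ∃ k ∈ Matrix.orthogonalGroup (Fin (2 * n)) ℝ, ∃ a : Fin n → ℝ, (∀ i, 0 ≤ a i) ∧ Monotone a ∧ X = k * Dmat a * kᵀ := by
  obtain ⟨B, a, hB, ha, hBa⟩ := skew_nf n (EuclideanSpace ℝ (Fin (2 * n))) (Matrix.toEuclideanLin X) (by
    intro x y
    simp only [EuclideanSpace.inner_eq_star_dotProduct, Matrix.toEuclideanLin_apply, star_trivial]
    rw [Matrix.dotProduct_mulVec, ← Matrix.mulVec_transpose, hX, Matrix.neg_mulVec, neg_dotProduct]) (by simp)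
  let s := Tuple.sort a
  let k : Matrix (Fin (2 * n)) (Fin (2 * n)) ℝ := Matrix.of fun i j => B (((eB n).symm j).1, s ((eB n).symm j).2) i
  have hk : kᵀ * k = 1 := by
    ext i j
    rw [Matrix.mul_apply]
    have h := (orthonormal_iff_ite.1 hB) (((eB n).symm i).1, s ((eB n).symm i).2) (((eB n).symm j).1, s ((eB n).symm j).2)
    rw [EuclideanSpace.inner_eq_star_dotProduct] at h
    have h' : ∑ x, k x i * k x j = if (((eB n).symm i).1, s ((eB n).symm i).2) = (((eB n).symm j).1, s ((eB n).symm j).2) then (1:ℝ) else 0 := by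
      rw [← h]
      simp [dotProduct, k, mul_comm]
    simp only [Matrix.transpose_apply]
    rw [h', Matrix.one_apply]
    congr 1
    apply propext
    constructor
    · intro h2
      simp only [Prod.mk.injEq, EmbeddingLike.apply_eq_iff_eq] at h2
      exact (eB n).symm.injective (Prod.ext h2.1 h2.2)
    · rintro rfl; rfl
  have hk2 : k * kᵀ = 1 := mul_eq_one_comm.1 hk
  refine ⟨k, ?_, a ∘ s, fun i => ha _, Tuple.monotone_sort a, ?_⟩
  · rw [Matrix.mem_orthogonalGroup_iff]; exact hk2
  · have hXk : X * k = k * Dmat (a ∘ s) := by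
      ext i j
      obtain ⟨⟨r, l⟩, rfl⟩ := (eB n).surjective j
      have hD : ∀ p : Fin 2 × Fin n, Dmat (a ∘ s) (eB n p) (eB n (r, l)) = Matrix.blockDiagonal (fun i => !![0, (a ∘ s) i; -(a ∘ s) i, 0]) p (r, l) := by
        intro p
        rw [← Dmat_eB]; rfl
      rw [Matrix.mul_apply, Matrix.mul_apply, ← (eB n).sum_comp (fun x => k i x * _), Fintype.sum_prod_type]
      simp only [hD, Matrix.blockDiagonal_apply]
      have hL : ∑ x, X i x * k x (eB n (r, l)) = (Matrix.toEuclideanLin X (B (r, s l))) i := by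
        simp [Matrix.toEuclideanLin_apply, Matrix.mulVec, dotProduct, k]
      rw [hL]
      have hb := hBa (s l)
      fin_cases r
      · have := congrArg (fun w : EuclideanSpace ℝ (Fin (2 * n)) => w i) hb.1
        simp only at this
        simp [this, k]
        ring
      · have := congrArg (fun w : EuclideanSpace ℝ (Fin (2 * n)) => w i) hb.2
        simp only at this
        simp [this, k]
        ring
    rw [← hXk, Matrix.mul_assoc, hk2, Matrix.mul_one]

end

section

open Polynomial in
def cc (n : ℕ) (b : Fin n → ℝ) : Fin n → ℝ := fun i => (∏ i, (X + C (b i)) : ℝ[X]).coeff (n - ((i : ℕ) + 1))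

lemma cc_cont (n : ℕ) : Continuous (cc n) := continuous_pi fun i => coeff_cont n Finset.univ _

def cv (n : ℕ) (X : Matrix (Fin (2 * n)) (Fin (2 * n)) ℝ) : Fin n → ℝ :=
  fun i => X.charpoly.coeff (2 * n - 2 * ((i : ℕ) + 1))

lemma cpc_cont (N m : ℕ) : Continuous fun X : Matrix (Fin N) (Fin N) ℝ => X.charpoly.coeff m := by
  have : ∀ X : Matrix (Fin N) (Fin N) ℝ, X.charpoly.coeff m = MvPolynomial.eval (fun ij : Fin N × Fin N => X ij.1 ij.2) ((Matrix.charpoly.univ ℝ (Fin N)).coeff m) := by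
    intro X
    have h := Matrix.charpoly.univ_map_eval₂Hom (n := Fin N) (RingHom.id ℝ) (fun ij : Fin N × Fin N => X ij.1 ij.2)
    have h2 := congrArg (fun p => p.coeff m) h
    simp only [Polynomial.coeff_map] at h2
    exact h2.symm
  simp_rw [this]
  refine (MvPolynomial.continuous_eval _).comp ?_
  exact continuous_pi fun ij => continuous_id.matrix_elem ij.1 ij.2

lemma cv_cont (n : ℕ) : Continuous (cv n) := continuous_pi fun i => cpc_cont _ _

open Polynomial in
lemma cv_Dmat (n : ℕ) (a : Fin n → ℝ) : cv n (Dmat a) = cc n (fun i => a i ^ 2) := by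
  ext i
  rw [cv, Dmat_charpoly, cc]
  have : (∏ i, (X ^ 2 + C (a i ^ 2)) : ℝ[X]) = expand ℝ 2 (∏ i, (X + C (a i ^ 2))) := by
    simp [map_prod, expand_C]
  rw [this, show 2 * n - 2 * ((i : ℕ) + 1) = (n - ((i : ℕ) + 1)) * 2 by omega, coeff_expand_mul two_pos]

lemma cv_conj (n : ℕ) (k X : Matrix (Fin (2 * n)) (Fin (2 * n)) ℝ) (hk : k ∈ Matrix.orthogonalGroup (Fin (2 * n)) ℝ) :
    cv n (k * X * kᵀ) = cv n X := by
  unfold cv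
  rw [charpoly_conj_og X ⟨k, hk⟩]

open Polynomial in
lemma ex_cc (n : ℕ) (b : Fin n → ℝ) (i : ℕ) (hi : i ≤ n) : ex (cc n b) i = (∏ i, (X + C (b i)) : ℝ[X]).coeff (n - i) := by
  unfold ex
  by_cases h0 : i = 0
  · subst h0
    rw [if_pos (by simp)]
    have hm : (∏ i, (X + C (b i)) : ℝ[X]).Monic := monic_prod_of_monic _ _ fun i _ => monic_X_add_C _
    have hd : (∏ i, (X + C (b i)) : ℝ[X]).natDegree = n := by
      rw [natDegree_prod_of_monic _ _ fun i _ => monic_X_add_C _]; simp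
    have := hm.coeff_natDegree
    rw [hd] at this
    simpa using this.symm
  · rw [if_neg (by omega), dif_pos (by omega)]
    unfold cc
    congr 1
    simp only
    omega

open Polynomial in
lemma SS_JT (n M : ℕ) (c : Fin M → ℕ) (hcn : ∀ j, c j ≤ n) (b : Fin n → ℝ) : SS n c b = JT c (cc n b) := by
  unfold SS JT
  congr 1
  ext j k
  simp only [Matrix.of_apply]
  have hj := hcn j
  rw [coeff_X_pow_mul']
  have hd : (∏ i, (X + C (b i)) : ℝ[X]).natDegree = n := by
    rw [natDegree_prod_of_monic _ _ fun i _ => monic_X_add_C _]; simp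
  split_ifs with h
  · by_cases h2 : (j : ℕ) ≤ c j + k
    · have := ex_cc n b (c j + k - j) (by omega)
      rw [show (c j : ℤ) - j + k = ((c j + k - j : ℕ) : ℤ) by omega, this]
      congr 1
      omega
    · rw [ex_out _ _ (by omega), coeff_eq_zero_of_natDegree_lt (by omega)]
  · rw [ex_out _ _ (by omega)]

lemma Sdet_JT (n M : ℕ) (c : Fin M → ℕ) (hcn : ∀ j, c j ≤ n) (X : Matrix (Fin (2 * n)) (Fin (2 * n)) ℝ) (hX : Xᵀ = -X) :
    Sdet (fun j => 2 * n - 2 * c j + 2 * (j : ℕ)) X.charpoly = JT c (cv n X) := by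
  obtain ⟨k, hk, a, -, -, rfl⟩ := antisymm_nf n X hX
  rw [cv_conj _ _ _ hk, charpoly_conj_og (Dmat a) ⟨k, hk⟩, Sdet_Dmat n M c hcn, SS_JT n M c hcn, cv_Dmat]

lemma Dmat_anti (n : ℕ) (a : Fin n → ℝ) : (Dmat a)ᵀ = - Dmat a := by
  ext i j
  have : ∀ i j : Fin (2*n), i.val / 2 = j.val / 2 → (⟨i.val / 2, by have := i.isLt; omega⟩ : Fin n) = ⟨j.val / 2, by have := j.isLt; omega⟩ := by
    intro i j h; simp [h]
  rw [Matrix.transpose_apply, Matrix.neg_apply]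
  simp only [Dmat, of_apply]
  by_cases h : i.val / 2 = j.val / 2
  · rw [if_pos h, if_pos h.symm, this i j h]
    have h1 : i.val % 2 = 0 ∨ i.val % 2 = 1 := by omega
    have h2 : j.val % 2 = 0 ∨ j.val % 2 = 1 := by omega
    rcases h1 with h1 | h1 <;> rcases h2 with h2 | h2 <;> simp [h1, h2]
  · rw [if_neg h, if_neg (fun h' => h h'.symm)]; simp

lemma conj_anti {N : ℕ} (u Y : Matrix (Fin N) (Fin N) ℝ) (hY : Yᵀ = -Y) : (u * Y * uᵀ)ᵀ = -(u * Y * uᵀ) := by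
  rw [transpose_mul, transpose_mul, transpose_transpose, hY, Matrix.neg_mul, Matrix.mul_neg, Matrix.mul_assoc]

/-- the random matrix -/
def gDg (n : ℕ) (u : FM (2 * n)) : Matrix (Fin (2 * n)) (Fin (2 * n)) ℝ := Matrix.of u * Dmat (fun _ : Fin n => (1:ℝ)) * (Matrix.of u)ᵀ

lemma gDg_cont (n : ℕ) : Continuous (gDg n) := by
  have hofc : Continuous fun u : FM (2 * n) => (Matrix.of u : Matrix (Fin (2 * n)) (Fin (2 * n)) ℝ) := continuous_id
  exact (hofc.matrix_mul continuous_const).matrix_mul hofc.matrix_transpose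

lemma gDg_anti (n : ℕ) (u : FM (2 * n)) : (gDg n u)ᵀ = - gDg n u := conj_anti _ _ (Dmat_anti n _)

/-- Muttalib-Borodin measure -/
def mb (n : ℕ) (ν μ : ℝ) : Measure (Fin n → ℝ) :=
  (volume.restrict (cube n)).withDensity fun a => ENNReal.ofReal (jacMB n ν μ a)

lemma exists_bd {n : ℕ} {α : Type} [TopologicalSpace α] (K : Set α) (hK : IsCompact K) (f : α → Fin n → ℝ) (hf : Continuous f) :
    ∃ B, ∀ x ∈ K, ∀ i, |f x i| ≤ B := by
  obtain ⟨B, hB⟩ := hK.exists_bound_of_continuousOn hf.continuousOn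
  exact ⟨B, fun x hx i => (norm_le_pi_norm (f x) i).trans (hB x hx)⟩

lemma sq_cont (n : ℕ) : Continuous fun a : Fin n → ℝ => cc n (fun i => a i ^ 2) :=
  (cc_cont n).comp (continuous_pi fun i => (continuous_apply i).pow 2)

end

section

lemma mb_int (n : ℕ) (ν μ : ℝ) (hν : -(1 / 2 : ℝ) < ν) (hμ : -(1 / 2 : ℝ) < μ) (g : (Fin n → ℝ) → ℝ) :
    ∫ a, g a ∂(mb n ν μ) = ∫ a in cube n, g a * jacMB n ν μ a := by
  have hI := (SS_MB n ν μ hν hμ).1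
  unfold mb
  rw [integral_withDensity_eq_integral_toReal_smul₀ hI.aestronglyMeasurable.aemeasurable.ennreal_ofReal (by simp)]
  refine setIntegral_congr_fun (cube_meas n) fun a ha => ?_
  simp only [smul_eq_mul]
  rw [ENNReal.toReal_ofReal (jacMB_nonneg n ν μ hν hμ a ha), mul_comm]

lemma mb_fin (n : ℕ) (ν μ : ℝ) (hν : -(1 / 2 : ℝ) < ν) (hμ : -(1 / 2 : ℝ) < μ) : IsFiniteMeasure (mb n ν μ) := by
  have hI := (SS_MB n ν μ hν hμ).1
  exact isFiniteMeasure_withDensity_ofReal hI.2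

lemma key_eq (n : ℕ) (ν μ : ℝ) (hν : -(1 / 2 : ℝ) < ν) (hμ : -(1 / 2 : ℝ) < μ) :
    (jm (2 * n) ν μ).map (fun u => cv n (gDg n u)) = (jm (2 * n) ν μ Set.univ) • (mb n ν μ).map (fun a => cc n (fun i => a i ^ 2)) := by
  obtain ⟨hfin, hpos, heig⟩ := jm_eig (2 * n) ν μ hν hμ
  have := mb_fin n ν μ hν hμ
  have hc1 : Continuous fun u => cv n (gDg n u) := (cv_cont n).comp (gDg_cont n)
  have hc2 := sq_cont n
  have hf2 : IsFiniteMeasure ((jm (2 * n) ν μ Set.univ) • (mb n ν μ).map (fun a => cc n (fun i => a i ^ 2))) :=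
    Measure.smul_finite _ (measure_ne_top _ _)
  obtain ⟨B1, hB1⟩ := exists_bd (Set.univ.pi fun _ : Fin (2 * n) => Set.univ.pi fun _ : Fin (2 * n) => Set.Icc (-1:ℝ) 1)
    (isCompact_univ_pi fun _ => isCompact_univ_pi fun _ => isCompact_Icc) _ hc1
  obtain ⟨B2, hB2⟩ := exists_bd (Set.univ.pi fun _ : Fin n => Set.Icc (0:ℝ) 1)
    (isCompact_univ_pi fun _ => isCompact_Icc) _ hc2
  have hcl : MeasurableSet {e : Fin n → ℝ | ∀ i, |e i| ≤ max 0 (max B1 B2)} := by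
    simp only [Set.setOf_forall]
    exact MeasurableSet.iInter fun i => measurableSet_le (measurable_pi_apply i).abs measurable_const
  refine meas_eq n (max 0 (max B1 B2)) (le_max_left _ _) _ _ ?_ ?_ ?_
  · rw [ae_map_iff hc1.measurable.aemeasurable hcl]
    filter_upwards [jm_bdd (2 * n) ν μ] with u hu i
    refine (hB1 u ?_ i).trans (by simp)
    intro i _ j _
    exact abs_le.1 (hu i j)
  · refine Measure.ae_smul_measure ?_ _
    rw [ae_map_iff hc2.measurable.aemeasurable hcl]
    refine (withDensity_absolutelyContinuous _ _).ae_le ?_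
    filter_upwards [ae_restrict_mem (cube_meas n)] with a ha i
    refine (hB2 a ?_ i).trans (by simp)
    intro i _
    exact ⟨(ha i).1.le, (ha i).2.le⟩
  · intro M c hc hcn
    have hJ : Continuous fun x : Fin n → ℝ => JT c x := by
      unfold JT
      exact Continuous.matrix_det (continuous_matrix fun j k => ex_cont _)
    rw [integral_smul_measure, integral_map hc1.measurable.aemeasurable hJ.aestronglyMeasurable,
      integral_map hc2.measurable.aemeasurable hJ.aestronglyMeasurable, mb_int n ν μ hν hμ]
    simp_rw [← SS_JT n M c hcn]
    rw [(SS_MB n ν μ hν hμ).2.2 M c hc hcn]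
    have e1 : ∀ u, JT c (cv n (gDg n u)) = Sdet (fun j => 2 * n - 2 * c j + 2 * (j : ℕ)) (gDg n u).charpoly :=
      fun u => (Sdet_JT n M c hcn _ (gDg_anti n u)).symm
    simp_rw [e1]
    have := heig M (fun j => 2 * c j) (fun i j h => by have := hc h; simp only; omega) (fun j => by have := hcn j; omega)
      (Dmat fun _ : Fin n => (1:ℝ)) (Dmat_anti n _)
    unfold gDg
    rw [this, GG_ratio n ν μ hν hμ M c, Sdet_Dmat n M c hcn]
    simp only [one_pow, smul_eq_mul, Measure.real, mul_assoc]

open Polynomial in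
lemma cc_inj (n : ℕ) (a b : Fin n → ℝ) (ha0 : ∀ i, 0 ≤ a i) (ha : Monotone a) (hb0 : ∀ i, 0 ≤ b i) (hb : Monotone b)
    (h : cc n (fun i => a i ^ 2) = cc n (fun i => b i ^ 2)) : a = b := by
  have hd : ∀ b : Fin n → ℝ, (∏ i, (X + C (b i)) : ℝ[X]).natDegree = n := fun b => by
    rw [natDegree_prod_of_monic _ _ fun i _ => monic_X_add_C _]; simp
  have hp : (∏ i, (X + C (a i ^ 2)) : ℝ[X]) = ∏ i, (X + C (b i ^ 2)) := by
    ext m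
    by_cases hm : m ≤ n
    · have h1 := ex_cc n (fun i => a i ^ 2) (n - m) (by omega)
      have h2 := ex_cc n (fun i => b i ^ 2) (n - m) (by omega)
      rw [show n - (n - m) = m by omega] at h1 h2
      rw [← h1, ← h2, h]
    · rw [coeff_eq_zero_of_natDegree_lt (by rw [hd fun i => a i ^ 2]; omega), coeff_eq_zero_of_natDegree_lt (by rw [hd fun i => b i ^ 2]; omega)]
  have hr : ∀ b : Fin n → ℝ, (∀ i, 0 ≤ b i) → ((∏ i, (X + C (b i ^ 2)) : ℝ[X]).roots.map fun x => Real.sqrt (-x)) = (Finset.univ.val.map b) := by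
    intro b hb
    have : (∏ i, (X + C (b i ^ 2)) : ℝ[X]) = ((Finset.univ.val.map fun i => -(b i ^ 2)).map fun x => X - C x).prod := by
      rw [Multiset.map_map]
      show (Finset.univ.val.map _).prod = _
      congr 1
      refine Multiset.map_congr rfl fun i _ => ?_
      simp
    rw [this, roots_multiset_prod_X_sub_C, Multiset.map_map]
    refine Multiset.map_congr rfl fun i _ => ?_
    simp [Real.sqrt_sq (hb i)]
  have hab := hr a ha0
  rw [hp, hr b hb0, Fin.univ_val_map, Fin.univ_val_map, Multiset.coe_eq_coe] at hab
  have := hab.eq_of_sortedLE hb.sortedLE_ofFn ha.sortedLE_ofFn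
  exact (List.ofFn_injective this).symm

lemma phi_factor (n : ℕ) (φ : Matrix (Fin (2 * n)) (Fin (2 * n)) ℝ → ℝ) (hφ : IsInvTest (2 * n) φ) :
    ∃ ψ : (Fin n → ℝ) → ℝ, Measurable ψ ∧ ∀ X : Matrix (Fin (2 * n)) (Fin (2 * n)) ℝ, Xᵀ = -X → φ X = ψ (cv n X) := by
  let A : Set (Fin n → ℝ) := {a | (∀ i, 0 ≤ a i) ∧ Monotone a}
  have hA : IsClosed A := by
    have : A = (⋂ i, {a | 0 ≤ a i}) ∩ ⋂ i, ⋂ j, ⋂ (_ : i ≤ j), {a | a i ≤ a j} := by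
      ext a
      simp [A, Monotone]
    rw [this]
    refine (isClosed_iInter fun i => isClosed_le continuous_const (continuous_apply i)).inter ?_
    exact isClosed_iInter fun i => isClosed_iInter fun j => isClosed_iInter fun _ => isClosed_le (continuous_apply i) (continuous_apply j)
  have hpol : PolishSpace A := hA.polishSpace
  let f : A → (Fin n → ℝ) := fun a => cc n (fun i => a.1 i ^ 2)
  have hf : Continuous f := (sq_cont n).comp continuous_subtype_val
  have hinj : Function.Injective f := fun a b h => Subtype.ext (cc_inj n _ _ a.2.1 a.2.2 b.2.1 b.2.2 h)
  have hme : MeasurableEmbedding f := hf.measurableEmbedding hinj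
  have hD : Continuous fun a : Fin n → ℝ => Dmat a := by
    refine continuous_matrix fun i j => ?_
    simp only [Dmat, Matrix.of_apply]
    split_ifs <;> fun_prop
  obtain ⟨ψ, hψ, h2⟩ := hme.exists_measurable_extend (g := fun a : A => φ (Dmat a.1))
    (hφ.1.comp (hD.measurable.comp measurable_subtype_coe)) (fun _ => ⟨0⟩)
  refine ⟨ψ, hψ, fun X hX => ?_⟩
  obtain ⟨k, hk, a, ha0, ha, rfl⟩ := antisymm_nf n X hX
  rw [cv_conj _ _ _ hk, cv_Dmat, hφ.2.2 _ (Dmat_anti n a) k hk]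
  exact (congrFun h2 ⟨a, ha0, ha⟩).symm

end

section

lemma jm_dens (n : ℕ) (ν μ : ℝ) (u : FM (2 * n)) : JF (Fin.elim0 : Fin 0 → ℕ) ν μ (grm u) = (jacDom n).indicator (fun u => ENNReal.ofReal (jacDens n ν μ u)) u := by
  unfold JF WE
  have hu : (1 - grm u).PosDef ↔ u ∈ jacDom n := Iff.rfl
  by_cases h : u ∈ jacDom n
  · rw [Set.indicator_of_mem h, if_pos (hu.2 h)]
    rw [← ENNReal.ofReal_mul (by simpa using Real.rpow_nonneg (grm_det_nonneg u) ν)]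
    simp [jacDens, grm]
  · rw [Set.indicator_of_notMem h, if_neg (fun h' => h (hu.1 h')), mul_zero]

lemma jacDom_meas (n : ℕ) : MeasurableSet (jacDom n) := by
  have hm := WE_meas (0 : ℝ) (fun u : FM (2 * n) => 1 - grm u) (continuous_const.sub grm_cont)
  have : jacDom n = {u : FM (2 * n) | WE (0:ℝ) (1 - grm u) = 1} := by
    ext u
    have hu : (1 - grm u).PosDef ↔ u ∈ jacDom n := Iff.rfl
    simp only [Set.mem_setOf_eq, WE, Real.rpow_zero, ENNReal.ofReal_one]
    rw [← hu]
    split_ifs with h <;> simp [h]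
  rw [this]
  exact hm (measurableSet_singleton 1)

lemma jacDens_meas (n : ℕ) (ν μ : ℝ) : Measurable (jacDens n ν μ) := by
  have h1 : Continuous fun u : FM (2 * n) => (grm u).det := grm_cont.matrix_det
  have h2 : Continuous fun u : FM (2 * n) => (1 - grm u).det := (continuous_const.sub grm_cont).matrix_det
  exact (h1.measurable.pow_const ν).mul (h2.measurable.pow_const μ)

lemma jacDens_nonneg (n : ℕ) (ν μ : ℝ) (u : FM (2 * n)) (hu : u ∈ jacDom n) : 0 ≤ jacDens n ν μ u := by
  have hu : (1 - grm u).PosDef := hu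
  exact mul_nonneg (Real.rpow_nonneg (grm_det_nonneg u) ν) (Real.rpow_nonneg hu.det_pos.le μ)

lemma jm_eq (n : ℕ) (ν μ : ℝ) : jm (2 * n) ν μ = (volume.restrict (jacDom n)).withDensity fun u => ENNReal.ofReal (jacDens n ν μ u) := by
  unfold jm
  simp_rw [jm_dens]
  exact withDensity_indicator (jacDom_meas n) _

lemma jm_int (n : ℕ) (ν μ : ℝ) (g : FM (2 * n) → ℝ) :
    ∫ u, g u ∂(jm (2 * n) ν μ) = ∫ u in jacDom n, g u * jacDens n ν μ u := by
  rw [jm_eq, integral_withDensity_eq_integral_toReal_smul (jacDens_meas n ν μ).ennreal_ofReal (by simp)]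
  refine setIntegral_congr_fun (jacDom_meas n) fun u hu => ?_
  simp only [smul_eq_mul]
  rw [ENNReal.toReal_ofReal (jacDens_nonneg n ν μ u hu), mul_comm]

lemma jacDens_int (n : ℕ) (ν μ : ℝ) (h : IsFiniteMeasure (jm (2 * n) ν μ)) : IntegrableOn (jacDens n ν μ) (jacDom n) := by
  refine ⟨(jacDens_meas n ν μ).aestronglyMeasurable, ?_⟩
  rw [hasFiniteIntegral_iff_ofReal]
  · have := measure_lt_top (jm (2 * n) ν μ) Set.univ
    rwa [jm_eq, withDensity_apply _ MeasurableSet.univ, Measure.restrict_univ] at this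
  · filter_upwards [ae_restrict_mem (jacDom_meas n)] with u hu
    exact jacDens_nonneg n ν μ u hu

end

/-- Corollary 4.3: the singular values of `g D(1) gᵀ` for `g` from the
induced real Jacobi ensemble form the Jacobi Muttalib–Borodin ensemble with `θ = 2`. -/
theorem jacobi_times_identity (n : ℕ) (hn : 1 ≤ n)
    (ν μ : ℝ) (hν : -(1 / 2 : ℝ) < ν) (hμ : -(1 / 2 : ℝ) < μ) :
    IntegrableOn (jacDens n ν μ) (jacDom n) ∧
    0 < (∫ u in jacDom n, jacDens n ν μ u) ∧
    (∀ φ : Matrix (Fin (2 * n)) (Fin (2 * n)) ℝ → ℝ, IsInvTest (2 * n) φ →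
      (1 / (∫ u in jacDom n, jacDens n ν μ u)) *
          (∫ u in jacDom n,
            φ (Matrix.of u * Dmat (fun _ => 1) * (Matrix.of u)ᵀ) * jacDens n ν μ u) =
        ∫ a in {a : Fin n → ℝ | ∀ j, a j ∈ Set.Ioo (0 : ℝ) 1},
          φ (Dmat a) * jacMB n ν μ a) ∧
    (∀ a : Fin n → ℝ, (∀ j, a j ∈ Set.Ioo (0 : ℝ) 1) → 0 ≤ jacMB n ν μ a) ∧
    (∫ a in {a : Fin n → ℝ | ∀ j, a j ∈ Set.Ioo (0 : ℝ) 1}, jacMB n ν μ a) = 1 := by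
  obtain ⟨hfin, hpos, -⟩ := jm_eig (2 * n) ν μ hν hμ
  have hZ : (jm (2 * n) ν μ).real Set.univ = ∫ u in jacDom n, jacDens n ν μ u := by
    have := jm_int n ν μ (fun _ => 1)
    simpa using this
  refine ⟨jacDens_int n ν μ hfin, hZ ▸ hpos, ?_, fun a ha => jacMB_nonneg n ν μ hν hμ a ha, (SS_MB n ν μ hν hμ).2.1⟩
  intro φ hφ
  obtain ⟨ψ, hψ, hψφ⟩ := phi_factor n φ hφ
  have hc1 : Continuous fun u => cv n (gDg n u) := (cv_cont n).comp (gDg_cont n)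
  have hc2 := sq_cont n
  have h1 := jm_int n ν μ (fun u => φ (gDg n u))
  have h2 := mb_int n ν μ hν hμ (fun a => φ (Dmat a))
  have e1 : ∀ u, φ (gDg n u) = ψ (cv n (gDg n u)) := fun u => hψφ _ (gDg_anti n u)
  have e2 : ∀ a : Fin n → ℝ, φ (Dmat a) = ψ (cc n fun i => a i ^ 2) := fun a => by rw [← cv_Dmat]; exact hψφ _ (Dmat_anti n a)
  have h3 := integral_map (μ := jm (2 * n) ν μ) hc1.measurable.aemeasurable (f := ψ) hψ.aestronglyMeasurable
  have h4 := integral_map (μ := mb n ν μ) hc2.measurable.aemeasurable (f := ψ) hψ.aestronglyMeasurable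
  rw [key_eq n ν μ hν hμ, integral_smul_measure, h4] at h3
  simp_rw [← e1, ← e2] at h3
  rw [h1, h2, smul_eq_mul] at h3
  rw [← hZ]
  show _ * (∫ u in jacDom n, φ (gDg n u) * jacDens n ν μ u) = _
  rw [← h3, one_div, ← mul_assoc]
  show ((jm (2 * n) ν μ).real Set.univ)⁻¹ * (jm (2 * n) ν μ).real Set.univ * _ = _
  rw [inv_mul_cancel₀ hpos.ne', one_mul]


end
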